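/- Suppose n = p₁⋯p_{t₁}·q₁⋯q_{t₂} is a product of t₁ + t₂ ≥ 1 distinct primes, all congruent to 1 (mod 4), with (2/p_i) = −1 for all i ∈ {1,…,t₁} and (2/q_j) = 1 for all j ∈ {1,…,t₂}. If (2/q_j)₄ = (q_j/2)₄ for all j (in particular when t₂ = 0), then r₂(H) = t₁ + 2t₂; if (2/q_j)₄ ≠ (q_j/2)₄ for at least one j, then r₂(H) = t₁ + 2t₂ − 1. -/

import Mathlib

/-- `ε` is the fundamental unit of the real quadratic field `ℚ(√l)` (viewed inside `ℝ`):
it lies in `ℚ(√l)`, it is a unit of the ring of integers (both `ε` and `ε⁻¹` are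
algebraic integers), `ε > 1`, and it is the smallest such unit. -/
def IsFundamentalUnit (l : ℕ) (ε : ℝ) : Prop :=
  1 < ε ∧ ε ∈ IntermediateField.adjoin ℚ ({Real.sqrt (l : ℝ)} : Set ℝ) ∧
    IsIntegral ℤ ε ∧ IsIntegral ℤ ε⁻¹ ∧
    ∀ x : ℝ, 1 < x → x ∈ IntermediateField.adjoin ℚ ({Real.sqrt (l : ℝ)} : Set ℝ) →
      IsIntegral ℤ x → IsIntegral ℤ x⁻¹ → ε ≤ x

/-- The Legendre symbol `(a/p)`, via Euler's criterion (so that no `Fact p.Prime`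
instance is needed): for an odd prime `p` it is `1` if `a` is a nonzero square mod `p`,
`0` if `p ∣ a`, and `-1` otherwise. -/
def legSym (p : ℕ) (a : ℤ) : ℤ :=
  if (a : ZMod p) ^ ((p - 1) / 2) = 1 then 1 else if (a : ZMod p) = 0 then 0 else -1

/-- The rational fourth power residue symbol `(a/p)₄ ∈ {±1}`, meaningful when
`(a/p) = 1`; it is determined by `(a/p)₄ ≡ a ^ ((p-1)/4) (mod p)`. -/
def quartSym (p : ℕ) (a : ℤ) : ℤ :=
  if (a : ZMod p) ^ ((p - 1) / 4) = 1 then 1 else -1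

/-- The cardinality of the 2-torsion subgroup of the class group of `K`.
For a number field `K` this equals `2 ^ r₂(H)`, where `r₂(H)` is the rank of the
2-class group `H` of `K` (i.e. `dim_{𝔽₂} Cl(K)/Cl(K)²`); in particular
`r₂(H) = r` iff this cardinality is `2 ^ r`. -/
noncomputable def twoTorsCard (K : IntermediateField ℚ ℝ) : ℕ :=
  Nat.card {x : ClassGroup (NumberField.RingOfIntegers K) // x ^ 2 = 1}

section GroupIndex

open Subgroup

theorem Subgroup.relIndex_map_map_of_ker_inf_le {G G' : Type*} [CommGroup G] [CommGroup G']
    (f : G →* G') {H L : Subgroup G} (hHL : H ≤ L) (hker : f.ker ⊓ L ≤ H) :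
    (H.map f).relIndex (L.map f) = H.relIndex L := by
  rw [relIndex_map_map]
  have h1 : L ⊔ f.ker = L ⊔ (H ⊔ f.ker) := by
    rw [← sup_assoc, sup_eq_left.mpr hHL]
  rw [h1, relIndex_sup_right, ← inf_relIndex_right, sup_inf_assoc_of_le _ hHL,
    sup_eq_left.mpr hker]

theorem Subgroup.relIndex_eq_map_mul_ker {G G' : Type*} [CommGroup G] [CommGroup G']
    (f : G →* G') {H L : Subgroup G} (hHL : H ≤ L) :
    H.relIndex L = (H.map f).relIndex (L.map f) * (H ⊓ f.ker).relIndex (L ⊓ f.ker) := by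
  have h1 : H ≤ H ⊔ (L ⊓ f.ker) := le_sup_left
  have h2 : H ⊔ (L ⊓ f.ker) ≤ L := sup_le hHL inf_le_left
  rw [← relIndex_mul_relIndex _ _ _ h1 h2, mul_comm]
  congr 1
  · rw [← relIndex_map_map_of_ker_inf_le f h2]
    · congr 1
      rw [Subgroup.map_sup, sup_eq_left]
      rintro _ ⟨x, hx, rfl⟩
      rw [(MonoidHom.mem_ker).mp hx.2]
      exact one_mem _
    · rw [inf_comm]; exact le_sup_right
  · rw [relIndex_sup_left, ← inf_relIndex_right, ← inf_assoc, inf_eq_left.mpr hHL]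

/-- The norm `x ↦ x * σ x` attached to an endomorphism. -/
def conjNorm {G : Type*} [CommGroup G] (σ : G →* G) : G →* G := MonoidHom.id G * σ

/-- The map `x ↦ x / σ x` attached to an endomorphism. -/
def conjDiv {G : Type*} [CommGroup G] (σ : G →* G) : G →* G := MonoidHom.id G / σ

section
variable {G : Type*} [CommGroup G] (σ : G →* G)

theorem conjNorm_apply (x : G) : conjNorm σ x = x * σ x := rfl

theorem conjDiv_apply (x : G) : conjDiv σ x = x / σ x := rfl

theorem mem_conjDiv_ker {x : G} : x ∈ (conjDiv σ).ker ↔ σ x = x := by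
  rw [MonoidHom.mem_ker, conjDiv_apply, div_eq_one, eq_comm]

theorem conjNorm_mem_ker (hσ : ∀ x, σ (σ x) = x) (x : G) : conjNorm σ x ∈ (conjDiv σ).ker := by
  rw [mem_conjDiv_ker, conjNorm_apply, map_mul, hσ, mul_comm]

theorem conjNorm_conjDiv (hσ : ∀ x, σ (σ x) = x) (x : G) : conjNorm σ (conjDiv σ x) = 1 := by
  rw [conjNorm_apply, conjDiv_apply, map_div, hσ, div_mul_div_cancel, div_self']

theorem conjNorm_of_fixed {x : G} (hx : σ x = x) : conjNorm σ x = x ^ 2 := by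
  rw [conjNorm_apply, hx, sq]

theorem conjDiv_of_norm_one {x : G} (hx : conjNorm σ x = 1) : conjDiv σ x = x ^ 2 := by
  rw [conjNorm_apply] at hx
  rw [conjDiv_apply, ← inv_eq_of_mul_eq_one_right hx, div_inv_eq_mul, sq]
end

variable {G A : Type*} [CommGroup G] [CommGroup A]

theorem card_two_torsion_quotient (P : Subgroup A) :
    Nat.card {x : A ⧸ P // x ^ 2 = 1} = P.relIndex (P.comap (powMonoidHom 2)) := by
  have h1 : P ≤ P.comap (powMonoidHom 2) := fun x hx => by
    rw [mem_comap, powMonoidHom_apply]; exact pow_mem hx 2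
  have key := relIndex_ker (K := P.comap (powMonoidHom 2)) (QuotientGroup.mk' P)
  rw [QuotientGroup.ker_mk'] at key
  rw [key]
  refine Nat.card_congr (Equiv.subtypeEquivRight fun x => ?_)
  obtain ⟨a, rfl⟩ := QuotientGroup.mk'_surjective P x
  rw [← map_pow, mem_map]
  constructor
  · intro h
    refine ⟨a, ?_, rfl⟩
    rw [mem_comap, powMonoidHom_apply]
    exact (QuotientGroup.eq_one_iff _).mp h
  · rintro ⟨b, hb, hab⟩
    rw [map_pow, ← hab, ← map_pow]
    exact (QuotientGroup.eq_one_iff _).mpr hb.out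

/-- Ambiguous class number formula for an involution, in terms of indices of groups of units. -/
theorem ambiguous_class_formula (σ : G →* G) (τ : A →* A) (pr : G →* A)
    (hσ : ∀ x, σ (σ x) = x) (hτ : ∀ x, τ (τ x) = x) (hpr : ∀ x, pr (σ x) = τ (pr x))
    (hG90 : ∀ x, conjNorm σ x = 1 → ∃ y, conjDiv σ y = x)
    (hA90 : ∀ x, conjNorm τ x = 1 → ∃ y, conjDiv τ y = x)
    (hN : ∀ x : A, ∃ a, σ a = a ∧ conjNorm τ x = pr a)
    (E : Subgroup G) (hE : E = pr.ker ⊓ (conjDiv σ).ker)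
    {t : ℕ} (ht : ((conjDiv σ).ker.map pr).relIndex (conjDiv τ).ker = t)
    (hU : ((pr.ker ⊓ (conjNorm σ).ker).map (powMonoidHom 2)).relIndex
      (pr.ker ⊓ (conjNorm σ).ker) = 8) :
    Nat.card {x : A ⧸ pr.range // x ^ 2 = 1} * 8 =
      t * (E.map (powMonoidHom 2)).relIndex (E ⊓ (conjNorm σ).range) := by
  have prD : ∀ x, pr (conjDiv σ x) = conjDiv τ (pr x) := fun x => by
    rw [conjDiv_apply, conjDiv_apply, map_div, hpr]
  have prN : ∀ x, pr (conjNorm σ x) = conjNorm τ (pr x) := fun x => by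
    rw [conjNorm_apply, conjNorm_apply, map_mul, hpr]
  set U := pr.ker with hUdef
  set F := (conjDiv σ).ker with hF
  set W := E.comap (conjNorm σ) with hW
  set J := pr.range.comap (powMonoidHom 2) with hJ
  have hσU : ∀ x ∈ U, σ x ∈ U := fun x hx => by
    rw [hUdef, MonoidHom.mem_ker] at hx ⊢
    rw [hpr, hx, map_one]
  have hPJ : pr.range ≤ J := fun x hx => by
    rw [hJ, mem_comap, powMonoidHom_apply]; exact pow_mem hx 2
  have hJN : ∀ x, conjDiv τ x ∈ pr.range ↔ x ∈ J := by
    intro x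
    obtain ⟨a, -, ha⟩ := hN x
    have : conjDiv τ x = x ^ 2 / pr a := by
      rw [← ha, conjNorm_apply, conjDiv_apply, sq, mul_div_mul_left_eq_div]
    rw [this, hJ, mem_comap, powMonoidHom_apply]
    constructor
    · intro h
      have := mul_mem h (show pr a ∈ pr.range from ⟨a, rfl⟩)
      rwa [div_mul_cancel] at this
    · intro h
      exact div_mem h ⟨a, rfl⟩
  have hFJ : (conjDiv τ).ker ≤ J := fun x hx => by
    rw [← hJN, hx.out]; exact one_mem _
  have s1 := relIndex_eq_map_mul_ker (conjDiv τ) hPJ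
  rw [inf_eq_right.mpr hFJ] at s1
  have e1 : pr.range.map (conjDiv τ) = (conjNorm σ).ker.map pr := by
    ext x
    constructor
    · rintro ⟨_, ⟨y, rfl⟩, rfl⟩
      exact ⟨conjDiv σ y, conjNorm_conjDiv σ hσ y, prD y⟩
    · rintro ⟨y, hy, rfl⟩
      obtain ⟨z, rfl⟩ := hG90 y hy
      exact ⟨pr z, ⟨z, rfl⟩, (prD z).symm⟩
  have e2 : J.map (conjDiv τ) = W.map pr := by
    ext x
    constructor
    · rintro ⟨y, hy, rfl⟩
      obtain ⟨a, ha⟩ := (hJN y).mpr hy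
      refine ⟨a, ?_, ha⟩
      rw [hW, SetLike.mem_coe, mem_comap, hE]
      refine Subgroup.mem_inf.mpr ⟨?_, conjNorm_mem_ker σ hσ a⟩
      rw [hUdef, MonoidHom.mem_ker, prN, ha, conjNorm_conjDiv τ hτ]
    · rintro ⟨y, hy, rfl⟩
      have hy' : conjNorm σ y ∈ U := by
        have : conjNorm σ y ∈ E := hy
        rw [hE] at this; exact this.1
      have h1 : conjNorm τ (pr y) = 1 := by rw [← prN]; exact hy'
      obtain ⟨z, hz⟩ := hA90 _ h1
      exact ⟨z, (hJN z).mp ⟨y, hz.symm⟩, hz⟩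
  have hUW : U ≤ W := fun x hx => by
    rw [hW, mem_comap, hE]
    exact ⟨mul_mem hx (hσU x hx), conjNorm_mem_ker σ hσ x⟩
  have hkW : (conjNorm σ).ker ≤ W := fun x hx => by
    rw [hW, mem_comap, hx.out]; exact one_mem _
  have e3 : ((conjNorm σ).ker.map pr).relIndex (W.map pr) =
      (U.map (conjNorm σ)).relIndex (E ⊓ (conjNorm σ).range) := by
    have : E ⊓ (conjNorm σ).range = W.map (conjNorm σ) := by
      rw [hW, map_comap_eq, inf_comm]
    rw [this, relIndex_map_map, relIndex_map_map, ← hUdef, sup_comm, sup_eq_left.mpr hUW,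
      sup_eq_left.mpr hkW]
  rw [e1, e2, e3] at s1
  -- strongly ambiguous classes
  set C := U.comap (conjDiv σ) with hC
  have hUC : U ≤ C := fun x hx => by
    rw [hC, mem_comap]; exact div_mem hx (hσU x hx)
  have hFC : F ≤ C := fun x hx => by
    rw [hC, mem_comap, hx.out]; exact one_mem _
  have e4 : pr.range ⊓ (conjDiv τ).ker = C.map pr := by
    ext x
    constructor
    · rintro ⟨⟨y, rfl⟩, hy⟩
      refine ⟨y, ?_, rfl⟩
      rw [SetLike.mem_coe, hC, mem_comap, hUdef, MonoidHom.mem_ker, prD]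
      exact hy
    · rintro ⟨y, hy, rfl⟩
      refine Subgroup.mem_inf.mpr ⟨⟨y, rfl⟩, ?_⟩
      rw [MonoidHom.mem_ker, ← prD]
      exact hy
  have e5 : (F.map pr).relIndex (C.map pr) = (U.map (conjDiv σ)).relIndex (U ⊓ (conjNorm σ).ker) := by
    have : U ⊓ (conjNorm σ).ker = C.map (conjDiv σ) := by
      rw [hC, map_comap_eq, inf_comm]
      congr 1
      ext x
      exact ⟨fun hx => hG90 x hx, by rintro ⟨y, rfl⟩; exact conjNorm_conjDiv σ hσ y⟩
    rw [this, relIndex_map_map, relIndex_map_map, ← hUdef, ← hF, sup_comm, sup_eq_left.mpr hUC,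
      sup_eq_left.mpr hFC]
  have s2 : (F.map pr).relIndex (C.map pr) * (C.map pr).relIndex (conjDiv τ).ker = t := by
    rw [← ht]
    refine relIndex_mul_relIndex _ _ _ (map_mono hFC) ?_
    rw [← e4]; exact inf_le_right
  rw [e5] at s2
  rw [e4] at s1
  -- units
  set U₁ := U ⊓ (conjNorm σ).ker with hU₁
  have hEU : E ≤ U := by rw [hE]; exact inf_le_left
  have e6 : U₁.map (powMonoidHom 2) = (U₁ ⊔ E).map (conjDiv σ) := by
    rw [Subgroup.map_sup]
    have h1 : E.map (conjDiv σ) = ⊥ := by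
      rw [eq_bot_iff, Subgroup.map_le_iff_le_comap]
      intro x hx
      rw [hE] at hx
      exact hx.2
    rw [h1, sup_bot_eq]
    ext x
    constructor
    · rintro ⟨y, hy, rfl⟩
      exact ⟨y, hy, conjDiv_of_norm_one σ hy.2⟩
    · rintro ⟨y, hy, rfl⟩
      exact ⟨y, hy, (conjDiv_of_norm_one σ hy.2).symm⟩
  have e7 : (U₁ ⊔ E).map (conjNorm σ) = E.map (powMonoidHom 2) := by
    rw [Subgroup.map_sup]
    have h1 : U₁.map (conjNorm σ) = ⊥ := by
      rw [eq_bot_iff, Subgroup.map_le_iff_le_comap]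
      intro x hx
      exact hx.2
    rw [h1, bot_sup_eq]
    have h2 : ∀ x ∈ E, conjNorm σ x = x ^ 2 := fun x hx => by
      rw [hE] at hx
      exact conjNorm_of_fixed σ ((mem_conjDiv_ker σ).mp hx.2)
    ext x
    constructor
    · rintro ⟨y, hy, rfl⟩
      exact ⟨y, hy, (h2 y hy).symm⟩
    · rintro ⟨y, hy, rfl⟩
      exact ⟨y, hy, h2 y hy⟩
  have hVU : U₁ ⊔ E ≤ U := sup_le inf_le_left hEU
  have e8 : ((U₁ ⊔ E).map (conjDiv σ)).relIndex (U.map (conjDiv σ)) = (U₁ ⊔ E).relIndex U := by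
    refine relIndex_map_map_of_ker_inf_le _ hVU ?_
    rw [inf_comm, ← hE]; exact le_sup_right
  have e9 : ((U₁ ⊔ E).map (conjNorm σ)).relIndex (U.map (conjNorm σ)) = (U₁ ⊔ E).relIndex U := by
    refine relIndex_map_map_of_ker_inf_le _ hVU ?_
    rw [inf_comm]; exact le_sup_left
  have hDU : U.map (conjDiv σ) ≤ U₁ := by
    rintro _ ⟨x, hx, rfl⟩
    exact Subgroup.mem_inf.mpr ⟨div_mem hx (hσU x hx), conjNorm_conjDiv σ hσ x⟩
  have s3 : (U₁.map (powMonoidHom 2)).relIndex (U.map (conjDiv σ)) *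
      (U.map (conjDiv σ)).relIndex U₁ = 8 := by
    rw [← hU]
    refine relIndex_mul_relIndex _ _ _ ?_ hDU
    rw [e6]; exact map_mono hVU
  have hNU : U.map (conjNorm σ) ≤ E ⊓ (conjNorm σ).range := by
    rintro _ ⟨x, hx, rfl⟩
    exact ⟨hUW hx, x, rfl⟩
  have s4 : (E.map (powMonoidHom 2)).relIndex (U.map (conjNorm σ)) *
      (U.map (conjNorm σ)).relIndex (E ⊓ (conjNorm σ).range) =
      (E.map (powMonoidHom 2)).relIndex (E ⊓ (conjNorm σ).range) := by
    refine relIndex_mul_relIndex _ _ _ ?_ hNU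
    rw [← e7]; exact map_mono hVU
  rw [e6, e8, ← e9, e7] at s3
  rw [card_two_torsion_quotient, s1, ← s4, ← s2, ← s3]
  ring

/-- The subgroup of squares of the norm-one units has index `8` as soon as the squares have index
`16` in all units and the fixed units have rank one. -/
theorem relIndex_sq_norm_one_units (σ : G →* G) (U E : Subgroup G)
    (hE : E = U ⊓ (conjDiv σ).ker) (hUσ : ∀ x ∈ U, σ x ∈ U) (hσ : ∀ x, σ (σ x) = x)
    (h2 : ∀ x ∈ U, x ^ 2 = 1 → σ x = x) (h4 : ∀ x ∈ E, x ^ 4 = 1 → x ^ 2 = 1)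
    (hU : (U.map (powMonoidHom 2)).relIndex U = 16)
    (hEfin : (E.map (powMonoidHom 2)).relIndex E ≠ 0)
    (hE4 : ((E.map (powMonoidHom 2)).map (powMonoidHom 2)).relIndex
      (E.map (powMonoidHom 2)) = 2) :
    ((U ⊓ (conjNorm σ).ker).map (powMonoidHom 2)).relIndex (U ⊓ (conjNorm σ).ker) = 8 := by
  set U₁ := U ⊓ (conjNorm σ).ker with hU₁
  set S : G →* G := powMonoidHom 2 with hS
  have hEU : E ≤ U := by rw [hE]; exact inf_le_left
  have hfixE : ∀ x ∈ E, σ x = x := fun x hx => by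
    rw [hE] at hx
    exact (mem_conjDiv_ker σ).mp hx.2
  have h2E : ∀ x ∈ U, x ^ 2 = 1 → x ∈ E := fun x hx h => by
    rw [hE]; exact ⟨hx, (mem_conjDiv_ker σ).mpr (h2 x hx h)⟩
  have hVU : U₁ ⊔ E ≤ U := sup_le inf_le_left hEU
  set V := U₁ ⊔ E with hV
  have hU₁V : U₁ ≤ V := le_sup_left
  have hEV : E ≤ V := le_sup_right
  have hU1map : U₁.map (conjNorm σ) = ⊥ := by
    rw [eq_bot_iff, Subgroup.map_le_iff_le_comap]
    intro x hx
    exact hx.2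
  have hEmap : ∀ H ≤ E, H.map (conjNorm σ) = H.map S := fun H hH => by
    have h2 : ∀ x ∈ H, conjNorm σ x = x ^ 2 := fun x hx => conjNorm_of_fixed σ (hfixE x (hH hx))
    ext x
    constructor
    · rintro ⟨y, hy, rfl⟩
      exact ⟨y, hy, (h2 y hy).symm⟩
    · rintro ⟨y, hy, rfl⟩
      exact ⟨y, hy, h2 y hy⟩
  have hsqle : ∀ H : Subgroup G, H.map S ≤ H := by
    rintro H _ ⟨x, hx, rfl⟩
    exact pow_mem hx 2
  have e9 : (V.map (conjNorm σ)).relIndex (U.map (conjNorm σ)) = V.relIndex U := by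
    refine relIndex_map_map_of_ker_inf_le _ hVU ?_
    rw [inf_comm]; exact hU₁V
  have hVfin : V.relIndex U ≠ 0 := by
    rw [← e9, Subgroup.map_sup, hU1map, bot_sup_eq, hEmap E le_rfl]
    refine fun h0 => hEfin (relIndex_eq_zero_of_le_right ?_ h0)
    rintro _ ⟨x, hx, rfl⟩
    rw [hE]
    exact Subgroup.mem_inf.mpr ⟨mul_mem hx (hUσ x hx), conjNorm_mem_ker σ hσ x⟩
  have e10 : (V.map S).relIndex (U.map S) = V.relIndex U := by
    refine relIndex_map_map_of_ker_inf_le _ hVU ?_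
    rintro x ⟨hx, hxU⟩
    exact hEV (h2E x hxU hx)
  have e11 : (V.map S).relIndex V = 16 := by
    have h1 := relIndex_mul_relIndex _ _ _ (hsqle V) hVU
    have h2 := relIndex_mul_relIndex _ _ _ (map_mono (f := S) hVU) (hsqle U)
    rw [← h2, e10, hU, mul_comm] at h1
    exact Nat.eq_of_mul_eq_mul_left (Nat.pos_of_ne_zero hVfin) h1
  have s := relIndex_eq_map_mul_ker (conjNorm σ) (hsqle V)
  have e12 : (V.map S).map (conjNorm σ) = (E.map S).map S := by
    rw [hV, Subgroup.map_sup, Subgroup.map_sup, hEmap _ (hsqle E)]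
    have : (U₁.map S).map (conjNorm σ) = ⊥ := by
      rw [eq_bot_iff, ← hU1map]
      exact map_mono (hsqle U₁)
    rw [this, bot_sup_eq]
  have e13 : V.map (conjNorm σ) = E.map S := by
    rw [hV, Subgroup.map_sup, hU1map, bot_sup_eq, hEmap E le_rfl]
  have e14 : V ⊓ (conjNorm σ).ker = U₁ :=
    le_antisymm (inf_le_inf_right _ hVU) (le_inf hU₁V inf_le_right)
  have e15 : V.map S ⊓ (conjNorm σ).ker = U₁.map S := by
    apply le_antisymm
    · rintro _ ⟨⟨v, hv, rfl⟩, hv1⟩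
      obtain ⟨u, hu, e, he, rfl⟩ := Subgroup.mem_sup.mp hv
      refine ⟨u, hu, ?_⟩
      have h1 : conjNorm σ (S (u * e)) = e ^ 4 := by
        rw [hS, powMonoidHom_apply, map_pow, map_mul, hu.2.out, one_mul,
          conjNorm_of_fixed σ (hfixE e he), ← pow_mul]
      have h3 : e ^ 2 = 1 := h4 e he (by rw [← h1]; exact hv1)
      rw [hS, powMonoidHom_apply, powMonoidHom_apply, mul_pow, h3, mul_one]
    · exact le_inf (map_mono hU₁V) ((hsqle U₁).trans inf_le_right)
  rw [e11, e12, e13, e14, e15, hE4] at s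
  omega

/-- The ambiguous ideals modulo the ideals coming from the base. -/
theorem relIndex_ambiguous (σ : G →* G) (τ : A →* A) (pr : G →* A)
    (hpr : ∀ x, pr (σ x) = τ (pr x))
    (hN : ∀ x : A, ∃ a, σ a = a ∧ conjNorm τ x = pr a)
    (h2 : ∀ x : A, x ^ 2 = 1 → x = 1)
    (F : Subgroup G) (hF : F = (conjDiv σ).ker) :
    (F.map pr).relIndex (conjDiv τ).ker =
      (F.map (powMonoidHom 2) ⊔ (pr.ker ⊓ F)).relIndex
        (F ⊓ ((⊤ : Subgroup A).map (powMonoidHom 2)).comap pr) := by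
  have hinj : Function.Injective (powMonoidHom 2 : A →* A) := by
    rw [injective_iff_map_eq_one]
    intro a ha
    exact h2 a ha
  have hfixF : ∀ x, x ∈ F ↔ σ x = x := fun x => by rw [hF, mem_conjDiv_ker]
  rw [← relIndex_map_map_of_injective _ _ hinj]
  set B := F ⊓ ((⊤ : Subgroup A).map (powMonoidHom 2)).comap pr with hB
  have hle : F.map (powMonoidHom 2) ⊔ (pr.ker ⊓ F) ≤ B := by
    apply sup_le
    · rintro _ ⟨x, hx, rfl⟩
      refine Subgroup.mem_inf.mpr ⟨pow_mem hx 2, ?_⟩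
      exact ⟨pr x, Subgroup.mem_top _, (map_pow pr x 2).symm⟩
    · rintro x ⟨hx1, hx2⟩
      refine Subgroup.mem_inf.mpr ⟨hx2, ?_⟩
      exact ⟨1, Subgroup.mem_top _, by rw [map_one]; exact hx1.out.symm⟩
  rw [← relIndex_map_map_of_ker_inf_le pr hle]
  · congr 1
    · rw [Subgroup.map_sup, Subgroup.map_map, Subgroup.map_map]
      have h1 : (pr.ker ⊓ F).map pr = ⊥ := by
        rw [eq_bot_iff, Subgroup.map_le_iff_le_comap]
        exact fun x hx => hx.1
      rw [h1, sup_bot_eq]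
      congr 1
      ext x
      exact (map_pow pr x 2).symm
    · ext x
      constructor
      · rintro ⟨I, hI, rfl⟩
        obtain ⟨a, ha, haI⟩ := hN I
        have hIτ := (mem_conjDiv_ker τ).mp hI
        rw [conjNorm_of_fixed τ hIτ] at haI
        exact ⟨a, Subgroup.mem_inf.mpr ⟨(hfixF a).mpr ha, I, Subgroup.mem_top _, haI⟩, haI.symm⟩
      · rintro ⟨a, ⟨ha, I, -, hI⟩, rfl⟩
        refine ⟨I, ?_, hI⟩
        rw [SetLike.mem_coe, mem_conjDiv_ker]
        apply hinj
        rw [hI, powMonoidHom_apply, ← map_pow]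
        rw [powMonoidHom_apply] at hI
        rw [hI, ← hpr, (hfixF a).mp ha]
  · rintro x ⟨hx1, hx2⟩
    exact le_sup_right (α := Subgroup G) (Subgroup.mem_inf.mpr ⟨hx1, hx2.1⟩)

end GroupIndex

section ZRootTwo

open Zsqrtd

/-- The ring `ℤ[√2]`. -/
abbrev ZRootTwo : Type := ℤ√2

namespace ZRootTwo

theorem norm_def' (x : ZRootTwo) : x.norm = x.re ^ 2 - 2 * x.im ^ 2 := by
  rw [Zsqrtd.norm_def]; ring

theorem two_ne_sq (n : ℤ) : (2 : ℤ) ≠ n * n := by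
  intro h
  have h1 : n ≤ 1 := by nlinarith
  have h2 : -1 ≤ n := by nlinarith
  interval_cases n <;> omega

theorem norm_eq_zero_iff' {x : ZRootTwo} : x.norm = 0 ↔ x = 0 := Zsqrtd.norm_eq_zero two_ne_sq x

instance : NoZeroDivisors ZRootTwo where
  eq_zero_or_eq_zero_of_mul_eq_zero {a b} h := by
    have h1 : a.norm * b.norm = 0 := by rw [← Zsqrtd.norm_mul, h, Zsqrtd.norm_zero]
    rcases mul_eq_zero.mp h1 with h | h
    · exact Or.inl (norm_eq_zero_iff'.mp h)
    · exact Or.inr (norm_eq_zero_iff'.mp h)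

instance : IsDomain ZRootTwo := NoZeroDivisors.to_isDomain _

theorem exists_round (a n : ℤ) (hn : n ≠ 0) : ∃ q : ℤ, 2 * |a - q * n| ≤ |n| := by
  have h1 := Int.emod_add_mul_ediv a n
  have h2 := Int.emod_nonneg a hn
  have h3 := Int.emod_lt_abs a hn
  by_cases h : 2 * (a % n) ≤ |n|
  · refine ⟨a / n, ?_⟩
    have : a - a / n * n = a % n := by linarith [mul_comm (a / n) n]
    rwa [this, abs_of_nonneg h2]
  · rcases lt_or_gt_of_ne hn with h4 | h4
    · refine ⟨a / n - 1, ?_⟩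
      have : a - (a / n - 1) * n = a % n + n := by linarith [mul_comm (a / n) n]
      rw [abs_of_neg h4] at *
      rw [this, abs_of_neg (by linarith)]
      linarith
    · refine ⟨a / n + 1, ?_⟩
      have : a - (a / n + 1) * n = a % n - n := by linarith [mul_comm (a / n) n]
      rw [abs_of_pos h4] at *
      rw [this, abs_of_neg (by linarith)]
      linarith

theorem exists_norm_sub_mul_lt (a b : ZRootTwo) (hb : b ≠ 0) :
    ∃ q : ZRootTwo, (a - q * b).norm.natAbs < b.norm.natAbs := by
  have hN : b.norm ≠ 0 := fun h => hb (norm_eq_zero_iff'.mp h)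
  obtain ⟨x, hx⟩ := exists_round (a * star b).re b.norm hN
  obtain ⟨y, hy⟩ := exists_round (a * star b).im b.norm hN
  refine ⟨⟨x, y⟩, ?_⟩
  set r := a - ⟨x, y⟩ * b with hr
  have h1 : r * star b = a * star b - ⟨x, y⟩ * (b.norm : ZRootTwo) := by
    rw [Zsqrtd.norm_eq_mul_conj, hr]; ring
  have h2 : (r * star b).re = (a * star b).re - x * b.norm := by
    rw [h1]; simp
  have h3 : (r * star b).im = (a * star b).im - y * b.norm := by
    rw [h1]; simp
  rw [← h2] at hx
  rw [← h3] at hy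
  have h4 : r.norm * b.norm = (r * star b).re ^ 2 - 2 * (r * star b).im ^ 2 := by
    rw [← norm_def', Zsqrtd.norm_mul, Zsqrtd.norm_conj]
  generalize (r * star b).re = u at *
  generalize (r * star b).im = v at *
  zify
  have hpos : 0 < |b.norm| := abs_pos.mpr hN
  have h5 : |r.norm| * |b.norm| < |b.norm| * |b.norm| := by
    rw [← abs_mul, h4]
    generalize |b.norm| = m at *
    have hu : 4 * u ^ 2 ≤ m ^ 2 := by
      rw [← sq_abs u]; nlinarith [abs_nonneg u]
    have hv : 4 * v ^ 2 ≤ m ^ 2 := by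
      rw [← sq_abs v]; nlinarith [abs_nonneg v]
    rw [abs_lt]
    constructor <;> nlinarith [sq_nonneg u, sq_nonneg v]
  exact lt_of_mul_lt_mul_right h5 hpos.le

instance : IsPrincipalIdealRing ZRootTwo where
  principal I := by
    classical
    by_cases hI : I = ⊥
    · rw [hI]; exact bot_isPrincipal
    obtain ⟨b0, hb0, hb0'⟩ := Submodule.exists_mem_ne_zero_of_ne_bot hI
    have hex : ∃ n : ℕ, ∃ b ∈ I, b ≠ 0 ∧ b.norm.natAbs = n := ⟨_, b0, hb0, hb0', rfl⟩
    obtain ⟨b, hb, hb', hbn⟩ := Nat.find_spec hex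
    refine ⟨b, le_antisymm (fun a ha => ?_) ?_⟩
    · obtain ⟨q, hq⟩ := exists_norm_sub_mul_lt a b hb'
      rw [Submodule.mem_span_singleton]
      refine ⟨q, ?_⟩
      by_contra hne
      have hmem : a - q * b ∈ I := I.sub_mem ha (I.mul_mem_left q hb)
      have hne' : a - q * b ≠ 0 := fun h => hne (sub_eq_zero.mp h).symm
      have := Nat.find_min' hex ⟨a - q * b, hmem, hne', rfl⟩
      omega
    · rw [Submodule.span_singleton_le_iff_mem]; exact hb

/-- The fundamental unit `1 + √2`, as an element of `ℤ[√2]`. -/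
def eps : ZRootTwo := ⟨1, 1⟩

theorem eps_mul : eps * ⟨-1, 1⟩ = 1 := by decide

theorem norm_eps : eps.norm = -1 := by decide

theorem isUnit_eps : IsUnit eps := IsUnit.of_mul_eq_one _ eps_mul

/-- The fundamental unit `1 + √2`. -/
noncomputable def epsUnit : ZRootTwoˣ := isUnit_eps.unit

theorem val_epsUnit : (epsUnit : ZRootTwo) = eps := rfl

theorem neg_one_not_sq (v : ZRootTwo) : v ^ 2 ≠ -1 := by
  intro h
  have h1 := congrArg Zsqrtd.re h
  simp [sq] at h1
  nlinarith [sq_nonneg v.re, sq_nonneg v.im]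

theorem eps_not_sq (v : ZRootTwo) : v ^ 2 ≠ eps := by
  intro h
  have h1 := congrArg Zsqrtd.norm h
  rw [norm_eps, sq, Zsqrtd.norm_mul] at h1
  nlinarith [sq_nonneg v.norm]

theorem neg_eps_not_sq (v : ZRootTwo) : v ^ 2 ≠ -eps := by
  intro h
  have h1 := congrArg Zsqrtd.norm h
  rw [Zsqrtd.norm_neg, norm_eps, sq, Zsqrtd.norm_mul] at h1
  nlinarith [sq_nonneg v.norm]

theorem unit_norm_sq (u : ZRootTwoˣ) : (u : ZRootTwo).norm = 1 ∨ (u : ZRootTwo).norm = -1 := by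
  have := (Zsqrtd.isUnit_iff_norm_isUnit (u : ZRootTwo)).mp u.isUnit
  exact Int.isUnit_iff.mp this

/-- Every unit of `ℤ[√2]` is, up to squares, one of `±1`, `±ε`. -/
theorem unit_mod_squares (u : ZRootTwoˣ) : ∃ v : ZRootTwoˣ,
    u = v ^ 2 ∨ u = -v ^ 2 ∨ u = epsUnit * v ^ 2 ∨ u = -(epsUnit * v ^ 2) := by
  have key : ∀ n : ℕ, ∀ u : ZRootTwoˣ, (u : ZRootTwo).im.natAbs = n → ∃ v : ZRootTwoˣ,
    u = v ^ 2 ∨ u = -v ^ 2 ∨ u = epsUnit * v ^ 2 ∨ u = -(epsUnit * v ^ 2) := by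
    intro n
    induction n using Nat.strong_induction_on with
    | _ n ih =>
    intro u hu
    have hnorm : (u : ZRootTwo).re ^ 2 - 2 * (u : ZRootTwo).im ^ 2 = 1 ∨
        (u : ZRootTwo).re ^ 2 - 2 * (u : ZRootTwo).im ^ 2 = -1 := by
      rw [← norm_def']; exact unit_norm_sq u
    have him1 : ((u * epsUnit : ZRootTwoˣ) : ZRootTwo).im =
        (u : ZRootTwo).re + (u : ZRootTwo).im := by
      rw [Units.val_mul, val_epsUnit, eps]; simp
    have him2 : ((u * epsUnit⁻¹ : ZRootTwoˣ) : ZRootTwo).im =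
        (u : ZRootTwo).re - (u : ZRootTwo).im := by
      have : ((epsUnit⁻¹ : ZRootTwoˣ) : ZRootTwo) = ⟨-1, 1⟩ :=
        Units.inv_eq_of_mul_eq_one_right eps_mul
      rw [Units.val_mul, this]; simp; ring
    by_cases h0 : (u : ZRootTwo).im = 0
    · rw [h0] at hnorm
      have hre : (u : ZRootTwo).re = 1 ∨ (u : ZRootTwo).re = -1 := by
        refine mul_self_eq_one_iff.mp ?_
        rcases hnorm with h | h
        · linarith
        · nlinarith [sq_nonneg (u : ZRootTwo).re]
      refine ⟨1, ?_⟩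
      rcases hre with h | h
      · left; ext <;> simp [h, h0]
      · right; left; ext <;> simp [h, h0]
    · have hb : 1 ≤ (u : ZRootTwo).im ^ 2 := by
        have : 0 < (u : ZRootTwo).im ^ 2 := by positivity
        linarith
      by_cases hs : 0 ≤ (u : ZRootTwo).re * (u : ZRootTwo).im
      · obtain ⟨v, hv⟩ := ih _ (by
          rw [← hu, him2]
          generalize (u : ZRootTwo).re = a at *
          generalize (u : ZRootTwo).im = b at *
          zify
          rw [← sq_lt_sq]
          rcases hnorm with h | h <;> nlinarith) (u * epsUnit⁻¹) rfl
        simp only [mul_inv_eq_iff_eq_mul] at hv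
        rcases hv with h | h | h | h
        · exact ⟨v, Or.inr (Or.inr (Or.inl (by rw [h, mul_comm])))⟩
        · exact ⟨v, Or.inr (Or.inr (Or.inr (by rw [h, neg_mul, mul_comm])))⟩
        · exact ⟨epsUnit * v, Or.inl (by rw [h, mul_pow, sq epsUnit]; ac_rfl)⟩
        · refine ⟨epsUnit * v, Or.inr (Or.inl ?_)⟩
          rw [h, mul_pow, sq epsUnit, neg_mul]; congr 1; ac_rfl
      · obtain ⟨v, hv⟩ := ih _ (by
          rw [← hu, him1]
          generalize (u : ZRootTwo).re = a at *
          generalize (u : ZRootTwo).im = b at *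
          zify
          rw [← sq_lt_sq]
          rcases hnorm with h | h <;> nlinarith) (u * epsUnit) rfl
        have e1 : epsUnit * (v * epsUnit⁻¹) ^ 2 = v ^ 2 * epsUnit⁻¹ := by
          rw [mul_pow, sq epsUnit⁻¹, mul_left_comm, mul_inv_cancel_left]
        rcases hv with h | h | h | h
        · refine ⟨v * epsUnit⁻¹, Or.inr (Or.inr (Or.inl ?_))⟩
          rw [e1, ← h, mul_inv_cancel_right]
        · refine ⟨v * epsUnit⁻¹, Or.inr (Or.inr (Or.inr ?_))⟩
          rw [e1, ← neg_mul, ← h, mul_inv_cancel_right]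
        · exact ⟨v, Or.inl (by rw [mul_comm] at h; exact mul_left_cancel h)⟩
        · refine ⟨v, Or.inr (Or.inl ?_)⟩
          rw [mul_comm, ← mul_neg] at h; exact mul_left_cancel h
  exact key _ u rfl

end ZRootTwo

end ZRootTwo

section ConjIdeal

open NumberField nonZeroDivisors

variable {K : Type*} [Field K] [NumberField K]

/-- The action of an automorphism of `K` on the fractional ideals of `K`. -/
noncomputable def conjIdeal (σ : K ≃+* K) :
    FractionalIdeal (𝓞 K)⁰ K ≃+* FractionalIdeal (𝓞 K)⁰ K :=
  FractionalIdeal.ringEquivOfRingEquiv K K (RingOfIntegers.mapRingEquiv σ)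

theorem ringEquivOfRingEquiv_mapRingEquiv (σ : K ≃+* K) (x : K) :
    IsFractionRing.ringEquivOfRingEquiv (K := K) (L := K) (RingOfIntegers.mapRingEquiv σ) x
      = σ x := by
  obtain ⟨a, b, _, rfl⟩ := IsFractionRing.div_surjective (A := 𝓞 K) x
  rw [map_div₀, map_div₀, IsFractionRing.ringEquivOfRingEquiv_algebraMap,
    IsFractionRing.ringEquivOfRingEquiv_algebraMap]
  rfl

theorem apply_mem_conjIdeal (σ : K ≃+* K) (I : FractionalIdeal (𝓞 K)⁰ K) (x : K) :
    σ x ∈ conjIdeal σ I ↔ x ∈ I := by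
  have key : ∀ y, y ∈ conjIdeal σ I ↔ ∃ x ∈ I, σ x = y := by
    intro y
    rw [← FractionalIdeal.mem_coe, ← FractionalIdeal.val_eq_coe, conjIdeal,
      FractionalIdeal.ringEquivOfRingEquiv_apply_val, Submodule.mem_map]
    constructor
    · rintro ⟨x, hx, rfl⟩
      exact ⟨x, hx, (ringEquivOfRingEquiv_mapRingEquiv σ x).symm⟩
    · rintro ⟨x, hx, rfl⟩
      exact ⟨x, hx, ringEquivOfRingEquiv_mapRingEquiv σ x⟩
  rw [key]
  constructor
  · rintro ⟨x', h, h'⟩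
    rwa [← σ.injective h']
  · exact fun h => ⟨x, h, rfl⟩

theorem mem_conjIdeal {σ : K ≃+* K} (hσ : ∀ x, σ (σ x) = x) (I : FractionalIdeal (𝓞 K)⁰ K)
    (x : K) : x ∈ conjIdeal σ I ↔ σ x ∈ I := by
  rw [← apply_mem_conjIdeal σ I (σ x), hσ]

theorem conjIdeal_conjIdeal {σ : K ≃+* K} (hσ : ∀ x, σ (σ x) = x)
    (I : FractionalIdeal (𝓞 K)⁰ K) : conjIdeal σ (conjIdeal σ I) = I := by
  ext x
  rw [mem_conjIdeal hσ, mem_conjIdeal hσ, hσ]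

theorem conjIdeal_spanSingleton (σ : K ≃+* K) (x : K) :
    conjIdeal σ (FractionalIdeal.spanSingleton (𝓞 K)⁰ x) =
      FractionalIdeal.spanSingleton (𝓞 K)⁰ (σ x) := by
  ext y
  obtain ⟨y, rfl⟩ := σ.surjective y
  rw [apply_mem_conjIdeal, FractionalIdeal.mem_spanSingleton, FractionalIdeal.mem_spanSingleton]
  constructor
  · rintro ⟨z, rfl⟩
    refine ⟨RingOfIntegers.mapRingEquiv σ z, ?_⟩
    rw [Algebra.smul_def, Algebra.smul_def, map_mul]
    rfl
  · rintro ⟨z, hz⟩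
    refine ⟨(RingOfIntegers.mapRingEquiv σ).symm z, σ.injective ?_⟩
    rw [← hz, Algebra.smul_def, Algebra.smul_def, map_mul]
    congr 1
    exact σ.apply_symm_apply _

/-- The action of an automorphism of `K` on the group of invertible fractional ideals. -/
noncomputable def conjIdealUnits (σ : K ≃+* K) :
    (FractionalIdeal (𝓞 K)⁰ K)ˣ →* (FractionalIdeal (𝓞 K)⁰ K)ˣ :=
  Units.map (conjIdeal σ : FractionalIdeal (𝓞 K)⁰ K →* FractionalIdeal (𝓞 K)⁰ K)

theorem val_conjIdealUnits (σ : K ≃+* K) (I : (FractionalIdeal (𝓞 K)⁰ K)ˣ) :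
    (conjIdealUnits σ I : FractionalIdeal (𝓞 K)⁰ K) = conjIdeal σ I := rfl

theorem conjIdealUnits_conjIdealUnits {σ : K ≃+* K} (hσ : ∀ x, σ (σ x) = x)
    (I : (FractionalIdeal (𝓞 K)⁰ K)ˣ) : conjIdealUnits σ (conjIdealUnits σ I) = I :=
  Units.ext (conjIdeal_conjIdeal hσ _)

/-- The action of an automorphism of `K` on `Kˣ`. -/
def conjUnits (σ : K ≃+* K) : Kˣ →* Kˣ := Units.map (σ : K →* K)

omit [NumberField K] in
theorem val_conjUnits (σ : K ≃+* K) (x : Kˣ) : (conjUnits σ x : K) = σ x := rfl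

theorem toPrincipalIdeal_conjUnits (σ : K ≃+* K) (x : Kˣ) :
    toPrincipalIdeal (𝓞 K) K (conjUnits σ x) = conjIdealUnits σ (toPrincipalIdeal (𝓞 K) K x) := by
  rw [toPrincipalIdeal_eq_iff, val_conjIdealUnits, coe_toPrincipalIdeal, conjIdeal_spanSingleton,
    val_conjUnits]

omit [NumberField K] in
/-- Hilbert's Theorem 90 for a quadratic extension. -/
theorem exists_conjDiv_eq {σ : K ≃+* K} {θ : K} (hθ : θ ≠ 0)
    (hσθ : σ θ = -θ) (x : Kˣ) (hx : conjNorm (conjUnits σ) x = 1) :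
    ∃ y, conjDiv (conjUnits σ) y = x := by
  have hmul : (x : K) * σ x = 1 := congrArg Units.val hx
  by_cases h : (x : K) = -1
  · refine ⟨Units.mk0 θ hθ, ?_⟩
    rw [conjDiv_apply, div_eq_iff_eq_mul]
    ext
    rw [Units.val_mul, val_conjUnits, Units.val_mk0, hσθ, h]; ring
  · have h1 : (1 : K) + x ≠ 0 := fun h' => h (by linear_combination h')
    refine ⟨Units.mk0 _ h1, ?_⟩
    rw [conjDiv_apply, div_eq_iff_eq_mul]
    ext
    rw [Units.val_mul, val_conjUnits, Units.val_mk0, map_add, map_one]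
    linear_combination -hmul

/-- Hilbert's Theorem 90 for fractional ideals. -/
theorem exists_conjDiv_ideal_eq {σ : K ≃+* K}
    (I : (FractionalIdeal (𝓞 K)⁰ K)ˣ) (hI : conjNorm (conjIdealUnits σ) I = 1) :
    ∃ J, conjDiv (conjIdealUnits σ) J = I := by
  have hI' : (I : FractionalIdeal (𝓞 K)⁰ K) * conjIdeal σ I = 1 := congrArg Units.val hI
  have h1 : (1 : FractionalIdeal (𝓞 K)⁰ K) + I ≠ 0 := by
    intro h
    have : (1 : FractionalIdeal (𝓞 K)⁰ K) ≤ 0 := by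
      rw [← h, ← FractionalIdeal.sup_eq_add]; exact le_sup_left
    exact one_ne_zero (le_antisymm this (FractionalIdeal.zero_le _))
  refine ⟨Units.mk0 _ h1, ?_⟩
  rw [conjDiv_apply, div_eq_iff_eq_mul]
  ext1
  rw [Units.val_mul, val_conjIdealUnits, Units.val_mk0, map_add, map_one, mul_add, mul_one, hI',
    add_comm]

omit [NumberField K] in
theorem isIntegral_of_mem_one {x : K} :
    x ∈ (1 : FractionalIdeal (𝓞 K)⁰ K) ↔ IsIntegral ℤ x := by
  rw [FractionalIdeal.mem_one_iff]
  constructor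
  · rintro ⟨y, rfl⟩
    exact RingOfIntegers.isIntegral_coe y
  · intro h
    exact ⟨⟨x, h⟩, rfl⟩

theorem ideal_eq_one_of_sq_eq_one (I : (FractionalIdeal (𝓞 K)⁰ K)ˣ) (h : I ^ 2 = 1) : I = 1 := by
  have key : ∀ J : (FractionalIdeal (𝓞 K)⁰ K)ˣ, J ^ 2 = 1 →
      (J : FractionalIdeal (𝓞 K)⁰ K) ≤ 1 := by
    intro J hJ x hx
    have hx2 : x ^ 2 ∈ (1 : FractionalIdeal (𝓞 K)⁰ K) := by
      have : (1 : FractionalIdeal (𝓞 K)⁰ K) = J * J := by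
        rw [← sq]; exact (congrArg Units.val hJ).symm
      rw [this, sq]
      exact FractionalIdeal.mul_mem_mul hx hx
    have := isIntegral_of_mem_one.mp hx2
    exact isIntegral_of_mem_one.mpr (this.of_pow two_pos)
  ext1
  refine le_antisymm (key I h) ?_
  have h2 := key I⁻¹ (by rw [inv_pow, h, inv_one])
  calc (1 : FractionalIdeal (𝓞 K)⁰ K) = ((I⁻¹ : (FractionalIdeal (𝓞 K)⁰ K)ˣ) :
        FractionalIdeal (𝓞 K)⁰ K) * I := by rw [Units.inv_mul]
    _ ≤ 1 * I := mul_le_mul_left h2 _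
    _ = I := one_mul _

end ConjIdeal

section QuadraticOver

open NumberField nonZeroDivisors

/-- A presentation of a field `K` as the quadratic extension of `ℚ(√2)` generated by a square root
`θ` of `d`. -/
structure QuadraticOver (K : Type*) [Field K] (d : ZRootTwo) where
  /-- the nontrivial automorphism over `ℚ(√2)` -/
  σ : K ≃+* K
  /-- the inclusion of `ℤ[√2]` -/
  j : ZRootTwo →+* K
  /-- the square root of `d` -/
  θ : K
  σ_σ : ∀ x, σ (σ x) = x
  σ_j : ∀ r, σ (j r) = j r
  σ_θ : σ θ = -θ
  θ_sq : θ ^ 2 = j d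
  θ_ne : θ ≠ 0
  fixed : ∀ x, σ x = x → ∃ a b : ZRootTwo, b ≠ 0 ∧ x * j b = j a

theorem isIntegral_of_quadratic {K : Type*} [Field K] {x t m : K} (ht : IsIntegral ℤ t)
    (hm : IsIntegral ℤ m) (h : x ^ 2 - t * x + m = 0) : IsIntegral ℤ x := by
  obtain ⟨t', rfl⟩ : ∃ t' : 𝓞 K, algebraMap (𝓞 K) K t' = t := ⟨⟨t, ht⟩, rfl⟩
  obtain ⟨m', rfl⟩ : ∃ m' : 𝓞 K, algebraMap (𝓞 K) K m' = m := ⟨⟨m, hm⟩, rfl⟩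
  have : IsIntegral (𝓞 K) x := by
    refine ⟨Polynomial.X ^ 2 + (Polynomial.C (-t') * Polynomial.X + Polynomial.C m'), ?_, ?_⟩
    · refine Polynomial.monic_X_pow_add ?_
      exact lt_of_le_of_lt Polynomial.degree_linear_le (by norm_num)
    · simp only [Polynomial.eval₂_add, Polynomial.eval₂_mul,
        Polynomial.eval₂_X, Polynomial.eval₂_C, Polynomial.eval₂_pow]
      rw [map_neg]
      linear_combination h
  exact isIntegral_trans x this

theorem ZRootTwo.isIntegral (r : ZRootTwo) : IsIntegral ℤ r := by
  refine ⟨Polynomial.X ^ 2 + (Polynomial.C (-2 * r.re) * Polynomial.X +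
      Polynomial.C r.norm), ?_, ?_⟩
  · refine Polynomial.monic_X_pow_add ?_
    exact lt_of_le_of_lt Polynomial.degree_linear_le (by norm_num)
  · simp only [Polynomial.eval₂_add, Polynomial.eval₂_mul,
        Polynomial.eval₂_X, Polynomial.eval₂_C, Polynomial.eval₂_pow]
    ext <;> simp [sq, ZRootTwo.norm_def'] <;> ring

namespace QuadraticOver

variable {K : Type*} [Field K] [NumberField K] {d : ZRootTwo} (D : QuadraticOver K d)
include D

theorem j_injective : Function.Injective D.j := by
  rw [injective_iff_map_eq_zero]
  intro a ha
  have h1 : D.j (a.norm : ZRootTwo) = 0 := by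
    rw [Zsqrtd.norm_eq_mul_conj, map_mul, ha, zero_mul]
  rw [map_intCast, Int.cast_eq_zero] at h1
  exact ZRootTwo.norm_eq_zero_iff'.mp h1

theorem j_eq_zero {a : ZRootTwo} : D.j a = 0 ↔ a = 0 := map_eq_zero_iff D.j D.j_injective

omit [NumberField K] in
theorem isIntegral_j (r : ZRootTwo) : IsIntegral ℤ (D.j r) := map_isIntegral_int D.j r.isIntegral

omit [NumberField K] in
theorem isIntegral_σ {x : K} (hx : IsIntegral ℤ x) : IsIntegral ℤ (D.σ x) :=
  map_isIntegral_int D.σ hx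

omit [NumberField K] in
theorem isIntegral_θ : IsIntegral ℤ D.θ :=
  IsIntegral.of_pow two_pos (D.θ_sq ▸ D.isIntegral_j d)

theorem exists_j_eq {x : K} (hx : IsIntegral ℤ x) (hσ : D.σ x = x) : ∃ r, D.j r = x := by
  obtain ⟨a, b, hb, hab⟩ := D.fixed x hσ
  let f : FractionRing ZRootTwo →+* K := IsFractionRing.lift D.j_injective
  have hf : ∀ r, f (algebraMap _ _ r) = D.j r := fun r => IsFractionRing.lift_algebraMap _ _
  have hjb : D.j b ≠ 0 := fun h => hb (D.j_eq_zero.mp h)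
  have hx' : f (algebraMap _ _ a / algebraMap _ _ b) = x := by
    rw [map_div₀, hf, hf, ← hab, mul_div_cancel_right₀ _ hjb]
  obtain ⟨p, hp, hpx⟩ := hx
  have h1 : IsIntegral ZRootTwo (algebraMap ZRootTwo (FractionRing ZRootTwo) a /
      algebraMap _ _ b) := by
    refine ⟨p.map (Int.castRingHom _), hp.map _, f.injective ?_⟩
    rw [Polynomial.eval₂_map, Polynomial.hom_eval₂, map_zero, hx', ← hpx]
    exact congrArg (fun g => Polynomial.eval₂ g x p) (Subsingleton.elim _ _)
  obtain ⟨r, hr⟩ := IsIntegrallyClosed.isIntegral_iff.mp h1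
  exact ⟨r, by rw [← hx', ← hr, hf]⟩

theorem exists_norm {x : K} (hx : IsIntegral ℤ x) : ∃ r, D.j r = x * D.σ x :=
  D.exists_j_eq (hx.mul (D.isIntegral_σ hx)) (by rw [map_mul, D.σ_σ, mul_comm])

theorem exists_trace {x : K} (hx : IsIntegral ℤ x) : ∃ r, D.j r = x + D.σ x :=
  D.exists_j_eq (hx.add (D.isIntegral_σ hx)) (by rw [map_add, D.σ_σ, add_comm])

omit [NumberField K] D in
theorem j_mul_mem {I : FractionalIdeal (𝓞 K)⁰ K} {x y : K} (hx : IsIntegral ℤ x) (hy : y ∈ I) :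
    x * y ∈ I := by
  have : (⟨x, hx⟩ : 𝓞 K) • y ∈ (I : Submodule (𝓞 K) K) := Submodule.smul_mem _ _ hy
  rwa [Algebra.smul_def] at this

omit D in
theorem mem_span_iff {x y : K} (hx : x ≠ 0) :
    y ∈ FractionalIdeal.spanSingleton (𝓞 K)⁰ x ↔ IsIntegral ℤ (y / x) := by
  rw [FractionalIdeal.mem_spanSingleton]
  constructor
  · rintro ⟨z, rfl⟩
    rw [Algebra.smul_def, mul_div_cancel_right₀ _ hx]
    exact RingOfIntegers.isIntegral_coe z
  · intro h
    obtain ⟨z, hz⟩ : ∃ z : 𝓞 K, algebraMap (𝓞 K) K z = y / x := ⟨⟨_, h⟩, rfl⟩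
    refine ⟨z, ?_⟩
    rw [Algebra.smul_def, hz]
    exact div_mul_cancel₀ y hx

theorem exists_conjNorm_of_le_one (I : (FractionalIdeal (𝓞 K)⁰ K)ˣ)
    (hI : (I : FractionalIdeal (𝓞 K)⁰ K) ≤ 1) :
    ∃ a, conjUnits D.σ a = a ∧
      conjNorm (conjIdealUnits D.σ) I = toPrincipalIdeal (𝓞 K) K a := by
  have hintegral : ∀ x ∈ (I : FractionalIdeal (𝓞 K)⁰ K), IsIntegral ℤ x := fun x hx =>
    isIntegral_of_mem_one.mp (hI hx)
  set 𝔞 : Ideal ZRootTwo :=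
    Ideal.span {r | ∃ x ∈ (I : FractionalIdeal (𝓞 K)⁰ K), D.j r = x * D.σ x} with h𝔞
  obtain ⟨a, ha⟩ := (IsPrincipalIdealRing.principal 𝔞).principal
  have hnorm : ∀ x ∈ (I : FractionalIdeal (𝓞 K)⁰ K), ∃ r, D.j a * D.j r = x * D.σ x := by
    intro x hx
    obtain ⟨r, hr⟩ := D.exists_norm (hintegral x hx)
    have : r ∈ 𝔞 := Ideal.subset_span ⟨x, hx, hr⟩
    rw [ha] at this
    obtain ⟨s, rfl⟩ := Ideal.mem_span_singleton'.mp this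
    exact ⟨s, by rw [← hr, map_mul, mul_comm]⟩
  have ha0 : D.j a ≠ 0 := by
    intro h0
    have : (I : FractionalIdeal (𝓞 K)⁰ K) = 0 := by
      refine FractionalIdeal.eq_zero_iff.mpr fun x hx => ?_
      obtain ⟨r, hr⟩ := hnorm x hx
      rw [h0, zero_mul] at hr
      rcases mul_eq_zero.mp hr.symm with h | h
      · exact h
      · exact (map_eq_zero D.σ).mp h
    exact I.ne_zero this
  refine ⟨Units.mk0 _ ha0, Units.ext (D.σ_j a), ?_⟩
  symm
  rw [toPrincipalIdeal_eq_iff, Units.val_mk0, conjNorm_apply, Units.val_mul, val_conjIdealUnits]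
  refine le_antisymm ?_ (FractionalIdeal.mul_le.mpr fun x hx y hy => ?_)
  · rw [FractionalIdeal.spanSingleton_le_iff_mem]
    have h1 : a ∈ 𝔞 := by rw [ha]; exact Ideal.mem_span_singleton_self a
    rw [h𝔞] at h1
    refine Submodule.span_induction (p := fun r _ => D.j r ∈
      (I : FractionalIdeal (𝓞 K)⁰ K) * conjIdeal D.σ I) ?_ ?_ ?_ ?_ h1
    · rintro r ⟨x, hx, hr⟩
      rw [hr]
      exact FractionalIdeal.mul_mem_mul hx ((apply_mem_conjIdeal _ _ _).mpr hx)
    · rw [map_zero]; exact Submodule.zero_mem _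
    · intro x y _ _ hx hy
      rw [map_add]
      exact Submodule.add_mem _ hx hy
    · intro r x _ hx
      rw [smul_eq_mul, map_mul]
      exact j_mul_mem (D.isIntegral_j r) hx
  · rw [mem_conjIdeal D.σ_σ] at hy
    rw [mem_span_iff ha0]
    obtain ⟨r, hr⟩ := hnorm x hx
    obtain ⟨s, hs⟩ := hnorm _ hy
    obtain ⟨t, ht⟩ := hnorm (x + D.σ y) (Submodule.add_mem _ hx hy)
    rw [D.σ_σ] at hs
    rw [map_add, D.σ_σ] at ht
    refine isIntegral_of_quadratic (D.isIntegral_j (t - r - s)) (D.isIntegral_j (r * s)) ?_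
    rw [map_sub, map_sub, map_mul]
    field_simp
    linear_combination (D.j a * D.j s) * hr + D.σ x * x * hs + (-x * y) * ht + (x * y) * hr
      + (x * y) * hs

theorem exists_conjNorm_ideal (I : (FractionalIdeal (𝓞 K)⁰ K)ˣ) :
    ∃ a, conjUnits D.σ a = a ∧
      conjNorm (conjIdealUnits D.σ) I = toPrincipalIdeal (𝓞 K) K a := by
  obtain ⟨c, hc, hI⟩ := (I : FractionalIdeal (𝓞 K)⁰ K).isFractional
  have hc0 : (c : K) ≠ 0 := by
    have := nonZeroDivisors.ne_zero hc
    simpa using this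
  set u : Kˣ := Units.mk0 (c : K) hc0 with hu
  obtain ⟨a, ha, haI⟩ := D.exists_conjNorm_of_le_one (toPrincipalIdeal (𝓞 K) K u * I) (by
    rw [Units.val_mul, coe_toPrincipalIdeal]
    refine FractionalIdeal.spanSingleton_mul_le_iff.mpr fun z hz => ?_
    obtain ⟨w, hw⟩ := hI z hz
    rw [FractionalIdeal.mem_one_iff]
    refine ⟨w, ?_⟩
    rw [hw, Algebra.smul_def]; rfl)
  refine ⟨a / conjNorm (conjUnits D.σ) u, ?_, ?_⟩
  · rw [map_div, ha, conjNorm_apply, map_mul]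
    congr 1
    rw [mul_comm]
    congr 1
    exact Units.ext (D.σ_σ _)
  · rw [map_div, ← haI, map_mul, mul_comm, eq_div_iff_mul_eq', conjNorm_apply (x := u), map_mul,
      toPrincipalIdeal_conjUnits, ← conjNorm_apply]

omit D in
theorem mem_ker_toPrincipalIdeal (x : Kˣ) : x ∈ (toPrincipalIdeal (𝓞 K) K).ker ↔
    IsIntegral ℤ (x : K) ∧ IsIntegral ℤ ((x⁻¹ : Kˣ) : K) := by
  rw [MonoidHom.mem_ker, toPrincipalIdeal_eq_iff, Units.val_one]
  have h1 : ∀ y : Kˣ, FractionalIdeal.spanSingleton (𝓞 K)⁰ (y : K) ≤ 1 ↔ IsIntegral ℤ (y : K) := by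
    intro y
    rw [FractionalIdeal.spanSingleton_le_iff_mem, isIntegral_of_mem_one]
  have h2 : 1 ≤ FractionalIdeal.spanSingleton (𝓞 K)⁰ (x : K) ↔ IsIntegral ℤ ((x⁻¹ : Kˣ) : K) := by
    rw [FractionalIdeal.one_le, mem_span_iff x.ne_zero, one_div, Units.val_inv_eq_inv_val]
  rw [le_antisymm_iff, h1, h2]

theorem units_fixed_eq : (toPrincipalIdeal (𝓞 K) K).ker ⊓ (conjDiv (conjUnits D.σ)).ker =
    (Units.map (D.j : ZRootTwo →* K)).range := by
  ext x
  rw [Subgroup.mem_inf, mem_ker_toPrincipalIdeal, mem_conjDiv_ker]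
  constructor
  · rintro ⟨⟨h1, h2⟩, h3⟩
    have h4 : conjUnits D.σ x⁻¹ = x⁻¹ := by rw [map_inv, h3]
    obtain ⟨r, hr⟩ := D.exists_j_eq h1 (congrArg Units.val h3)
    obtain ⟨s, hs⟩ := D.exists_j_eq h2 (congrArg Units.val h4)
    have hrs : r * s = 1 := D.j_injective (by rw [map_mul, hr, hs, map_one, Units.mul_inv])
    exact ⟨⟨r, s, hrs, by rw [mul_comm, hrs]⟩, Units.ext hr⟩
  · rintro ⟨u, rfl⟩
    refine ⟨⟨D.isIntegral_j u, ?_⟩, Units.ext (D.σ_j u)⟩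
    rw [← map_inv]
    exact D.isIntegral_j _

end QuadraticOver

end QuadraticOver

section SquarefreePart

variable {R : Type*} [CommRing R] [IsDomain R] [UniqueFactorizationMonoid R]

theorem exists_squarefree_mul_sq (c : R) (hc : c ≠ 0) : ∃ s z : R, Squarefree s ∧ c = s * z ^ 2 := by
  induction c using UniqueFactorizationMonoid.induction_on_prime with
  | h₁ => exact absurd rfl hc
  | h₂ x hx => exact ⟨x, 1, hx.squarefree, by ring⟩
  | h₃ a p ha hp ih =>
    obtain ⟨s, z, hs, rfl⟩ := ih ha
    by_cases h : p ∣ s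
    · obtain ⟨s', rfl⟩ := h
      exact ⟨s', p * z, hs.squarefree_of_dvd (dvd_mul_left _ _), by ring⟩
    · refine ⟨p * s, z, ?_, by ring⟩
      rw [squarefree_mul_iff]
      exact ⟨(hp.irreducible.isRelPrime_iff_not_dvd).mpr h, hp.irreducible.squarefree, hs⟩

theorem associated_of_squarefree_mul_sq {s t a b : R} (hs : Squarefree s) (ht : Squarefree t)
    (ha : a ≠ 0) (hb : b ≠ 0) (h : s * b ^ 2 = t * a ^ 2) : Associated s t := by
  obtain ⟨a', b', c, hab, rfl, rfl⟩ := UniqueFactorizationMonoid.exists_reduced_factors a ha b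
  have hc : c ≠ 0 := left_ne_zero_of_mul ha
  have h' : s * b' ^ 2 = t * a' ^ 2 := by
    apply mul_left_cancel₀ (pow_ne_zero 2 hc)
    linear_combination h
  have hb' : IsUnit b' := by
    apply ht
    rw [← sq]
    exact (hab.symm.pow (m := 2) (n := 2)).dvd_of_dvd_mul_right (Dvd.intro_left s h')
  have ha' : IsUnit a' := by
    apply hs
    rw [← sq]
    exact (hab.pow (m := 2) (n := 2)).dvd_of_dvd_mul_right (Dvd.intro_left t h'.symm)
  have e1 : Associated s (s * b' ^ 2) := (associated_mul_unit_right s _ (hb'.pow 2))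
  have e2 : Associated t (t * a' ^ 2) := (associated_mul_unit_right t _ (ha'.pow 2))
  exact (e1.trans (by rw [h'])).trans e2.symm

variable {ι : Type*} {P : ι → R}

theorem exists_associated_prod (hP : ∀ i, Prime (P i)) (T : Finset ι) (s : R) (hs : Squarefree s)
    (h : ∀ ρ, Prime ρ → ρ ∣ s → ρ ∣ ∏ i ∈ T, P i) :
    ∃ S ⊆ T, Associated s (∏ i ∈ S, P i) := by
  classical
  induction T using Finset.induction_on generalizing s with
  | empty =>
    refine ⟨∅, subset_rfl, ?_⟩
    rw [Finset.prod_empty, associated_one_iff_isUnit]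
    by_contra hu
    obtain ⟨ρ, hρ, hd⟩ := WfDvdMonoid.exists_irreducible_factor hu hs.ne_zero
    have hρ' := UniqueFactorizationMonoid.irreducible_iff_prime.mp hρ
    exact hρ'.not_isUnit (isUnit_of_dvd_one (by simpa using h ρ hρ' hd))
  | insert i T hi ih =>
    have key : ∀ s', ¬ P i ∣ s' → (∀ ρ, Prime ρ → ρ ∣ s' → ρ ∣ ∏ i ∈ insert i T, P i) →
        ∀ ρ, Prime ρ → ρ ∣ s' → ρ ∣ ∏ i ∈ T, P i := by
      intro s' hs' h' ρ hρ hd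
      have := h' ρ hρ hd
      rw [Finset.prod_insert hi] at this
      rcases hρ.dvd_or_dvd this with h1 | h1
      · exact absurd ((((hρ.associated_of_dvd (hP i) h1).symm).dvd).trans hd) hs'
      · exact h1
    by_cases hd : P i ∣ s
    · obtain ⟨s', rfl⟩ := hd
      have hnd : ¬ P i ∣ s' := by
        intro h2
        exact (hP i).not_isUnit (hs _ (mul_dvd_mul_left _ h2))
      obtain ⟨S, hS, hS'⟩ := ih s' (hs.squarefree_of_dvd (dvd_mul_left _ _))
        (key s' hnd fun ρ hρ h2 => h ρ hρ (h2.mul_left _))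
      refine ⟨insert i S, Finset.insert_subset_insert _ hS, ?_⟩
      rw [Finset.prod_insert (fun h3 => hi (hS h3))]
      exact hS'.mul_left _
    · obtain ⟨S, hS, hS'⟩ := ih s hs (key s hd h)
      exact ⟨S, hS.trans (Finset.subset_insert _ _), hS'⟩

theorem squarefree_prod_of_primes (hP : ∀ i, Prime (P i))
    (hP' : ∀ i k, Associated (P i) (P k) → i = k) (S : Finset ι) :
    Squarefree (∏ i ∈ S, P i) := by
  classical
  induction S using Finset.induction_on with
  | empty => simp
  | insert i S hi ih =>
    rw [Finset.prod_insert hi, squarefree_mul_iff]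
    refine ⟨((hP i).irreducible.isRelPrime_iff_not_dvd).mpr ?_, (hP i).irreducible.squarefree, ih⟩
    intro h
    obtain ⟨k, hk, hd⟩ := (hP i).exists_mem_finset_dvd h
    exact hi ((hP' i k ((hP i).associated_of_dvd (hP k) hd)) ▸ hk)

omit [UniqueFactorizationMonoid R] in
theorem eq_of_associated_prod (hP : ∀ i, Prime (P i))
    (hP' : ∀ i k, Associated (P i) (P k) → i = k) {S T : Finset ι}
    (h : Associated (∏ i ∈ S, P i) (∏ i ∈ T, P i)) : S = T := by
  have key : ∀ S T : Finset ι, (∏ i ∈ S, P i) ∣ (∏ i ∈ T, P i) → S ⊆ T := by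
    intro S T h i hi
    obtain ⟨k, hk, hd⟩ := (hP i).exists_mem_finset_dvd ((Finset.dvd_prod_of_mem P hi).trans h)
    exact (hP' i k ((hP i).associated_of_dvd (hP k) hd)) ▸ hk
  exact Finset.Subset.antisymm (key _ _ h.dvd) (key _ _ h.symm.dvd)

end SquarefreePart

section AmbiguousIdeals

open NumberField nonZeroDivisors

namespace QuadraticOver

variable {K : Type*} [Field K] [NumberField K] {d : ZRootTwo} (D : QuadraticOver K d)

omit [NumberField K] in
theorem mem_sup_of_mem_left {x : K} {I : FractionalIdeal (𝓞 K)⁰ K}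
    (J : FractionalIdeal (𝓞 K)⁰ K) (h : x ∈ I) : x ∈ I ⊔ J :=
  (le_sup_left : I ≤ I ⊔ J) h

omit [NumberField K] in
theorem mem_sup_of_mem_right {x : K} (I : FractionalIdeal (𝓞 K)⁰ K)
    {J : FractionalIdeal (𝓞 K)⁰ K} (h : x ∈ J) : x ∈ I ⊔ J :=
  (le_sup_right : J ≤ I ⊔ J) h

/-- The elements of `Kˣ` generating the square of a fractional ideal. -/
noncomputable def idealSquares (K : Type*) [Field K] [NumberField K] : Subgroup Kˣ :=
  ((⊤ : Subgroup (FractionalIdeal (𝓞 K)⁰ K)ˣ).map (powMonoidHom 2)).comap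
    (toPrincipalIdeal (𝓞 K) K)

theorem mem_idealSquares (x : Kˣ) : x ∈ idealSquares K ↔
    ∃ I : (FractionalIdeal (𝓞 K)⁰ K)ˣ, I ^ 2 = toPrincipalIdeal (𝓞 K) K x := by
  rw [idealSquares, Subgroup.mem_comap, Subgroup.mem_map]
  simp

include D

/-- Nonzero elements of `ℤ[√2]` as units of `K`. -/
noncomputable def jUnit (r : ZRootTwo) (hr : r ≠ 0) : Kˣ :=
  Units.mk0 (D.j r) fun h => hr (D.j_eq_zero.mp h)

theorem val_jUnit (r : ZRootTwo) (hr : r ≠ 0) : (D.jUnit r hr : K) = D.j r := rfl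

theorem jUnit_mem_idealSquares_of_coprime {π m : ZRootTwo} (h0 : π ≠ 0) (hd : d = π * m)
    (hc : IsCoprime π m) : D.jUnit π h0 ∈ idealSquares K := by
  obtain ⟨α, β, hαβ⟩ := hc
  have hjπ : D.j π ≠ 0 := fun h => h0 (D.j_eq_zero.mp h)
  set X := FractionalIdeal.spanSingleton (𝓞 K)⁰ (D.j π) with hX
  set Y := FractionalIdeal.spanSingleton (𝓞 K)⁰ D.θ with hY
  have hXY : (X + Y) * (X + Y) = X := by
    have e : (X + Y) * (X + Y) = X * X + (X * Y + Y * Y) := by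
      calc (X + Y) * (X + Y) = X * X + ((X * Y + X * Y) + Y * Y) := by ring
        _ = X * X + (X * Y + Y * Y) := by
          rw [← FractionalIdeal.sup_eq_add (X * Y) (X * Y), sup_idem]
    have hYY : Y * Y = FractionalIdeal.spanSingleton (𝓞 K)⁰ (D.j π * D.j m) := by
      rw [hY, FractionalIdeal.spanSingleton_mul_spanSingleton, ← sq, D.θ_sq, ← map_mul]
      exact congrArg (fun r => FractionalIdeal.spanSingleton (𝓞 K)⁰ (D.j r)) hd
    rw [e, hYY, hX, hY, FractionalIdeal.spanSingleton_mul_spanSingleton,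
      FractionalIdeal.spanSingleton_mul_spanSingleton, ← FractionalIdeal.sup_eq_add,
      ← FractionalIdeal.sup_eq_add]
    refine le_antisymm (sup_le ?_ (sup_le ?_ ?_)) ?_
    · rw [FractionalIdeal.spanSingleton_le_iff_mem, mem_span_iff hjπ, mul_div_cancel_left₀ _ hjπ]
      exact D.isIntegral_j _
    · rw [FractionalIdeal.spanSingleton_le_iff_mem, mem_span_iff hjπ, mul_div_cancel_left₀ _ hjπ]
      exact D.isIntegral_θ
    · rw [FractionalIdeal.spanSingleton_le_iff_mem, mem_span_iff hjπ, mul_div_cancel_left₀ _ hjπ]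
      exact D.isIntegral_j _
    · rw [FractionalIdeal.spanSingleton_le_iff_mem]
      have : D.j π = D.j α * (D.j π * D.j π) + D.j β * (D.j π * D.j m) := by
        have := congrArg D.j hαβ
        rw [map_add, map_mul, map_mul, map_one] at this
        linear_combination (-D.j π) * this
      refine (congrArg (fun y => y ∈ _) this).mpr ?_
      refine Submodule.add_mem _ ?_ ?_
      · refine j_mul_mem (D.isIntegral_j _) ?_
        exact mem_sup_of_mem_left _ (FractionalIdeal.mem_spanSingleton_self _ _)
      · refine j_mul_mem (D.isIntegral_j _) ?_
        exact mem_sup_of_mem_right _ (mem_sup_of_mem_right _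
          (FractionalIdeal.mem_spanSingleton_self _ _))
  rw [mem_idealSquares]
  have hne : X + Y ≠ 0 := by
    intro h
    rw [h, zero_mul] at hXY
    exact hjπ (FractionalIdeal.spanSingleton_eq_zero_iff.mp hXY.symm)
  refine ⟨Units.mk0 _ hne, ?_⟩
  symm
  rw [toPrincipalIdeal_eq_iff, Units.val_pow_eq_pow_val, Units.val_mk0, sq, hXY, val_jUnit]

theorem sq_dvd_of_mem_idealSquares {ρ s : ZRootTwo} (hρ : Prime ρ) (hρd : ¬ ρ ∣ d)
    (hρ2 : ¬ ρ ∣ 2) (hs : s ≠ 0) (h : D.jUnit s hs ∈ idealSquares K) (hd : ρ ∣ s) :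
    ρ ^ 2 ∣ s := by
  rw [mem_idealSquares] at h
  obtain ⟨I, hI⟩ := h
  have hI' : (I : FractionalIdeal (𝓞 K)⁰ K) * I =
      FractionalIdeal.spanSingleton (𝓞 K)⁰ (D.j s) := by
    rw [← sq, ← Units.val_pow_eq_pow_val, hI, coe_toPrincipalIdeal, val_jUnit]
  have hjs : D.j s ≠ 0 := fun h => hs (D.j_eq_zero.mp h)
  have hjρ : D.j ρ ≠ 0 := fun h => hρ.ne_zero (D.j_eq_zero.mp h)
  have hle : (I : FractionalIdeal (𝓞 K)⁰ K) ≤ FractionalIdeal.spanSingleton (𝓞 K)⁰ (D.j ρ) := by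
    intro x hx
    rw [mem_span_iff hjρ]
    have hx2 := FractionalIdeal.mul_mem_mul hx hx
    rw [hI', mem_span_iff hjs] at hx2
    set y := x * x / D.j s with hy
    have hxy : x * x = D.j s * y := by rw [hy, mul_div_cancel₀ _ hjs]
    have hxint : IsIntegral ℤ x := by
      refine IsIntegral.of_pow two_pos ?_
      rw [sq, hxy]
      exact (D.isIntegral_j s).mul hx2
    have hσxy : D.σ x * D.σ x = D.j s * D.σ y := by
      rw [← map_mul, hxy, map_mul, D.σ_j]
    obtain ⟨m, hm⟩ := D.exists_norm hxint
    obtain ⟨t, ht⟩ := D.exists_trace hxint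
    obtain ⟨n, hn⟩ := D.exists_norm hx2
    obtain ⟨v, hv⟩ := D.exists_trace hx2
    have hρm : ρ ∣ m := by
      refine hρ.dvd_of_dvd_pow (n := 2) (hd.trans ⟨s * n, D.j_injective ?_⟩)
      rw [map_pow, map_mul, map_mul, hm, hn]
      linear_combination (D.σ x * D.σ x) * hxy + D.j s * y * hσxy
    have hρt : ρ ∣ t := by
      have e : t ^ 2 = s * v + 2 * m := by
        apply D.j_injective
        rw [map_pow, map_add, map_mul, map_mul, map_ofNat, ht, hv, hm]
        linear_combination hxy + hσxy
      refine hρ.dvd_of_dvd_pow (n := 2) ?_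
      rw [e]
      exact dvd_add (hd.mul_right _) (hρm.mul_left _)
    have hρm2 : ρ ^ 2 ∣ m := by
      obtain ⟨r, hr⟩ := D.exists_j_eq (x := (x - D.σ x) * D.θ)
        ((hxint.sub (D.isIntegral_σ hxint)).mul D.isIntegral_θ)
        (by rw [map_mul, map_sub, D.σ_σ, D.σ_θ]; ring)
      have hr2 : r ^ 2 = (t ^ 2 - 4 * m) * d := by
        apply D.j_injective
        rw [map_pow, map_mul, map_sub, map_pow, map_mul, map_ofNat, hr, ht, hm, mul_pow, D.θ_sq]
        ring
      have hρr : ρ ∣ r := by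
        refine hρ.dvd_of_dvd_pow (n := 2) ?_
        rw [hr2]
        refine Dvd.dvd.mul_right (dvd_sub ?_ (hρm.mul_left _)) _
        exact dvd_pow hρt two_ne_zero
      have h1 : ρ ^ 2 ∣ t ^ 2 - 4 * m := by
        refine hρ.pow_dvd_of_dvd_mul_right 2 hρd ?_
        rw [← hr2]
        exact pow_dvd_pow_of_dvd hρr 2
      have h2 : ρ ^ 2 ∣ 2 * (2 * m) := by
        have := dvd_sub (pow_dvd_pow_of_dvd hρt 2) h1
        have e : t ^ 2 - (t ^ 2 - 4 * m) = 2 * (2 * m) := by ring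
        rwa [e] at this
      exact hρ.pow_dvd_of_dvd_mul_left 2 hρ2 (hρ.pow_dvd_of_dvd_mul_left 2 hρ2 h2)
    obtain ⟨t', rfl⟩ := hρt
    obtain ⟨m', rfl⟩ := hρm2
    refine isIntegral_of_quadratic (D.isIntegral_j t') (D.isIntegral_j m') ?_
    rw [map_mul] at ht
    rw [map_mul, map_pow] at hm
    field_simp
    linear_combination hm - x * ht
  have hmem : D.j s ∈ FractionalIdeal.spanSingleton (𝓞 K)⁰ (D.j ρ ^ 2) := by
    have h1 : (I : FractionalIdeal (𝓞 K)⁰ K) * I ≤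
        FractionalIdeal.spanSingleton (𝓞 K)⁰ (D.j ρ) *
          FractionalIdeal.spanSingleton (𝓞 K)⁰ (D.j ρ) := mul_le_mul' hle hle
    rw [FractionalIdeal.spanSingleton_mul_spanSingleton, hI', ← sq] at h1
    exact h1 (FractionalIdeal.mem_spanSingleton_self _ _)
  rw [mem_span_iff (pow_ne_zero 2 hjρ)] at hmem
  obtain ⟨r, hr⟩ := D.exists_j_eq hmem (by rw [map_div₀, map_pow, D.σ_j, D.σ_j])
  refine ⟨r, D.j_injective ?_⟩
  rw [map_mul, hr, map_pow]
  field_simp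

theorem exists_jUnit_div {x : Kˣ} (hx : x ∈ (conjDiv (conjUnits D.σ)).ker) :
    ∃ a b : ZRootTwo, ∃ (ha : a ≠ 0) (hb : b ≠ 0), x = D.jUnit a ha / D.jUnit b hb := by
  rw [mem_conjDiv_ker] at hx
  obtain ⟨a, b, hb, hab⟩ := D.fixed x (congrArg Units.val hx)
  have hjb : D.j b ≠ 0 := fun h => hb (D.j_eq_zero.mp h)
  have ha : a ≠ 0 := by
    rintro rfl
    rw [map_zero] at hab
    exact (mul_ne_zero x.ne_zero hjb) hab
  refine ⟨a, b, ha, hb, ?_⟩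
  rw [eq_div_iff_mul_eq']
  ext
  exact hab

theorem jUnit_mem_ker (r : ZRootTwo) (hr : r ≠ 0) :
    D.jUnit r hr ∈ (conjDiv (conjUnits D.σ)).ker := by
  rw [mem_conjDiv_ker]
  exact Units.ext (D.σ_j r)

/-- The number of ambiguous ideal classes modulo principal ideals from the base field is `2 ^ t`,
where `t` is the number of primes dividing `d`. -/
theorem relIndex_idealSquares {ι : Type*} [Fintype ι] {P : ι → ZRootTwo} (hP : ∀ i, Prime (P i))
    (hP' : ∀ i k, Associated (P i) (P k) → i = k) (hd : Associated d (∏ i, P i))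
    (h2 : ∀ ρ, Prime ρ → ρ ∣ 2 → ρ ∣ d) :
    ((conjDiv (conjUnits D.σ)).ker.map (powMonoidHom 2) ⊔
      ((toPrincipalIdeal (𝓞 K) K).ker ⊓ (conjDiv (conjUnits D.σ)).ker)).relIndex
      ((conjDiv (conjUnits D.σ)).ker ⊓ idealSquares K) = 2 ^ Fintype.card ι := by
  classical
  set F := (conjDiv (conjUnits D.σ)).ker with hF
  set H := F.map (powMonoidHom 2) ⊔ ((toPrincipalIdeal (𝓞 K) K).ker ⊓ F) with hH
  set Q := F ⊓ idealSquares K with hQ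
  have hsq : ∀ x : Kˣ, x ^ 2 ∈ idealSquares K := fun x => by
    rw [mem_idealSquares]
    exact ⟨_, (map_pow _ x 2).symm⟩
  have hker : ∀ x ∈ (toPrincipalIdeal (𝓞 K) K).ker, x ∈ idealSquares K := fun x hx => by
    rw [mem_idealSquares]
    exact ⟨1, by rw [one_pow, (MonoidHom.mem_ker).mp hx]⟩
  have hPne : ∀ S : Finset ι, ∏ i ∈ S, P i ≠ 0 := fun S =>
    Finset.prod_ne_zero_iff.mpr fun i _ => (hP i).ne_zero
  have hprod : ∀ S : Finset ι, D.jUnit (∏ i ∈ S, P i) (hPne S) ∈ Q := by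
    intro S
    refine ⟨D.jUnit_mem_ker _ _, ?_⟩
    have e : D.jUnit (∏ i ∈ S, P i) (hPne S) = ∏ i ∈ S, D.jUnit (P i) (hP i).ne_zero := by
      ext
      rw [Units.coe_prod, val_jUnit, map_prod]
      rfl
    rw [e]
    refine Subgroup.prod_mem _ fun i _ => ?_
    obtain ⟨u, hu⟩ := hd.symm
    rw [← Finset.mul_prod_erase _ _ (Finset.mem_univ i), mul_assoc] at hu
    refine D.jUnit_mem_idealSquares_of_coprime (hP i).ne_zero hu.symm ?_
    rw [(hP i).irreducible.coprime_iff_not_dvd]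
    intro h
    rcases (hP i).dvd_or_dvd h with h | h
    · obtain ⟨k, hk, hdk⟩ := (hP i).exists_mem_finset_dvd h
      exact (Finset.ne_of_mem_erase hk) (hP' _ _ ((hP i).associated_of_dvd (hP k) hdk)).symm
    · exact (hP i).not_isUnit (isUnit_of_dvd_unit h u.isUnit)
  have hmemH : ∀ x : Kˣ, x ∈ H ↔ ∃ y ∈ F, ∃ u : ZRootTwoˣ,
      x = y ^ 2 * Units.map (D.j : ZRootTwo →* K) u := by
    intro x
    rw [hH, D.units_fixed_eq, Subgroup.mem_sup]
    constructor
    · rintro ⟨_, ⟨y, hy, rfl⟩, _, ⟨u, rfl⟩, rfl⟩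
      exact ⟨y, hy, u, rfl⟩
    · rintro ⟨y, hy, u, rfl⟩
      exact ⟨_, ⟨y, hy, rfl⟩, _, ⟨u, rfl⟩, rfl⟩
  let f : Finset ι → Q ⧸ H.subgroupOf Q := fun S => QuotientGroup.mk ⟨_, hprod S⟩
  have hf : Function.Bijective f := by
    constructor
    · intro S T hST
      have h1 := QuotientGroup.eq.mp hST
      rw [Subgroup.mem_subgroupOf, hmemH] at h1
      obtain ⟨y, hy, u, hyu⟩ := h1
      obtain ⟨a, b, ha, hb, rfl⟩ := D.exists_jUnit_div hy
      have h2 : D.jUnit _ (hPne T) * D.jUnit b hb ^ 2 =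
          D.jUnit _ (hPne S) * D.jUnit a ha ^ 2 * Units.map (D.j : ZRootTwo →* K) u := by
        have : D.jUnit _ (hPne T) = D.jUnit _ (hPne S) * ((D.jUnit a ha / D.jUnit b hb) ^ 2 *
            Units.map (D.j : ZRootTwo →* K) u) := by
          rw [← hyu]; simp
        rw [this, div_pow, div_mul_eq_mul_div, ← mul_div_assoc, div_mul_cancel, mul_assoc]
      have h3 : (∏ i ∈ T, P i) * b ^ 2 = ((∏ i ∈ S, P i) * u) * a ^ 2 := by
        apply D.j_injective
        have := congrArg Units.val h2
        simp only [Units.val_mul, Units.val_pow_eq_pow_val, val_jUnit] at this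
        rw [map_mul, map_mul, map_mul, map_pow, map_pow, this]
        change _ * _ * D.j u = _
        ring
      have h4 : Associated ((∏ i ∈ S, P i) * u) (∏ i ∈ S, P i) :=
        associated_mul_unit_left _ _ u.isUnit
      have hsqS := squarefree_prod_of_primes hP hP' S
      refine eq_of_associated_prod hP hP' (h4.symm.trans ?_)
      refine (associated_of_squarefree_mul_sq (squarefree_prod_of_primes hP hP' T) ?_ ha hb h3).symm
      exact hsqS.squarefree_of_dvd h4.dvd
    · intro x
      obtain ⟨⟨x, hx⟩, rfl⟩ := QuotientGroup.mk_surjective x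
      obtain ⟨a, b, ha, hb, hab⟩ := D.exists_jUnit_div hx.1
      obtain ⟨s, z, hs, hz⟩ := exists_squarefree_mul_sq (a * b) (mul_ne_zero ha hb)
      have hz0 : z ≠ 0 := by
        rintro rfl
        exact (mul_ne_zero ha hb) (by rw [hz]; ring)
      have hxs : x = D.jUnit s hs.ne_zero * (D.jUnit z hz0 / D.jUnit b hb) ^ 2 := by
        have : D.jUnit a ha * D.jUnit b hb = D.jUnit s hs.ne_zero * D.jUnit z hz0 ^ 2 := by
          ext
          simp only [Units.val_mul, Units.val_pow_eq_pow_val, val_jUnit, ← map_mul, ← map_pow, hz]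
        rw [hab, div_pow, ← mul_div_assoc, ← this, sq, mul_div_mul_right_eq_div]
      have hsmem : D.jUnit s hs.ne_zero ∈ idealSquares K := by
        have := hx.2
        rw [hxs] at this
        exact (Subgroup.mul_mem_cancel_right _ (hsq _)).mp this
      obtain ⟨S, -, hS⟩ := exists_associated_prod hP Finset.univ s hs fun ρ hρ hρs => by
        rw [← hd.dvd_iff_dvd_right]
        by_contra hρd
        have := D.sq_dvd_of_mem_idealSquares hρ hρd (fun h => hρd (h2 ρ hρ h)) hs.ne_zero hsmem hρs
        rw [sq] at this
        exact hρ.not_isUnit (hs _ this)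
      obtain ⟨u, hu⟩ := hS.symm
      refine ⟨S, ?_⟩
      rw [QuotientGroup.eq, Subgroup.mem_subgroupOf, hmemH]
      refine ⟨D.jUnit z hz0 / D.jUnit b hb, div_mem (D.jUnit_mem_ker _ _) (D.jUnit_mem_ker _ _), u,
        ?_⟩
      have hu' : D.jUnit s hs.ne_zero =
          D.jUnit (∏ i ∈ S, P i) (hPne S) * Units.map (D.j : ZRootTwo →* K) u := by
        ext
        rw [val_jUnit, ← hu, map_mul]
        rfl
      rw [Subgroup.coe_mul, InvMemClass.coe_inv, inv_mul_eq_iff_eq_mul]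
      change x = _
      rw [hxs, hu']
      change _ = D.jUnit (∏ i ∈ S, P i) (hPne S) * _
      ac_rfl
  rw [Subgroup.relIndex, Subgroup.index, ← Nat.card_congr (Equiv.ofBijective f hf),
    Nat.card_eq_fintype_card, Fintype.card_finset]

end QuadraticOver

end AmbiguousIdeals

section UnitIndex

open NumberField nonZeroDivisors

theorem index_range_powMonoidHom_of_free (M : Type*) [CommGroup M] [Module.Free ℤ (Additive M)]
    [Module.Finite ℤ (Additive M)] (n : ℕ) :
    (powMonoidHom n : M →* M).range.index = n ^ Module.finrank ℤ (Additive M) := by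
  rw [← AddSubgroup.index_range_nsmul (Additive M) n]
  rfl

theorem index_sq_of_torsion {V : Type*} [CommGroup V] (T : Subgroup V) {z : V} (hz : z ≠ 1)
    (hzT : z ∈ T) (hz2 : z ^ 2 = 1) (hT : ∀ x ∈ T, x = 1 ∨ x = z)
    (hsat : ∀ y : V, y ^ 2 ∈ T → y ∈ T)
    [Module.Free ℤ (Additive (V ⧸ T))] [Module.Finite ℤ (Additive (V ⧸ T))] :
    (powMonoidHom 2 : V →* V).range.index =
      2 ^ (Module.finrank ℤ (Additive (V ⧸ T)) + 1) := by
  set H := (powMonoidHom 2 : V →* V).range with hH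
  have e1 := Subgroup.relIndex_eq_map_mul_ker (QuotientGroup.mk' T) (le_top : H ≤ ⊤)
  have e2 : H.map (QuotientGroup.mk' T) = (powMonoidHom 2 : (V ⧸ T) →* (V ⧸ T)).range := by
    ext x
    constructor
    · rintro ⟨_, ⟨y, rfl⟩, rfl⟩
      exact ⟨QuotientGroup.mk' T y, (map_pow _ _ _).symm⟩
    · rintro ⟨y, rfl⟩
      obtain ⟨y, rfl⟩ := QuotientGroup.mk'_surjective T y
      exact ⟨y ^ 2, ⟨y, rfl⟩, map_pow _ _ _⟩
  have e3 : H ⊓ T = ⊥ := by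
    rw [eq_bot_iff]
    rintro _ ⟨⟨y, rfl⟩, hy⟩
    rw [Subgroup.mem_bot, powMonoidHom_apply]
    rcases hT y (hsat y hy) with rfl | rfl
    · simp
    · exact hz2
  have e4 : Nat.card T = 2 := by
    rw [Nat.card_eq_two_iff]
    refine ⟨1, ⟨z, hzT⟩, fun h => hz (congrArg Subtype.val h).symm, ?_⟩
    ext ⟨x, hx⟩
    rcases hT x hx with h | h
    · simp [h, Subtype.ext_iff]
    · simp [h, Subtype.ext_iff]
  rw [Subgroup.relIndex_top_right, QuotientGroup.ker_mk', top_inf_eq, e3,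
    Subgroup.relIndex_bot_left, e4, e2, ← MonoidHom.range_eq_map, QuotientGroup.range_mk',
    Subgroup.relIndex_top_right, index_range_powMonoidHom_of_free (V ⧸ T), ← pow_succ] at e1
  exact e1

variable {K : Type*} [Field K] [NumberField K]

theorem torsion_eq_one_or_neg_one [IsTotallyReal K] (x : (𝓞 K)ˣ) (hx : x ∈ Units.torsion K) :
    x = 1 ∨ x = -1 := by
  have hpos : InfinitePlace.nrRealPlaces K ≠ 0 := by
    rw [← IsTotallyReal.finrank]
    exact Module.finrank_pos.ne'
  by_cases! hc : 2 < orderOf x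
  · have h1 : IsPrimitiveRoot ((x : 𝓞 K) : K) (orderOf x) :=
      ((IsPrimitiveRoot.coe_units_iff).2 (IsPrimitiveRoot.orderOf x)).map_of_injective
        (f := algebraMap (𝓞 K) K) RingOfIntegers.coe_injective
    exact absurd (InfinitePlace.IsPrimitiveRoot.nrRealPlaces_eq_zero_of_two_lt hc h1) hpos
  · have h0 : orderOf x ≠ 0 := (orderOf_pos_iff.2 ((CommGroup.mem_torsion x).1 hx)).ne'
    have hx2 : x ^ 2 = 1 := by
      apply orderOf_dvd_iff_pow_eq_one.1
      interval_cases orderOf x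
      · exact absurd rfl h0
      · norm_num
      · norm_num
    have : (x : 𝓞 K) ^ 2 = 1 := by
      rw [← Units.val_pow_eq_pow_val, hx2, Units.val_one]
    rcases sq_eq_one_iff.1 this with h | h
    · exact Or.inl (Units.ext h)
    · exact Or.inr (Units.ext h)

theorem index_sq_units [IsTotallyReal K] :
    (powMonoidHom 2 : (𝓞 K)ˣ →* (𝓞 K)ˣ).range.index = 2 ^ Module.finrank ℚ K := by
  have hne1 : (-1 : (𝓞 K)ˣ) ≠ 1 := by
    intro h
    have := congrArg Units.val h
    simp at this
    norm_num at this
  have hm1 : (-1 : (𝓞 K)ˣ) ∈ Units.torsion K := by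
    rw [Units.torsion, CommGroup.mem_torsion, isOfFinOrder_iff_pow_eq_one]
    exact ⟨2, two_pos, by simp⟩
  rw [index_sq_of_torsion (Units.torsion K) hne1 hm1 (by simp) torsion_eq_one_or_neg_one]
  · congr 1
    rw [Units.finrank_modTorsion, Units.rank,
      InfinitePlace.card_eq_nrRealPlaces_add_nrComplexPlaces,
      IsTotallyReal.nrComplexPlaces_eq_zero, add_zero, ← IsTotallyReal.finrank]
    exact Nat.sub_add_cancel Module.finrank_pos
  · intro y hy
    rw [Units.torsion, CommGroup.mem_torsion] at hy ⊢
    exact (isOfFinOrder_pow.mp hy).resolve_right (by norm_num)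

theorem relIndex_sq_ker_toPrincipalIdeal [IsTotallyReal K] :
    ((toPrincipalIdeal (𝓞 K) K).ker.map (powMonoidHom 2)).relIndex
      (toPrincipalIdeal (𝓞 K) K).ker = 2 ^ Module.finrank ℚ K := by
  set g : (𝓞 K)ˣ →* Kˣ := Units.map (algebraMap (𝓞 K) K : 𝓞 K →* K) with hg
  have hgi : Function.Injective g := Units.map_injective RingOfIntegers.coe_injective
  have e1 : (toPrincipalIdeal (𝓞 K) K).ker = g.range := by
    ext x
    rw [QuadraticOver.mem_ker_toPrincipalIdeal]
    constructor
    · rintro ⟨h1, h2⟩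
      obtain ⟨a, ha⟩ : ∃ a : 𝓞 K, algebraMap (𝓞 K) K a = x := ⟨⟨_, h1⟩, rfl⟩
      obtain ⟨b, hb⟩ : ∃ b : 𝓞 K, algebraMap (𝓞 K) K b = (x⁻¹ : Kˣ) := ⟨⟨_, h2⟩, rfl⟩
      have hab : a * b = 1 := by
        apply RingOfIntegers.coe_injective
        rw [map_mul, ha, hb, Units.mul_inv, map_one]
      exact ⟨⟨a, b, hab, by rw [mul_comm, hab]⟩, Units.ext ha⟩
    · rintro ⟨u, rfl⟩
      refine ⟨RingOfIntegers.isIntegral_coe _, ?_⟩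
      rw [← map_inv]
      exact RingOfIntegers.isIntegral_coe _
  have e2 : g.range.map (powMonoidHom 2) = (powMonoidHom 2 : (𝓞 K)ˣ →* (𝓞 K)ˣ).range.map g := by
    ext x
    constructor
    · rintro ⟨_, ⟨y, rfl⟩, rfl⟩
      exact ⟨_, ⟨y, rfl⟩, map_pow _ _ _⟩
    · rintro ⟨_, ⟨y, rfl⟩, rfl⟩
      exact ⟨_, ⟨y, rfl⟩, (map_pow _ _ _).symm⟩
  have e3 : g.range = (⊤ : Subgroup (𝓞 K)ˣ).map g := MonoidHom.range_eq_map g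
  rw [e1, e2, e3, Subgroup.relIndex_map_map_of_injective _ _ hgi, Subgroup.relIndex_top_right]
  exact index_sq_units

end UnitIndex

section Assembly

open NumberField nonZeroDivisors

theorem Subgroup.relIndex_eq_two {G : Type*} [CommGroup G] {H L : Subgroup G} (a : G)
    (haL : a ∈ L) (ha : a ∉ H) (h : ∀ b ∈ L, b ∈ H ∨ b * a ∈ H) :
    H.relIndex L = 2 := by
  rw [Subgroup.relIndex_eq_two_iff]
  refine ⟨a, haL, fun b hb => ?_⟩
  rcases h b hb with h | h
  · refine Or.inr ⟨h, fun h' => ha ?_⟩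
    exact (Subgroup.mul_mem_cancel_left H h).mp h'
  · refine Or.inl ⟨h, fun h' => ha ?_⟩
    exact (Subgroup.mul_mem_cancel_left H h').mp h

namespace QuadraticOver

variable {K : Type*} [Field K] [NumberField K] {d : ZRootTwo} (D : QuadraticOver K d)

/-- The inclusion of the units of `ℤ[√2]` in `Kˣ`. -/
def unitMap : ZRootTwoˣ →* Kˣ := Units.map (D.j : ZRootTwo →* K)

theorem unitMap_injective : Function.Injective D.unitMap := Units.map_injective D.j_injective

omit [NumberField K] in
theorem conjNorm_unitMap (u : ZRootTwoˣ) : conjNorm (conjUnits D.σ) (D.unitMap u) = D.unitMap (u ^ 2) := by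
  rw [conjNorm_of_fixed, map_pow]
  exact Units.ext (D.σ_j _)

omit [NumberField K] in
theorem mem_range_map_sq (x : Kˣ) : x ∈ D.unitMap.range.map (powMonoidHom 2) ↔
    ∃ v, D.unitMap (v ^ 2) = x := by
  constructor
  · rintro ⟨_, ⟨v, rfl⟩, rfl⟩
    exact ⟨v, map_pow _ _ _⟩
  · rintro ⟨v, rfl⟩
    exact ⟨_, ⟨v, rfl⟩, (map_pow _ _ _).symm⟩

omit [NumberField K] in
theorem unitMap_mem_sq (v : ZRootTwoˣ) :
    D.unitMap (v ^ 2) ∈ D.unitMap.range.map (powMonoidHom 2) :=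
  (D.mem_range_map_sq _).mpr ⟨v, rfl⟩

theorem unitMap_mem_map_sq (u : ZRootTwoˣ) :
    D.unitMap u ∈ D.unitMap.range.map (powMonoidHom 2) ↔ ∃ v, v ^ 2 = u := by
  rw [mem_range_map_sq]
  exact exists_congr fun v => D.unitMap_injective.eq_iff

theorem relIndex_sq_neg_one {N : Subgroup Kˣ} (hN : N ≤ D.unitMap.range)
    (hneg : D.unitMap (-1) ∈ N) (hsq : ∀ v, D.unitMap (v ^ 2) ∈ N)
    (heps : D.unitMap ZRootTwo.epsUnit ∉ N) :
    (D.unitMap.range.map (powMonoidHom 2)).relIndex N = 2 := by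
  refine Subgroup.relIndex_eq_two (D.unitMap (-1)) hneg ?_ ?_
  · rw [unitMap_mem_map_sq]
    rintro ⟨v, hv⟩
    exact ZRootTwo.neg_one_not_sq v (congrArg Units.val hv)
  · intro b hb
    obtain ⟨u, rfl⟩ := hN hb
    rw [← map_mul]
    obtain ⟨v, rfl | rfl | rfl | rfl⟩ := ZRootTwo.unit_mod_squares u
    · exact Or.inl (D.unitMap_mem_sq v)
    · right
      rw [mul_neg_one, neg_neg]
      exact D.unitMap_mem_sq v
    · rw [map_mul] at hb
      exact absurd ((Subgroup.mul_mem_cancel_right N (hsq v)).mp hb) heps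
    · rw [← neg_one_mul, map_mul, Subgroup.mul_mem_cancel_left N hneg, map_mul] at hb
      exact absurd ((Subgroup.mul_mem_cancel_right N (hsq v)).mp hb) heps

theorem relIndex_sq_units : (D.unitMap.range.map (powMonoidHom 2)).relIndex D.unitMap.range = 4 := by
  set S := D.unitMap.range.map (powMonoidHom 2) with hS
  set M := S ⊔ Subgroup.zpowers (D.unitMap (-1)) with hM
  have hmem : ∀ x, x ∈ M ↔ x ∈ S ∨ x * D.unitMap (-1) ∈ S := by
    intro x
    constructor
    · intro hx
      obtain ⟨s, hs, z, hz, rfl⟩ := Subgroup.mem_sup.mp hx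
      obtain ⟨k, rfl⟩ := Subgroup.mem_zpowers_iff.mp hz
      rcases Int.even_or_odd k with hk | hk
      · left
        rw [← map_zpow, hk.neg_one_zpow, map_one, mul_one]
        exact hs
      · right
        rw [← map_zpow, hk.neg_one_zpow, mul_assoc, ← map_mul, neg_one_mul, neg_neg, map_one,
          mul_one]
        exact hs
    · rintro (h | h)
      · exact (le_sup_left : S ≤ M) h
      · have h1 : D.unitMap (-1) ∈ M :=
          (le_sup_right : _ ≤ M) (Subgroup.mem_zpowers (D.unitMap (-1)))
        exact (Subgroup.mul_mem_cancel_right M h1).mp ((le_sup_left : S ≤ M) h)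
  have hSE : S ≤ D.unitMap.range := by
    rintro x hx
    obtain ⟨v, rfl⟩ := (D.mem_range_map_sq x).mp hx
    exact ⟨_, rfl⟩
  have hneg : D.unitMap (-1) ∈ M :=
    (le_sup_right : _ ≤ M) (Subgroup.mem_zpowers (D.unitMap (-1)))
  have hSM : S ≤ M := le_sup_left
  have hME : M ≤ D.unitMap.range := by
    refine sup_le hSE ?_
    rw [Subgroup.zpowers_le]
    exact ⟨_, rfl⟩
  have heps : D.unitMap ZRootTwo.epsUnit ∉ M := by
    rw [hmem, ← map_mul, mul_neg_one, hS, unitMap_mem_map_sq, unitMap_mem_map_sq]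
    rintro (⟨v, hv⟩ | ⟨v, hv⟩)
    · exact ZRootTwo.eps_not_sq v (congrArg Units.val hv)
    · exact ZRootTwo.neg_eps_not_sq v (congrArg Units.val hv)
  rw [← Subgroup.relIndex_mul_relIndex S M _ hSM hME,
    D.relIndex_sq_neg_one hME hneg (fun v => hSM (D.unitMap_mem_sq v)) heps]
  rw [Subgroup.relIndex_eq_two (D.unitMap ZRootTwo.epsUnit) (MonoidHom.mem_range.mpr ⟨_, rfl⟩) heps]
  · rintro _ ⟨u, rfl⟩
    obtain ⟨v, rfl | rfl | rfl | rfl⟩ := ZRootTwo.unit_mod_squares u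
    · exact Or.inl (hSM (D.unitMap_mem_sq v))
    · left
      rw [← neg_one_mul, map_mul]
      exact mul_mem hneg (hSM (D.unitMap_mem_sq v))
    · right
      rw [← map_mul, mul_right_comm, ← sq, ← mul_pow]
      exact hSM (D.unitMap_mem_sq _)
    · right
      rw [← map_mul, neg_mul, mul_right_comm, ← sq, ← mul_pow, ← neg_one_mul, map_mul]
      exact mul_mem hneg (hSM (D.unitMap_mem_sq _))

theorem relIndex_sq_sq_units : ((D.unitMap.range.map (powMonoidHom 2)).map (powMonoidHom 2)).relIndex
    (D.unitMap.range.map (powMonoidHom 2)) = 2 := by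
  have hmem : ∀ x, x ∈ (D.unitMap.range.map (powMonoidHom 2)).map (powMonoidHom 2) ↔
      ∃ v, D.unitMap ((v ^ 2) ^ 2) = x := by
    intro x
    constructor
    · rintro ⟨y, hy, rfl⟩
      obtain ⟨v, rfl⟩ := (D.mem_range_map_sq y).mp hy
      exact ⟨v, map_pow _ _ _⟩
    · rintro ⟨v, rfl⟩
      exact ⟨_, D.unitMap_mem_sq v, (map_pow _ _ _).symm⟩
  refine Subgroup.relIndex_eq_two (D.unitMap (ZRootTwo.epsUnit ^ 2)) (D.unitMap_mem_sq _) ?_ ?_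
  · rw [hmem]
    rintro ⟨v, hv⟩
    have h1 := congrArg Units.val (D.unitMap_injective hv)
    rw [Units.val_pow_eq_pow_val, Units.val_pow_eq_pow_val _ 2] at h1
    rcases sq_eq_sq_iff_eq_or_eq_neg.mp h1 with h | h
    · exact ZRootTwo.eps_not_sq v h
    · exact ZRootTwo.neg_eps_not_sq v h
  · intro b hb
    obtain ⟨u, rfl⟩ := (D.mem_range_map_sq b).mp hb
    simp only [← map_mul, hmem]
    obtain ⟨v, rfl | rfl | rfl | rfl⟩ := ZRootTwo.unit_mod_squares u
    · exact Or.inl ⟨v, rfl⟩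
    · exact Or.inl ⟨v, by rw [neg_sq]⟩
    · refine Or.inr ⟨ZRootTwo.epsUnit * v, congrArg _ ?_⟩
      rw [← mul_pow, mul_right_comm, ← sq, ← mul_pow]
    · refine Or.inr ⟨ZRootTwo.epsUnit * v, congrArg _ ?_⟩
      rw [neg_sq, ← mul_pow, mul_right_comm, ← sq, ← mul_pow]

theorem unitMap_mem_range_conjNorm {u : ZRootTwoˣ} (h : ∃ y, y * D.σ y = D.j u) :
    D.unitMap u ∈ (conjNorm (conjUnits D.σ)).range := by
  obtain ⟨y, hy⟩ := h
  have hy0 : y ≠ 0 := by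
    rintro rfl
    rw [zero_mul, eq_comm, D.j_eq_zero] at hy
    exact u.ne_zero hy
  exact ⟨Units.mk0 y hy0, Units.ext hy⟩

variable [IsTotallyReal K]

theorem relIndex_sq_norm_one (hfin : Module.finrank ℚ K = 4) :
    (((toPrincipalIdeal (𝓞 K) K).ker ⊓ (conjNorm (conjUnits D.σ)).ker).map
      (powMonoidHom 2)).relIndex
      ((toPrincipalIdeal (𝓞 K) K).ker ⊓ (conjNorm (conjUnits D.σ)).ker) = 8 := by
  have hE : D.unitMap.range =
      (toPrincipalIdeal (𝓞 K) K).ker ⊓ (conjDiv (conjUnits D.σ)).ker := D.units_fixed_eq.symm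
  refine relIndex_sq_norm_one_units (conjUnits D.σ) _ _ hE ?_
    (fun x => Units.ext (D.σ_σ x)) ?_ ?_ ?_ ?_ D.relIndex_sq_sq_units
  · intro x hx
    rw [mem_ker_toPrincipalIdeal] at hx ⊢
    rw [← map_inv]
    exact ⟨D.isIntegral_σ hx.1, D.isIntegral_σ hx.2⟩
  · intro x _ hx
    have h : (x : K) ^ 2 = 1 := by rw [← Units.val_pow_eq_pow_val, hx, Units.val_one]
    ext
    rw [val_conjUnits]
    rcases sq_eq_one_iff.mp h with h | h <;> simp [h]
  · rintro _ ⟨u, rfl⟩ h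
    rw [← map_pow, ← map_one D.unitMap, D.unitMap_injective.eq_iff] at h
    rw [← map_pow, ← map_one D.unitMap, D.unitMap_injective.eq_iff]
    have h' : ((u ^ 2 : ZRootTwoˣ) : ZRootTwo) ^ 2 = 1 := by
      rw [← Units.val_pow_eq_pow_val, ← pow_mul, h, Units.val_one]
    rcases sq_eq_one_iff.mp h' with h1 | h1
    · exact Units.ext h1
    · exact absurd h1 (ZRootTwo.neg_one_not_sq u)
  · rw [relIndex_sq_ker_toPrincipalIdeal, hfin]
    norm_num
  · rw [relIndex_sq_units]
    norm_num

/-- The number of ideal classes of order dividing two, in terms of norms of units. -/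
theorem card_two_torsion_mul (hfin : Module.finrank ℚ K = 4) {ι : Type*} [Fintype ι]
    {P : ι → ZRootTwo} (hP : ∀ i, Prime (P i))
    (hP' : ∀ i k, Associated (P i) (P k) → i = k) (hd : Associated d (∏ i, P i))
    (h2 : ∀ ρ, Prime ρ → ρ ∣ 2 → ρ ∣ d) :
    Nat.card {x : ClassGroup (𝓞 K) // x ^ 2 = 1} * 8 = 2 ^ Fintype.card ι *
      (D.unitMap.range.map (powMonoidHom 2)).relIndex
        (D.unitMap.range ⊓ (conjNorm (conjUnits D.σ)).range) := by
  have e : Nat.card {x : ClassGroup (𝓞 K) // x ^ 2 = 1} =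
      Nat.card {x : (FractionalIdeal (𝓞 K)⁰ K)ˣ ⧸ (toPrincipalIdeal (𝓞 K) K).range //
        x ^ 2 = 1} := by
    refine Nat.card_congr (Equiv.subtypeEquiv (ClassGroup.equiv K).toEquiv fun x => ?_)
    change _ ↔ (ClassGroup.equiv K x) ^ 2 = 1
    rw [← map_pow, MulEquiv.map_eq_one_iff]
  rw [e]
  refine ambiguous_class_formula (conjUnits D.σ) (conjIdealUnits D.σ) (toPrincipalIdeal (𝓞 K) K)
    (fun x => Units.ext (D.σ_σ x)) (conjIdealUnits_conjIdealUnits D.σ_σ)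
    (toPrincipalIdeal_conjUnits D.σ) (exists_conjDiv_eq D.θ_ne D.σ_θ) exists_conjDiv_ideal_eq
    D.exists_conjNorm_ideal _ D.units_fixed_eq.symm ?_ (D.relIndex_sq_norm_one hfin)
  rw [relIndex_ambiguous (conjUnits D.σ) (conjIdealUnits D.σ) (toPrincipalIdeal (𝓞 K) K)
    (toPrincipalIdeal_conjUnits D.σ) D.exists_conjNorm_ideal ideal_eq_one_of_sq_eq_one _ rfl]
  exact D.relIndex_idealSquares hP hP' hd h2

theorem card_two_torsion_of_norm (hfin : Module.finrank ℚ K = 4) {ι : Type*} [Fintype ι]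
    {P : ι → ZRootTwo} (hP : ∀ i, Prime (P i))
    (hP' : ∀ i k, Associated (P i) (P k) → i = k) (hd : Associated d (∏ i, P i))
    (h2 : ∀ ρ, Prime ρ → ρ ∣ 2 → ρ ∣ d) (hneg : ∃ y, y * D.σ y = -1)
    (heps : ∃ y, y * D.σ y = D.j ZRootTwo.eps) :
    Nat.card {x : ClassGroup (𝓞 K) // x ^ 2 = 1} * 8 = 2 ^ Fintype.card ι * 4 := by
  rw [D.card_two_torsion_mul hfin hP hP' hd h2, inf_eq_left.mpr, relIndex_sq_units]
  set N := (conjNorm (conjUnits D.σ)).range with hN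
  have hneg : D.unitMap (-1) ∈ N := D.unitMap_mem_range_conjNorm (by simpa using hneg)
  have heps : D.unitMap ZRootTwo.epsUnit ∈ N := D.unitMap_mem_range_conjNorm heps
  have hsq : ∀ v, D.unitMap (v ^ 2) ∈ N := fun v => ⟨_, D.conjNorm_unitMap v⟩
  rintro _ ⟨u, rfl⟩
  obtain ⟨v, rfl | rfl | rfl | rfl⟩ := ZRootTwo.unit_mod_squares u
  · exact hsq v
  · rw [← neg_one_mul, map_mul]
    exact mul_mem hneg (hsq v)
  · rw [map_mul]
    exact mul_mem heps (hsq v)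
  · rw [← neg_one_mul, map_mul, map_mul]
    exact mul_mem hneg (mul_mem heps (hsq v))

theorem card_two_torsion_of_not_norm (hfin : Module.finrank ℚ K = 4) {ι : Type*} [Fintype ι]
    {P : ι → ZRootTwo} (hP : ∀ i, Prime (P i))
    (hP' : ∀ i k, Associated (P i) (P k) → i = k) (hd : Associated d (∏ i, P i))
    (h2 : ∀ ρ, Prime ρ → ρ ∣ 2 → ρ ∣ d) (hneg : ∃ y, y * D.σ y = -1)
    (heps : ¬ ∃ y, y * D.σ y = D.j ZRootTwo.eps) :
    Nat.card {x : ClassGroup (𝓞 K) // x ^ 2 = 1} * 8 = 2 ^ Fintype.card ι * 2 := by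
  rw [D.card_two_torsion_mul hfin hP hP' hd h2, D.relIndex_sq_neg_one inf_le_left]
  · exact ⟨⟨_, rfl⟩, D.unitMap_mem_range_conjNorm (by simpa using hneg)⟩
  · exact fun v => ⟨⟨_, rfl⟩, _, D.conjNorm_unitMap v⟩
  · rintro ⟨-, y, hy⟩
    exact heps ⟨y, congrArg Units.val hy⟩

end QuadraticOver

end Assembly

section Residues

theorem isSquare_iff_of_two_mul {q : ℕ} [Fact q.Prime] {i r : ZMod q} (hq : q ≠ 2)
    (hi : i ^ 2 = -1) (hr : r ^ 2 = 2) (h : IsSquare (1 + r)) : IsSquare (1 + i) := by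
  have h2 : (2 : ZMod q) ≠ 0 := by
    intro h
    have h' : ((2 : ℕ) : ZMod q) = 0 := by exact_mod_cast h
    rw [ZMod.natCast_eq_zero_iff] at h'
    exact hq ((Nat.prime_dvd_prime_iff_eq Fact.out Nat.prime_two).mp h')
  have hr0 : r ≠ 0 := by
    rintro rfl
    exact h2 (by rw [← hr]; ring)
  have hr1 : 1 + r ≠ 0 := by
    intro h
    have : (1 : ZMod q) = 0 := by linear_combination (r - 1) * h - hr
    exact one_ne_zero this
  obtain ⟨z, hz⟩ := h
  have hz0 : z ≠ 0 := by
    rintro rfl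
    exact hr1 (by rw [hz, mul_zero])
  refine ⟨(1 + i + r) / (r * z), ?_⟩
  field_simp
  linear_combination (-(1 + i) * r ^ 2) * hz + (1 + i) * (1 + r) * hr - hi - hr

theorem isSquare_one_add_iff {q : ℕ} [Fact q.Prime] (hq : q % 8 = 1) {i : ZMod q}
    (hi : i ^ 2 = -1) : IsSquare (1 + i) ↔ (2 : ZMod q) ^ ((q - 1) / 4) = (-1) ^ ((q - 1) / 8) := by
  obtain ⟨k, hk⟩ : ∃ k, q = 8 * k + 1 := ⟨q / 8, by omega⟩
  have h1 : (q - 1) / 4 = 2 * k := by omega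
  have h2 : (q - 1) / 8 = k := by omega
  have h3 : q / 2 = 4 * k := by omega
  have h20 : (2 : ZMod q) ≠ 0 := by
    intro h
    have h' : ((2 : ℕ) : ZMod q) = 0 := by exact_mod_cast h
    rw [ZMod.natCast_eq_zero_iff] at h'
    have := (Nat.prime_dvd_prime_iff_eq Fact.out Nat.prime_two).mp h'
    omega
  have hi0 : 1 + i ≠ 0 := by
    intro h
    refine h20 ?_
    linear_combination (1 - i) * h + hi
  rw [ZMod.euler_criterion q hi0, h1, h2, h3]
  have e : (1 + i) ^ (4 * k) = 2 ^ (2 * k) * (-1) ^ k := by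
    have : (1 + i) ^ 4 = 2 ^ 2 * (-1) := by linear_combination (i ^ 2 + 4 * i + 5) * hi
    rw [pow_mul, this, mul_pow, ← pow_mul]
  rw [e]
  rcases neg_one_pow_eq_or (ZMod q) k with h | h
  · rw [h, mul_one]
  · rw [h, mul_neg_one, neg_eq_iff_eq_neg]

theorem quartSym_eq_iff {q : ℕ} [Fact q.Prime] (hq : q % 8 = 1) (h2 : IsSquare (2 : ZMod q)) :
    quartSym q 2 = (-1 : ℤ) ^ ((q - 1) / 8) ↔
      (2 : ZMod q) ^ ((q - 1) / 4) = (-1) ^ ((q - 1) / 8) := by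
  obtain ⟨k, hk⟩ : ∃ k, q = 8 * k + 1 := ⟨q / 8, by omega⟩
  have e1 : (q - 1) / 4 = 2 * k := by omega
  have e2 : q / 2 = 4 * k := by omega
  have : Fact (2 < q) := ⟨by have := (Fact.out : q.Prime).two_le; omega⟩
  have hne : (-1 : ZMod q) ≠ 1 := ZMod.neg_one_ne_one
  have h20 : (2 : ZMod q) ≠ 0 := by
    intro h
    apply hne
    linear_combination -h
  have hpm : (2 : ZMod q) ^ ((q - 1) / 4) = 1 ∨ (2 : ZMod q) ^ ((q - 1) / 4) = -1 := by
    rw [← sq_eq_one_iff, e1, ← pow_mul, show 2 * k * 2 = q / 2 by omega,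
      ← ZMod.euler_criterion q h20]
    exact h2
  unfold quartSym
  push_cast
  rcases neg_one_pow_eq_or ℤ ((q - 1) / 8) with h | h <;>
  rcases neg_one_pow_eq_or (ZMod q) ((q - 1) / 8) with h' | h' <;>
  rcases hpm with h3 | h3
  all_goals first
    | (have hc := congrArg (Int.cast : ℤ → ZMod q) h
       push_cast at hc
       rw [h'] at hc
       first
         | exact absurd hc hne
         | exact absurd hc.symm hne
         | (rw [h, h', h3]; simp [hne, hne.symm]))

end Residues

section LocalRoots

theorem isSquare_mul_of_not_isSquare {F : Type*} [Field F] [Fintype F] [DecidableEq F] {a b : F}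
    (ha : ¬ IsSquare a) (hb : ¬ IsSquare b) : IsSquare (a * b) := by
  have ha0 : a ≠ 0 := by
    rintro rfl
    exact ha IsSquare.zero
  have hb0 : b ≠ 0 := by
    rintro rfl
    exact hb IsSquare.zero
  rw [← quadraticChar_one_iff_isSquare ha0] at ha
  rw [← quadraticChar_one_iff_isSquare hb0] at hb
  rw [← quadraticChar_one_iff_isSquare (mul_ne_zero ha0 hb0), map_mul,
    (quadraticChar_dichotomy ha0).resolve_left ha, (quadraticChar_dichotomy hb0).resolve_left hb]
  norm_num

namespace ZRootTwo

theorem exists_sq_sub_eps_of_two_mul_sq {p : ℕ} [Fact p.Prime] (hp : p ≠ 2) {c i : ZMod p}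
    (hi : i ^ 2 = -1) (hc : 2 * c ^ 2 = 1 + i) : ∃ s : ZRootTwo, (p : ZRootTwo) ∣ s ^ 2 - eps := by
  have h20 : (2 : ZMod p) ≠ 0 := by
    intro h
    have h' : ((2 : ℕ) : ZMod p) = 0 := by exact_mod_cast h
    rw [ZMod.natCast_eq_zero_iff] at h'
    exact hp ((Nat.prime_dvd_prime_iff_eq Fact.out Nat.prime_two).mp h')
  have hc0 : c ≠ 0 := by
    rintro rfl
    refine h20 ?_
    linear_combination (i - 1) * hc + hi
  obtain ⟨a, ha⟩ := ZMod.intCast_surjective c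
  obtain ⟨b, hb⟩ := ZMod.intCast_surjective (1 / (2 * c))
  have hb' : 2 * c * (b : ZMod p) = 1 := by
    rw [hb]
    field_simp
  refine ⟨⟨a, b⟩, ?_⟩
  have e : ((p : ℕ) : ZRootTwo) = ((p : ℤ) : ZRootTwo) := by push_cast; rfl
  rw [e, Zsqrtd.intCast_dvd]
  constructor
  · rw [← ZMod.intCast_zmod_eq_zero_iff_dvd]
    have : ((⟨a, b⟩ : ZRootTwo) ^ 2 - eps).re = a ^ 2 + 2 * b ^ 2 - 1 := by
      simp [sq, eps]
      ring
    rw [this]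
    push_cast
    rw [ha]
    apply mul_left_cancel₀ (mul_ne_zero (pow_ne_zero 2 h20) (pow_ne_zero 2 hc0))
    linear_combination 2 * (2 * c * b + 1) * hb' + (2 * c ^ 2 + i - 1) * hc + hi
  · rw [← ZMod.intCast_zmod_eq_zero_iff_dvd]
    have : ((⟨a, b⟩ : ZRootTwo) ^ 2 - eps).im = 2 * a * b - 1 := by
      simp [sq, eps]
      ring
    rw [this]
    push_cast
    rw [ha]
    linear_combination hb'

theorem exists_sq_sub_eps_of_mod_eight_eq_five {p : ℕ} [Fact p.Prime] (hp : p % 8 = 5) :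
    ∃ s : ZRootTwo, (p : ZRootTwo) ∣ s ^ 2 - eps := by
  have hp2 : p ≠ 2 := by rintro rfl; omega
  have h2 : ¬ IsSquare (2 : ZMod p) := by
    rw [ZMod.exists_sq_eq_two_iff hp2]
    omega
  have h20 : (2 : ZMod p) ≠ 0 := by
    intro h
    exact h2 (h ▸ IsSquare.zero)
  obtain ⟨i, hi⟩ := (ZMod.exists_sq_eq_neg_one_iff (p := p)).mpr (by omega)
  have hi' : i ^ 2 = -1 := by rw [sq, ← hi]
  have key : IsSquare ((1 + i) / 2) ∨ IsSquare ((1 - i) / 2) := by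
    by_contra! h
    obtain ⟨z, hz⟩ := isSquare_mul_of_not_isSquare h.1 h.2
    have hz' : 2 * z ^ 2 = 1 := by
      have : z * z * 4 = 2 := by
        rw [← hz]
        field_simp
        linear_combination -4 * hi'
      apply mul_left_cancel₀ h20
      linear_combination this
    exact h2 ⟨2 * z, by linear_combination -2 * hz'⟩
  rcases key with ⟨c, hc⟩ | ⟨c, hc⟩
  · exact exists_sq_sub_eps_of_two_mul_sq hp2 hi' (c := c) (by rw [sq, ← hc]; field_simp)
  · exact exists_sq_sub_eps_of_two_mul_sq hp2 (i := -i) (by rw [neg_sq, hi']) (c := c)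
      (by rw [sq, ← hc]; field_simp; ring)

theorem exists_sq_sub_eps_of_isSquare {p : ℕ} [Fact p.Prime] (hp : p ≠ 2) {i : ZMod p}
    (hi : i ^ 2 = -1) (h : IsSquare (1 + i)) (h2 : IsSquare (2 : ZMod p)) :
    ∃ s : ZRootTwo, (p : ZRootTwo) ∣ s ^ 2 - eps := by
  obtain ⟨z, hz⟩ := h
  obtain ⟨r, hr⟩ := h2
  have h20 : (2 : ZMod p) ≠ 0 := by
    intro h
    have h' : ((2 : ℕ) : ZMod p) = 0 := by exact_mod_cast h
    rw [ZMod.natCast_eq_zero_iff] at h'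
    exact hp ((Nat.prime_dvd_prime_iff_eq Fact.out Nat.prime_two).mp h')
  have hr0 : r ≠ 0 := by
    rintro rfl
    exact h20 (by rw [hr, mul_zero])
  refine exists_sq_sub_eps_of_two_mul_sq hp hi (c := z / r) ?_
  rw [div_pow, hz, sq r, ← hr]
  field_simp

theorem exists_sq_sub_eps {n : ℕ} (hn : Squarefree n)
    (h : ∀ p : ℕ, p.Prime → p ∣ n → ∃ s : ZRootTwo, (p : ZRootTwo) ∣ s ^ 2 - eps) :
    ∃ s : ZRootTwo, (n : ZRootTwo) ∣ s ^ 2 - eps := by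
  induction n using induction_on_primes with
  | zero => exact absurd hn not_squarefree_zero
  | one => exact ⟨0, by simp⟩
  | prime_mul p a hp ih =>
    obtain ⟨hc, -, ha⟩ := (Nat.squarefree_mul_iff).mp hn
    obtain ⟨s, hs⟩ := ih ha fun q hq hqa => h q hq (dvd_mul_of_dvd_right hqa p)
    obtain ⟨t, ht⟩ := h p hp (dvd_mul_right p a)
    obtain ⟨u, v, huv⟩ := (Nat.isCoprime_iff_coprime.mpr hc).map (Int.castRingHom ZRootTwo)
    simp only [eq_intCast, Int.cast_natCast] at huv
    have hc' : IsCoprime (p : ZRootTwo) (a : ZRootTwo) := ⟨u, v, huv⟩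
    refine ⟨s * (u * p) + t * (v * a), ?_⟩
    rw [Nat.cast_mul]
    refine hc'.mul_dvd ?_ ?_
    · have : (s * (u * p) + t * (v * a)) ^ 2 - eps =
          (t ^ 2 - eps) + p * (u * (s - t) * (s * (u * p) + t * (v * a) + t)) := by
        linear_combination (t * (s * (u * p) + t * (v * a) + t)) * huv
      rw [this]
      exact dvd_add ht (dvd_mul_right _ _)
    · have : (s * (u * p) + t * (v * a)) ^ 2 - eps =
          (s ^ 2 - eps) + a * (v * (t - s) * (s * (u * p) + t * (v * a) + s)) := by
        linear_combination (s * (s * (u * p) + t * (v * a) + s)) * huv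
      rw [this]
      exact dvd_add hs (dvd_mul_right _ _)

end ZRootTwo

end LocalRoots

section Minkowski

open MeasureTheory

/-- **Minkowski's theorem on linear forms**. -/
theorem Matrix.exists_int_abs_mulVec_lt {ι : Type*} [Fintype ι] [DecidableEq ι]
    (M : Matrix ι ι ℝ) (hM : M.det ≠ 0) (c : ι → ℝ) (hc : ∀ i, 0 < c i) (h : |M.det| < ∏ i, c i) :
    ∃ v : ι → ℤ, v ≠ 0 ∧ ∀ i, |M.mulVec (fun k => (v k : ℝ)) i| < c i := by
  classical
  set f : (ι → ℝ) →ₗ[ℝ] (ι → ℝ) := Matrix.toLin' M with hf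
  have hdet : LinearMap.det f = M.det := LinearMap.det_toLin' M
  set B : Set (ι → ℝ) := Set.pi Set.univ fun i => Set.Ioo (-c i) (c i) with hB
  set b := Pi.basisFun ℝ ι with hb
  have fund := ZSpan.isAddFundamentalDomain' b volume
  have : Countable (Submodule.span ℤ (Set.range b)).toAddSubgroup :=
    inferInstanceAs (Countable (Submodule.span ℤ (Set.range b)))
  have hsymm : ∀ x ∈ f ⁻¹' B, -x ∈ f ⁻¹' B := by
    intro x hx i hi
    have := hx i hi
    rw [map_neg]
    exact ⟨neg_lt_neg this.2, neg_lt.mp this.1⟩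
  have hconv : Convex ℝ (f ⁻¹' B) := (convex_pi fun i _ => convex_Ioo _ _).linear_preimage f
  have hlt : volume (ZSpan.fundamentalDomain b) * 2 ^ Module.finrank ℝ (ι → ℝ) < volume (f ⁻¹' B) := by
    have hvol : volume (ZSpan.fundamentalDomain b) = 1 := by
      rw [ZSpan.volume_fundamentalDomain]
      have : Matrix.of (b : ι → ι → ℝ) = 1 := by
        ext i k
        simp [hb, Matrix.one_apply, Pi.single_apply, eq_comm]
      simp [this]
    rw [hvol, Measure.addHaar_preimage_linearMap volume (by rwa [hdet]), hdet, hB,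
      Real.volume_pi_Ioo, one_mul, Module.finrank_fintype_fun_eq_card,
      ← ENNReal.ofReal_prod_of_nonneg (fun i _ => by linarith [hc i]),
      ← ENNReal.ofReal_mul (abs_nonneg _), abs_inv,
      show (2 : ENNReal) ^ Fintype.card ι = ENNReal.ofReal (2 ^ Fintype.card ι) by
        rw [ENNReal.ofReal_pow zero_le_two]; simp]
    have e : ∏ i, (c i - -c i) = 2 ^ Fintype.card ι * ∏ i, c i := by
      rw [← Finset.card_univ, ← Finset.prod_const, ← Finset.prod_mul_distrib]
      exact Finset.prod_congr rfl fun i _ => by ring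
    rw [ENNReal.ofReal_lt_ofReal_iff_of_nonneg (by positivity), e]
    have hd := abs_pos.mpr hM
    rw [inv_mul_eq_div, lt_div_iff₀ hd]
    exact mul_lt_mul_of_pos_left h (by positivity)
  obtain ⟨⟨x, hxL⟩, hx0, hx⟩ :=
    exists_ne_zero_mem_lattice_of_measure_mul_two_pow_lt_measure fund hsymm hconv hlt
  have hx' := (b.mem_span_iff_repr_mem ℤ x).mp hxL
  choose v hv using hx'
  have hv' : (fun k => (v k : ℝ)) = x := by
    ext k
    simpa [hb] using hv k
  refine ⟨v, ?_, fun i => ?_⟩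
  · rintro rfl
    apply hx0
    ext k
    simp [← hv']
  · rw [abs_lt, hv']
    exact hx i (Set.mem_univ i)

namespace ZRootTwo

/-- The embedding of `ℤ[√2]` in `ℝ` sending `√2` to the positive root. -/
noncomputable def toReal₁ : ZRootTwo →+* ℝ := Zsqrtd.lift ⟨√2, by simp⟩

/-- The embedding of `ℤ[√2]` in `ℝ` sending `√2` to the negative root. -/
noncomputable def toReal₂ : ZRootTwo →+* ℝ := Zsqrtd.lift ⟨-√2, by simp⟩

theorem toReal₁_apply (x : ZRootTwo) : toReal₁ x = x.re + x.im * √2 := by simp [toReal₁]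

theorem toReal₂_apply (x : ZRootTwo) : toReal₂ x = x.re - x.im * √2 := by
  simp [toReal₂, sub_eq_add_neg]

theorem toReal_mul_toReal (x : ZRootTwo) : toReal₁ x * toReal₂ x = x.norm := by
  rw [toReal₁_apply, toReal₂_apply, norm_def']
  have h : √2 * √2 = (2 : ℝ) := Real.mul_self_sqrt zero_le_two
  push_cast
  linear_combination (-x.im ^ 2 : ℝ) * h

theorem toReal₂_eq_zero {x : ZRootTwo} : toReal₂ x = 0 ↔ x = 0 := by
  constructor
  · intro h
    have := toReal_mul_toReal x
    rw [h, mul_zero] at this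
    exact norm_eq_zero_iff'.mp (by exact_mod_cast this.symm)
  · rintro rfl
    exact map_zero _

theorem toReal₂_form (x y : ZRootTwo) :
    toReal₂ (x ^ 2 - eps * y ^ 2) = toReal₂ x ^ 2 + (√2 - 1) * toReal₂ y ^ 2 := by
  have : toReal₂ eps = 1 - √2 := by simp [toReal₂_apply, eps]
  rw [map_sub, map_mul, map_pow, map_pow, this]
  ring

theorem toReal₂_form_nonneg (x y : ZRootTwo) : 0 ≤ toReal₂ (x ^ 2 - eps * y ^ 2) := by
  rw [toReal₂_form]
  have : (0 : ℝ) ≤ √2 - 1 := by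
    rw [sub_nonneg, Real.one_le_sqrt]
    norm_num
  positivity

theorem abs_sub_mul_add_lt {N A B C D : ℝ} (hN : 0 < N) (hA : 0 ≤ A) (hB : 0 ≤ B) (hC : 0 ≤ C)
    (hD : 0 ≤ D) (hA' : A < 2.9 * N) (hB' : B < 2.9 * N) (hC' : C < 2.9 * N) (hD' : D < 2.9 * N) :
    |(A - B) * (C + D)| < N ^ 2 * 17 := by
  have h₁ : |A - B| ≤ 2.9 * N := by
    rw [abs_le]
    constructor <;> linarith
  have h₂ : |C + D| ≤ 5.8 * N := by
    rw [abs_of_nonneg (by positivity)]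
    linarith
  rw [abs_mul]
  calc |A - B| * |C + D| ≤ (2.9 * N) * (5.8 * N) := mul_le_mul h₁ h₂ (abs_nonneg _) (by positivity)
    _ < N ^ 2 * 17 := by nlinarith [pow_pos hN 2]

theorem exists_form_eq_mul_small {n : ℕ} (hn : 0 < n) {s : ZRootTwo}
    (hs : (n : ZRootTwo) ∣ s ^ 2 - eps) :
    ∃ x y m : ZRootTwo, x ^ 2 - eps * y ^ 2 = n * m ∧ m ≠ 0 ∧ m.norm.natAbs ≤ 16 := by
  have hr2 : √2 ^ 2 = (2 : ℝ) := Real.sq_sqrt zero_le_two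
  have hr1 : 1 < √2 := Real.one_lt_sqrt_two
  set r : ℝ := √2 with hr
  have hn' : (0 : ℝ) < n := by exact_mod_cast hn
  set M : Matrix (Fin 4) (Fin 4) ℝ := !![(n : ℝ), n * r, s.re + s.im * r, (s.re + s.im * r) * r;
    n, -(n * r), s.re - s.im * r, -((s.re - s.im * r) * r);
    0, 0, 1, r; 0, 0, 1, -r] with hM
  have hdet : M.det = 8 * n ^ 2 := by
    simp [hM, Matrix.det_succ_row_zero, Fin.sum_univ_succ]
    simp [Fin.succAbove]
    linear_combination 4 * (n : ℝ) ^ 2 * hr2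
  set c : Fin 4 → ℝ := ![√(2.9 * n), √(2.9 * n), √(2.9 * n * (r - 1)), √(2.9 * n * (r + 1))] with hc
  have hr1' : 0 < r - 1 := by linarith
  have hr1'' : 0 < r + 1 := by linarith
  have hcpos : ∀ i, 0 < c i := by
    intro i
    fin_cases i <;> simp only [hc] <;> simp <;> positivity
  have hprod : ∏ i, c i = 8.41 * n ^ 2 := by
    have e : √(2.9 * n * (r - 1)) * √(2.9 * n * (r + 1)) = 2.9 * n := by
      rw [← Real.sqrt_mul (by positivity), Real.sqrt_eq_iff_mul_self_eq (by positivity) (by positivity)]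
      linear_combination (2.9 ^ 2 * (n : ℝ) ^ 2) * hr2
    rw [Fin.prod_univ_four]
    simp only [hc]
    simp only [Matrix.cons_val]
    rw [Real.mul_self_sqrt (by positivity), mul_assoc, e]
    ring
  obtain ⟨v, hv0, hv⟩ := M.exists_int_abs_mulVec_lt (by rw [hdet]; positivity) c hcpos (by
    rw [hdet, hprod, abs_of_pos (by positivity)]
    nlinarith [pow_pos hn' 2])
  set y : ZRootTwo := ⟨v 2, v 3⟩ with hy
  set z : ZRootTwo := ⟨v 0, v 1⟩ with hz
  set x : ZRootTwo := n * z + s * y with hx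
  have hx1 : toReal₁ x = M.mulVec (fun k => (v k : ℝ)) 0 := by
    simp only [hx, map_add, map_mul, map_natCast, toReal₁_apply, ← hr, hM, Matrix.mulVec,
      dotProduct, Fin.sum_univ_four]
    simp [hy, hz]
    ring
  have hx2 : toReal₂ x = M.mulVec (fun k => (v k : ℝ)) 1 := by
    simp only [hx, map_add, map_mul, map_natCast, toReal₂_apply, ← hr, hM, Matrix.mulVec,
      dotProduct, Fin.sum_univ_four]
    simp [hy, hz]
    ring
  have hy1 : toReal₁ y = M.mulVec (fun k => (v k : ℝ)) 2 := by
    simp only [toReal₁_apply, ← hr, hM, Matrix.mulVec, dotProduct, Fin.sum_univ_four]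
    simp [hy]
    ring
  have hy2 : toReal₂ y = M.mulVec (fun k => (v k : ℝ)) 3 := by
    simp only [toReal₂_apply, ← hr, hM, Matrix.mulVec, dotProduct, Fin.sum_univ_four]
    simp [hy]
    ring
  have bx1 := hv 0
  have bx2 := hv 1
  have by1 := hv 2
  have by2 := hv 3
  rw [← hx1] at bx1
  rw [← hx2] at bx2
  rw [← hy1] at by1
  rw [← hy2] at by2
  simp only [hc, Matrix.cons_val] at bx1 bx2 by1 by2
  rw [Real.lt_sqrt (abs_nonneg _), sq_abs] at bx1 bx2 by1 by2
  have by1' : (r + 1) * toReal₁ y ^ 2 < 2.9 * n := by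
    nlinarith
  have by2' : (r - 1) * toReal₂ y ^ 2 < 2.9 * n := by
    nlinarith
  have hdvd : (n : ZRootTwo) ∣ x ^ 2 - eps * y ^ 2 := by
    have : x ^ 2 - eps * y ^ 2 = n * (z * (n * z + 2 * s * y)) + (s ^ 2 - eps) * y ^ 2 := by
      rw [hx]; ring
    rw [this]
    exact dvd_add (dvd_mul_right _ _) (dvd_mul_of_dvd_left hs _)
  obtain ⟨m, hm⟩ := hdvd
  have f1 : toReal₁ (x ^ 2 - eps * y ^ 2) = toReal₁ x ^ 2 - (r + 1) * toReal₁ y ^ 2 := by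
    have : toReal₁ eps = r + 1 := by simp [toReal₁_apply, eps, hr, add_comm]
    rw [map_sub, map_mul, map_pow, map_pow, this]
  have f2 := toReal₂_form x y
  rw [← hr] at f2
  refine ⟨x, y, m, hm, ?_, ?_⟩
  · rintro rfl
    rw [hm, mul_zero, map_zero] at f2
    have hy0 : toReal₂ y = 0 := by
      by_contra h
      have : 0 < toReal₂ y ^ 2 := by positivity
      nlinarith [sq_nonneg (toReal₂ x)]
    have hx0 : toReal₂ x = 0 := by
      rw [hy0] at f2
      exact pow_eq_zero_iff two_ne_zero |>.mp (by linarith)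
    rw [toReal₂_eq_zero] at hx0 hy0
    rw [hx, hy0, mul_zero, add_zero] at hx0
    have hz0 : z = 0 := (mul_eq_zero.mp hx0).resolve_left (by exact_mod_cast hn.ne')
    apply hv0
    ext k
    have h0 := congrArg Zsqrtd.re hz0
    have h1 := congrArg Zsqrtd.im hz0
    have h2 := congrArg Zsqrtd.re hy0
    have h3 := congrArg Zsqrtd.im hy0
    fin_cases k
    · exact h0
    · exact h1
    · exact h2
    · exact h3
  · have hN := toReal_mul_toReal (x ^ 2 - eps * y ^ 2)
    have hnm : ((x ^ 2 - eps * y ^ 2).norm : ℝ) = n ^ 2 * m.norm := by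
      rw [hm, Zsqrtd.norm_mul, Zsqrtd.norm_natCast]
      push_cast
      ring
    rw [hnm, f1, f2] at hN
    have hlt : |(n : ℝ) ^ 2 * m.norm| < n ^ 2 * 17 := by
      rw [← hN]
      exact abs_sub_mul_add_lt hn' (sq_nonneg _) (mul_nonneg hr1''.le (sq_nonneg _)) (sq_nonneg _)
        (mul_nonneg hr1'.le (sq_nonneg _)) bx1 by1' bx2 by2'
    rw [abs_mul, abs_of_pos (by positivity : (0 : ℝ) < n ^ 2)] at hlt
    have := lt_of_mul_lt_mul_left hlt (by positivity)
    have h3 : ((m.norm.natAbs : ℕ) : ℝ) < 17 := by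
      rw [Nat.cast_natAbs, Int.cast_abs]
      exact this
    have h4 : m.norm.natAbs < 17 := by exact_mod_cast h3
    omega

end ZRootTwo

end Minkowski

namespace ZRootTwo

theorem toReal₂_natCast_mul_pos {n : ℕ} (hn : 0 < n) {w : ZRootTwo} (hw : w ≠ 0) :
    0 < toReal₂ (n * w ^ 2) := by
  have : toReal₂ w ≠ 0 := by rwa [Ne, toReal₂_eq_zero]
  rw [map_mul, map_pow, map_natCast]
  positivity

theorem toReal₂_eps_neg : toReal₂ eps < 0 := by
  have : toReal₂ eps = 1 - √2 := by simp [toReal₂_apply, eps]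
  rw [this, sub_neg]
  exact Real.one_lt_sqrt_two

theorem exists_form_eq_mul_sq_of_unit {n : ℕ} (hn : 0 < n) {x y w u : ZRootTwo} (hw : w ≠ 0)
    (hu : IsUnit u) (h : x ^ 2 - eps * y ^ 2 = n * w ^ 2 * u) :
    ∃ x y w : ZRootTwo, w ≠ 0 ∧ x ^ 2 - eps * y ^ 2 = n * w ^ 2 := by
  obtain ⟨u, rfl⟩ := hu
  have hnn := toReal₂_form_nonneg x y
  have key : ∀ v : ZRootTwoˣ, w * v ≠ 0 := fun v => mul_ne_zero hw v.ne_zero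
  obtain ⟨v, hv | hv | hv | hv⟩ := unit_mod_squares u
  · refine ⟨x, y, w * v, key v, ?_⟩
    rw [h, hv]
    push_cast
    ring
  · exfalso
    have : x ^ 2 - eps * y ^ 2 = -(n * (w * v) ^ 2) := by
      rw [h, hv]
      push_cast
      ring
    rw [this, map_neg] at hnn
    linarith [toReal₂_natCast_mul_pos hn (key v)]
  · exfalso
    have : x ^ 2 - eps * y ^ 2 = eps * (n * (w * v) ^ 2) := by
      rw [h, hv]
      push_cast [val_epsUnit]
      ring
    rw [this, map_mul] at hnn
    exact absurd (mul_neg_of_neg_of_pos toReal₂_eps_neg (toReal₂_natCast_mul_pos hn (key v)))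
      hnn.not_gt
  · refine ⟨eps * y, x, eps * (w * v), mul_ne_zero isUnit_eps.ne_zero (key v), ?_⟩
    have : x ^ 2 - eps * y ^ 2 = -(eps * (n * (w * v) ^ 2)) := by
      rw [h, hv]
      push_cast [val_epsUnit]
      ring
    linear_combination (-eps) * this

theorem isUnit_of_natAbs_norm_eq_one {u : ZRootTwo} (h : u.norm.natAbs = 1) : IsUnit u :=
  Zsqrtd.norm_eq_one_iff.mp h

theorem form_div_sqrtd {n m x y : ZRootTwo} (h : x ^ 2 - eps * y ^ 2 = n * (Zsqrtd.sqrtd * m)) :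
    ∃ x' y' : ZRootTwo, x' ^ 2 - eps * y' ^ 2 = n * -m := by
  have hre := congrArg Zsqrtd.re h
  simp [eps, pow_two] at hre
  have h2 : (x.re - y.re) % 2 = 0 := by
    have e : (x.re - y.re) * (x.re + y.re) % 2 = 0 := by
      have : (x.re - y.re) * (x.re + y.re) = 2 * (-(x.im * x.im) + y.im * y.im +
          (y.re * y.im + y.im * y.re) + (n.re * m.im + n.im * m.re)) := by linarith
      omega
    rcases Int.even_or_odd (x.re - y.re) with h | h
    · exact Int.even_iff.mp h
    · have h' : Odd (x.re + y.re) := by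
        have : x.re + y.re = x.re - y.re + 2 * y.re := by ring
        rw [this]
        exact h.add_even (even_two_mul _)
      have := Int.odd_iff.mp (h.mul h')
      omega
  obtain ⟨k, hk⟩ := Int.dvd_of_emod_eq_zero h2
  set z : ZRootTwo := ⟨y.im - x.im, -k⟩ with hz
  have hx : x = y - Zsqrtd.sqrtd * z := by
    ext
    · simp [hz]; linarith
    · simp [hz]
  have hs : (Zsqrtd.sqrtd : ZRootTwo) * Zsqrtd.sqrtd = 2 := by ext <;> simp
  have he : eps = 1 + Zsqrtd.sqrtd := by ext <;> simp [eps]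
  have hs0 : (Zsqrtd.sqrtd : ZRootTwo) ≠ 0 := by
    intro h
    have := congrArg Zsqrtd.im h
    simp at this
  refine ⟨z + y, z, mul_left_cancel₀ hs0 ?_⟩
  rw [he] at h ⊢
  rw [hx] at h
  linear_combination (-1) * h + z ^ 2 * hs - z ^ 2 * hs

theorem zmod_three_form (a b c d : ZMod 3) (h₁ : a * a + 2 * (b * b) = c * c + 2 * (d * d) + 4 * (c * d))
    (h₂ : 2 * (a * b) = c * c + 2 * (d * d) + 2 * (c * d)) : a = 0 ∧ b = 0 ∧ c = 0 ∧ d = 0 := by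
  revert a b c d
  decide

theorem zmod_seven_form (a b : ZMod 7) (h : a ^ 2 = 5 * b ^ 2) : a = 0 ∧ b = 0 := by
  revert a b
  decide

theorem three_dvd_of_form {x y m : ZRootTwo} (h : x ^ 2 - eps * y ^ 2 = 3 * m) : 3 ∣ x ∧ 3 ∣ y := by
  have h3 : (3 : ZRootTwo) = ((3 : ℤ) : ZRootTwo) := by norm_cast
  have h3' : (3 : ZRootTwo) = ⟨3, 0⟩ := by ext <;> rfl
  have h30 : (3 : ZMod 3) = 0 := rfl
  rw [h3'] at h
  have hre := congrArg (fun z : ZRootTwo => (z.re : ZMod 3)) h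
  have him := congrArg (fun z : ZRootTwo => (z.im : ZMod 3)) h
  simp [eps, pow_two, h30] at hre him
  obtain ⟨e₁, e₂, e₃, e₄⟩ := zmod_three_form x.re x.im y.re y.im (by linear_combination hre)
    (by linear_combination him)
  rw [h3, Zsqrtd.intCast_dvd, Zsqrtd.intCast_dvd]
  exact ⟨⟨(ZMod.intCast_zmod_eq_zero_iff_dvd _ 3).mp e₁, (ZMod.intCast_zmod_eq_zero_iff_dvd _ 3).mp e₂⟩,
    ⟨(ZMod.intCast_zmod_eq_zero_iff_dvd _ 3).mp e₃, (ZMod.intCast_zmod_eq_zero_iff_dvd _ 3).mp e₄⟩⟩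

/-- Reduction modulo the prime `3 + √2` of norm `7`. -/
def toZModSeven : ZRootTwo →+* ZMod 7 := Zsqrtd.lift ⟨4, by decide⟩

theorem toZModSeven_apply (x : ZRootTwo) : toZModSeven x = x.re + x.im * 4 := by simp [toZModSeven]

theorem toZModSeven_eq_zero {x : ZRootTwo} (h : toZModSeven x = 0) : (⟨3, 1⟩ : ZRootTwo) ∣ x := by
  rw [toZModSeven_apply] at h
  have : (7 : ℤ) ∣ x.re + x.im * 4 := by
    have := (ZMod.intCast_zmod_eq_zero_iff_dvd (x.re + x.im * 4) 7).mp (by push_cast; exact h)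
    exact_mod_cast this
  obtain ⟨k, hk⟩ := this
  refine ⟨⟨3 * k - 2 * x.im, x.im - k⟩, ?_⟩
  ext
  · simp; linarith
  · simp; ring

theorem seven_dvd_of_sq {a b : ℤ} (h : 7 ∣ a ^ 2 - 2 * b ^ 2) : 7 ∣ a + b * 4 ∨ 7 ∣ a - b * 4 := by
  have : (7 : ℤ) ∣ (a + b * 4) * (a - b * 4) := by
    have e : (a + b * 4) * (a - b * 4) = a ^ 2 - 2 * b ^ 2 - 7 * (2 * b ^ 2) := by ring
    rw [e]
    exact dvd_sub h (dvd_mul_right _ _)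
  exact (Int.Prime.dvd_mul' (p := 7) (by norm_num) this)

theorem exists_form_eq_mul_sq_of_small {n : ℕ} (hn : 0 < n) (h3 : ¬ 3 ∣ n) (h7 : ¬ 7 ∣ n) (k : ℕ) :
    ∀ x y m : ZRootTwo, x ^ 2 - eps * y ^ 2 = n * m → m ≠ 0 → m.norm.natAbs = k → k ≤ 16 →
      ∃ x y w : ZRootTwo, w ≠ 0 ∧ x ^ 2 - eps * y ^ 2 = n * w ^ 2 := by
  induction k using Nat.strong_induction_on with
  | _ k ih =>
  intro x y m h hm hk hk16
  have hN := norm_def' m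
  rcases Int.even_or_odd m.re with he | ho
  · obtain ⟨c, hc⟩ := he
    set m' : ZRootTwo := ⟨m.im, c⟩ with hm'
    have hmm : m = Zsqrtd.sqrtd * m' := by
      ext
      · simp [hm']; linarith
      · simp [hm']
    have hm0 : m' ≠ 0 := by
      rintro h0
      exact hm (by rw [hmm, h0, mul_zero])
    obtain ⟨x', y', h'⟩ := form_div_sqrtd (hmm ▸ h)
    have hn' : k = 2 * m'.norm.natAbs := by
      rw [← hk, hmm, Zsqrtd.norm_mul, Int.natAbs_mul]
      congr 1
    have hpos : 0 < m'.norm.natAbs := by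
      rw [Int.natAbs_pos, Ne, norm_eq_zero_iff']
      exact hm0
    refine ih m'.norm.natAbs (by omega) x' y' (-m') h' (neg_ne_zero.mpr hm0) ?_ (by omega)
    rw [Zsqrtd.norm_neg]
  · have hodd : m.norm % 8 = 1 ∨ m.norm % 8 = 7 := by
      obtain ⟨c, hc⟩ := ho
      have e1 : m.re ^ 2 = 4 * (c * (c + 1)) + 1 := by rw [hc]; ring
      obtain ⟨c', hc'⟩ := Int.even_mul_succ_self c
      rw [hN, e1, hc']
      rcases Int.even_or_odd' m.im with ⟨d, hd | hd⟩
      · have : m.im ^ 2 = 4 * d ^ 2 := by rw [hd]; ring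
        omega
      · have : m.im ^ 2 = 4 * (d ^ 2 + d) + 1 := by rw [hd]; ring
        omega
    have h3m : (3 : ℤ) ∣ m.norm → ∃ m' : ZRootTwo, m = 3 * m' := by
      intro hd
      have hz : ((m.re : ZMod 3)) ^ 2 - 2 * (m.im : ZMod 3) ^ 2 = 0 := by
        have := (ZMod.intCast_zmod_eq_zero_iff_dvd m.norm 3).mpr (by exact_mod_cast hd)
        rw [hN] at this
        push_cast at this
        exact this
      have hz' : (m.re : ZMod 3) = 0 ∧ (m.im : ZMod 3) = 0 := by
        generalize (m.re : ZMod 3) = a at hz ⊢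
        generalize (m.im : ZMod 3) = b at hz ⊢
        revert a b
        decide
      have : ((3 : ℤ) : ZRootTwo) ∣ m := by
        rw [Zsqrtd.intCast_dvd]
        exact ⟨(ZMod.intCast_zmod_eq_zero_iff_dvd _ 3).mp hz'.1,
          (ZMod.intCast_zmod_eq_zero_iff_dvd _ 3).mp hz'.2⟩
      obtain ⟨m', hm'⟩ := this
      exact ⟨m', by exact_mod_cast hm'⟩
    have h3norm : ∀ m' : ZRootTwo, m = 3 * m' → m.norm.natAbs = 9 * m'.norm.natAbs := by
      rintro m' rfl
      rw [Zsqrtd.norm_mul, Int.natAbs_mul]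
      congr 1
    have hcases : k = 1 ∨ k = 7 ∨ k = 9 := by
      have : k = 1 ∨ k = 7 ∨ k = 9 ∨ k = 15 := by omega
      rcases this with h | h | h | h
      · exact .inl h
      · exact .inr (.inl h)
      · exact .inr (.inr h)
      · obtain ⟨m', hm'⟩ := h3m (by omega)
        have := h3norm m' hm'
        omega
    rcases hcases with rfl | rfl | rfl
    · exact exists_form_eq_mul_sq_of_unit hn one_ne_zero (isUnit_of_natAbs_norm_eq_one hk)
        (by rw [h]; ring)
    · rcases seven_dvd_of_sq (a := m.re) (b := m.im) (by rw [← hN]; omega) with hd | hd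
      · exfalso
        have hunit : ∀ z : ZRootTwo, m = ⟨3, 1⟩ * z → IsUnit z := by
          rintro z rfl
          rw [Zsqrtd.norm_mul, Int.natAbs_mul] at hk
          apply isUnit_of_natAbs_norm_eq_one
          rw [show (⟨3, 1⟩ : ZRootTwo).norm.natAbs = 7 from rfl] at hk
          omega
        obtain ⟨z, hz⟩ := toZModSeven_eq_zero (x := m) (by
          rw [toZModSeven_apply]
          have := (ZMod.intCast_zmod_eq_zero_iff_dvd (m.re + m.im * 4) 7).mpr (by exact_mod_cast hd)
          push_cast at this
          exact this)
        have hzu := hunit z hz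
        have h0 : toZModSeven ⟨3, 1⟩ = 0 := by rw [toZModSeven_apply]; rfl
        have heps : toZModSeven eps = 5 := by rw [toZModSeven_apply]; rfl
        have hφ := congrArg toZModSeven h
        rw [hz, map_mul, map_mul, h0, zero_mul, mul_zero, map_sub, map_mul, map_pow, map_pow, heps,
          sub_eq_zero] at hφ
        obtain ⟨hx, hy⟩ := zmod_seven_form _ _ hφ
        obtain ⟨x', rfl⟩ := toZModSeven_eq_zero hx
        obtain ⟨y', rfl⟩ := toZModSeven_eq_zero hy
        have h31 : (⟨3, 1⟩ : ZRootTwo) ≠ 0 := by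
          intro h
          have := congrArg Zsqrtd.im h
          simp at this
        have hcan : (n : ZRootTwo) * z = ⟨3, 1⟩ * (x' ^ 2 - eps * y' ^ 2) := by
          apply mul_left_cancel₀ h31
          rw [hz] at h
          linear_combination -h
        have hφ' := congrArg toZModSeven hcan
        rw [map_mul, map_mul, h0, zero_mul, map_natCast] at hφ'
        have : Fact (Nat.Prime 7) := ⟨by norm_num⟩
        have : ((n : ℕ) : ZMod 7) = 0 :=
          (mul_eq_zero.mp hφ').resolve_right (hzu.map toZModSeven).ne_zero
        exact h7 ((ZMod.natCast_eq_zero_iff n 7).mp this)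
      · obtain ⟨c, hc⟩ := hd
        set u : ZRootTwo := ⟨3 * c + 2 * m.im, m.im + c⟩ with hu
        have hmu : m = ⟨3, -1⟩ * u := by
          ext
          · simp [hu]; linarith
          · simp [hu]; ring
        have huu : IsUnit u := by
          apply isUnit_of_natAbs_norm_eq_one
          rw [hmu, Zsqrtd.norm_mul, Int.natAbs_mul] at hk
          rw [show (⟨3, -1⟩ : ZRootTwo).norm.natAbs = 7 from rfl] at hk
          omega
        have h31 : (⟨3, -1⟩ : ZRootTwo) ≠ 0 := by
          intro h
          have := congrArg Zsqrtd.im h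
          simp at this
        refine exists_form_eq_mul_sq_of_unit (x := 2 * x + eps * y) (y := x + 2 * y) hn h31 huu ?_
        have e : (⟨3, -1⟩ : ZRootTwo) = 4 - eps := by ext <;> simp [eps]
        rw [hmu] at h
        have : (2 * x + eps * y) ^ 2 - eps * (x + 2 * y) ^ 2 = (4 - eps) * (x ^ 2 - eps * y ^ 2) := by
          ring
        rw [this, h, ← e]
        ring
    · exfalso
      obtain ⟨m', hm'⟩ := h3m (by omega)
      have hu : IsUnit m' := isUnit_of_natAbs_norm_eq_one (by have := h3norm m' hm'; omega)
      obtain ⟨⟨x', hx'⟩, ⟨y', hy'⟩⟩ := three_dvd_of_form (x := x) (y := y) (m := n * m')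
        (by rw [h, hm']; ring)
      have h30 : (3 : ZRootTwo) ≠ 0 := by
        intro h
        have := congrArg Zsqrtd.re h
        simp at this
      have hcan : (n : ZRootTwo) * m' = 3 * (x' ^ 2 - eps * y' ^ 2) := by
        apply mul_left_cancel₀ h30
        rw [hm', hx', hy'] at h
        linear_combination -h
      have hdvd : ((3 : ℤ) : ZRootTwo) ∣ (((n : ℕ) : ℤ) : ZRootTwo) := by
        rw [Int.cast_natCast, Int.cast_ofNat]
        exact (hu.dvd_mul_right (a := (3 : ZRootTwo)) (b := (n : ZRootTwo))).mp ⟨_, hcan⟩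
      have := (Zsqrtd.intCast_dvd_intCast 3 (n : ℤ)).mp hdvd
      exact h3 (by exact_mod_cast this)

theorem exists_form_eq_mul_sq {n : ℕ} (hn : 0 < n) (h3 : ¬ 3 ∣ n) (h7 : ¬ 7 ∣ n) {s : ZRootTwo}
    (hs : (n : ZRootTwo) ∣ s ^ 2 - eps) :
    ∃ x y w : ZRootTwo, w ≠ 0 ∧ x ^ 2 - eps * y ^ 2 = n * w ^ 2 := by
  obtain ⟨x, y, m, h, hm, hk⟩ := exists_form_eq_mul_small hn hs
  exact exists_form_eq_mul_sq_of_small hn h3 h7 _ x y m h hm rfl hk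

end ZRootTwo

namespace QuadraticOver

variable {K : Type*} [Field K] [NumberField K]

open ZRootTwo

theorem norm_div_eq {d : ZRootTwo} (D : QuadraticOver K d) {X Y w e : ZRootTwo} (hY : Y ≠ 0)
    (h : X ^ 2 - e * Y ^ 2 = d * w ^ 2) : ∃ z : K, z * D.σ z = D.j e := by
  have hY' : D.j Y ≠ 0 := by rwa [Ne, D.j_eq_zero]
  refine ⟨(D.j X + D.j w * D.θ) / D.j Y, ?_⟩
  have h' := congrArg D.j h
  simp only [map_sub, map_mul, map_pow] at h'
  rw [map_div₀, map_add, map_mul, D.σ_j, D.σ_j, D.σ_j, D.σ_θ, div_mul_div_comm,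
    div_eq_iff (mul_ne_zero hY' hY')]
  linear_combination h' - (D.j w) ^ 2 * D.θ_sq

theorem exists_norm_eq_eps {n : ℕ} (hn : 0 < n) (D : QuadraticOver K (n * ⟨2, 1⟩))
    (h3 : ¬ 3 ∣ n) (h7 : ¬ 7 ∣ n) {s : ZRootTwo} (hs : (n : ZRootTwo) ∣ s ^ 2 - eps) :
    ∃ y : K, y * D.σ y = D.j eps := by
  obtain ⟨x, y, w, hw, h⟩ := exists_form_eq_mul_sq hn h3 h7 hs
  have h21 : (⟨2, 1⟩ : ZRootTwo) = eps ^ 2 - eps := by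
    ext <;> simp [eps, pow_two]
  refine D.norm_div_eq (X := eps * x + eps * y) (Y := x + eps * y) (w := w) ?_ ?_
  · intro hY
    have hx : x = -(eps * y) := by linear_combination hY
    have e : n * w ^ 2 = (⟨2, 1⟩ : ZRootTwo) * y ^ 2 := by
      rw [← h, hx, h21]
      ring
    have e' := congrArg Zsqrtd.norm e
    rw [Zsqrtd.norm_mul, Zsqrtd.norm_mul, Zsqrtd.norm_natCast, pow_two, pow_two, Zsqrtd.norm_mul,
      Zsqrtd.norm_mul, show (⟨2, 1⟩ : ZRootTwo).norm = 2 from rfl] at e'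
    have hz : (⟨n * w.norm, y.norm⟩ : ZRootTwo) = 0 := by
      rw [← norm_eq_zero_iff', norm_def']
      dsimp only
      linear_combination e'
    have hz' := congrArg Zsqrtd.re hz
    simp [norm_eq_zero_iff', hw, hn.ne'] at hz'
  · rw [h21]
    linear_combination (eps ^ 2 - eps) * h

theorem exists_norm_eq_neg_one {n : ℕ} (hn : Squarefree n) (D : QuadraticOver K (n * ⟨2, 1⟩))
    (h : ∀ p, p.Prime → p ∣ n → p % 4 ≠ 3) : ∃ y : K, y * D.σ y = -1 := by
  obtain ⟨a, b, hab⟩ := Nat.eq_sq_add_sq_of_isSquare_mod_neg_one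
    ((ZMod.isSquare_neg_one_iff_forall_mem_primeFactors_mod_four_ne_three hn).mpr fun q hq =>
      h q (Nat.prime_of_mem_primeFactors hq) (Nat.dvd_of_mem_primeFactors hq))
  have hab' : (n : ZRootTwo) = a ^ 2 + b ^ 2 := by
    rw [hab]
    push_cast
    rfl
  have : ∃ y : K, y * D.σ y = D.j (-1) := by
    refine D.norm_div_eq (X := eps * a - b) (Y := eps * b + a) (w := ⟨0, 1⟩) ?_ ?_
    · intro hY
      have hre := congrArg Zsqrtd.re hY
      have him := congrArg Zsqrtd.im hY
      simp [eps] at hre him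
      subst him
      simp at hre
      subst hre
      simp at hab
      exact hn.ne_zero hab
    · have h2 : (⟨2, 1⟩ : ZRootTwo) * ⟨0, 1⟩ ^ 2 = eps ^ 2 + 1 := by
        ext <;> simp [eps, pow_two]
      rw [mul_assoc, h2, hab']
      ring
  simpa using this

end QuadraticOver

namespace ZRootTwo

theorem isSquare_of_form {d e π : ZRootTwo} (hd : Squarefree d) (hπ : Prime π) (hπd : π ∣ d)
    {F : Type*} [Field F] (φ : ZRootTwo →+* F) (hφ : ∀ x, φ x = 0 ↔ π ∣ x) (k : ℕ) :
    ∀ a b c : ZRootTwo, c ≠ 0 → c.norm.natAbs = k → e * c ^ 2 = a ^ 2 - d * b ^ 2 →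
      IsSquare (φ e) := by
  induction k using Nat.strong_induction_on with
  | _ k ih =>
  intro a b c hc hk h
  have hφd : φ d = 0 := (hφ d).mpr hπd
  have h' := congrArg φ h
  rw [map_mul, map_pow, map_sub, map_pow, map_mul, hφd, zero_mul, sub_zero] at h'
  by_cases h0 : φ c = 0
  · obtain ⟨c', rfl⟩ := (hφ c).mp h0
    rw [h0, zero_pow two_ne_zero, mul_zero] at h'
    obtain ⟨a', rfl⟩ := (hφ a).mp (pow_eq_zero_iff two_ne_zero |>.mp h'.symm)
    obtain ⟨f, rfl⟩ := hπd
    have e1 : f * b ^ 2 = π * (a' ^ 2 - e * c' ^ 2) := by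
      apply mul_left_cancel₀ hπ.ne_zero
      linear_combination h
    have hf : ¬ π ∣ f := by
      rintro ⟨g, rfl⟩
      exact hπ.not_isUnit (hd π ⟨g, by ring⟩)
    obtain ⟨b', rfl⟩ := hπ.dvd_of_dvd_pow ((hπ.dvd_or_dvd (Dvd.intro _ e1.symm)).resolve_left hf)
    have hc' : c' ≠ 0 := right_ne_zero_of_mul hc
    have hlt : c'.norm.natAbs < k := by
      rw [← hk, Zsqrtd.norm_mul, Int.natAbs_mul]
      have h1 : 0 < c'.norm.natAbs := by
        rwa [Int.natAbs_pos, Ne, norm_eq_zero_iff']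
      have h2 : 0 < π.norm.natAbs := by
        rw [Int.natAbs_pos, Ne, norm_eq_zero_iff']
        exact hπ.ne_zero
      have h3 : π.norm.natAbs ≠ 1 := fun h => hπ.not_isUnit (isUnit_of_natAbs_norm_eq_one h)
      exact lt_mul_of_one_lt_left h1 (by omega)
    refine ih _ hlt a' b' c' hc' rfl ?_
    apply mul_left_cancel₀ (pow_ne_zero 2 hπ.ne_zero)
    linear_combination h
  · refine ⟨φ a / φ c, ?_⟩
    field_simp
    linear_combination h'

end ZRootTwo

namespace QuadraticOver

variable {K : Type*} [Field K] [NumberField K]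

theorem exists_form_of_norm {d : ZRootTwo} (D : QuadraticOver K d) {e : ZRootTwo}
    (h : ∃ y : K, y * D.σ y = D.j e) :
    ∃ a b c : ZRootTwo, c ≠ 0 ∧ e * c ^ 2 = a ^ 2 - d * b ^ 2 := by
  obtain ⟨y, hy⟩ := h
  obtain ⟨a₁, b₁, hb₁, e₁⟩ := D.fixed (y + D.σ y) (by rw [map_add, D.σ_σ, add_comm])
  obtain ⟨a₂, b₂, hb₂, e₂⟩ := D.fixed ((y - D.σ y) / D.θ) (by
    rw [map_div₀, map_sub, D.σ_σ, D.σ_θ, div_neg, ← neg_div, neg_sub])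
  have h2 : (2 : ZRootTwo) ≠ 0 := by
    intro h
    have := congrArg Zsqrtd.re h
    simp at this
  refine ⟨a₁ * b₂, a₂ * b₁, 2 * (b₁ * b₂), mul_ne_zero h2 (mul_ne_zero hb₁ hb₂), ?_⟩
  apply D.j_injective
  simp only [map_mul, map_sub, map_pow, ← e₁, ← e₂, ← hy, map_ofNat, ← D.θ_sq]
  have := D.θ_ne
  field_simp
  ring

theorem isSquare_of_norm {d : ZRootTwo} (D : QuadraticOver K d) (hd : Squarefree d) {F : Type*}
    [Field F] (φ : ZRootTwo →+* F) (hφ : φ d = 0) {e : ZRootTwo}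
    (h : ∃ y : K, y * D.σ y = D.j e) : IsSquare (φ e) := by
  obtain ⟨a, b, c, hc, h⟩ := D.exists_form_of_norm h
  have hker : RingHom.ker φ ≠ ⊥ := by
    intro h0
    have : d ∈ RingHom.ker φ := hφ
    rw [h0, Ideal.mem_bot] at this
    exact hd.ne_zero this
  have hprime : (RingHom.ker φ).IsPrime := RingHom.ker_isPrime φ
  have hmem : ∀ x, φ x = 0 ↔ Submodule.IsPrincipal.generator (RingHom.ker φ) ∣ x := fun x => by
    rw [← RingHom.mem_ker, Submodule.IsPrincipal.mem_iff_generator_dvd]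
  exact ZRootTwo.isSquare_of_form hd
    (Submodule.IsPrincipal.prime_generator_of_isPrime _ hker) ((hmem d).mp hφ) φ hmem _ a b c hc rfl h

end QuadraticOver

namespace ZRootTwo

theorem prime_of_prime_natAbs_norm {x : ZRootTwo} (h : x.norm.natAbs.Prime) : Prime x := by
  refine Irreducible.prime ⟨fun hu => h.ne_one (Zsqrtd.norm_eq_one_iff.mpr hu), ?_⟩
  rintro a b rfl
  rw [Zsqrtd.norm_mul, Int.natAbs_mul] at h
  rcases Nat.prime_mul_iff.mp h with ⟨-, hb⟩ | ⟨-, ha⟩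
  · exact .inr (isUnit_of_natAbs_norm_eq_one hb)
  · exact .inl (isUnit_of_natAbs_norm_eq_one ha)

theorem prime_sqrtd : Prime (Zsqrtd.sqrtd : ZRootTwo) :=
  prime_of_prime_natAbs_norm (by rw [norm_def']; norm_num)

theorem natAbs_norm_eq_of_associated {x y : ZRootTwo} (h : Associated x y) :
    x.norm.natAbs = y.norm.natAbs := by
  obtain ⟨u, rfl⟩ := h
  rw [Zsqrtd.norm_mul, Int.natAbs_mul, Zsqrtd.norm_eq_one_iff.mpr u.isUnit, mul_one]

theorem norm_emod_eight {x : ZRootTwo} (h : x.norm % 2 = 1) : x.norm % 8 = 1 ∨ x.norm % 8 = 7 := by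
  have hN := norm_def' x
  obtain ⟨k, hk | hk⟩ := Int.even_or_odd' x.re
  · have : x.re ^ 2 = 2 * (2 * k ^ 2) := by rw [hk]; ring
    omega
  · have e1 : x.re ^ 2 = 4 * (k * (k + 1)) + 1 := by rw [hk]; ring
    obtain ⟨l, hl⟩ := Int.even_mul_succ_self k
    rw [hN, e1, hl]
    obtain ⟨d, hd | hd⟩ := Int.even_or_odd' x.im
    · have : x.im ^ 2 = 4 * d ^ 2 := by rw [hd]; ring
      omega
    · have : x.im ^ 2 = 4 * (d ^ 2 + d) + 1 := by rw [hd]; ring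
      omega

theorem natAbs_norm_natCast (p : ℕ) : (p : ZRootTwo).norm.natAbs = p ^ 2 := by
  rw [Zsqrtd.norm_natCast, Int.natAbs_mul, Int.natAbs_natCast, pow_two]

theorem natAbs_norm_eq_of_mul_eq {p : ℕ} (hp : p.Prime) {a b : ZRootTwo} (h : (p : ZRootTwo) = a * b)
    (ha : ¬ IsUnit a) (hb : ¬ IsUnit b) : a.norm.natAbs = p ∧ b.norm.natAbs = p := by
  have h' : a.norm.natAbs * b.norm.natAbs = p ^ 2 := by
    rw [← natAbs_norm_natCast, h, Zsqrtd.norm_mul, Int.natAbs_mul]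
  exact (hp.mul_eq_prime_sq_iff (fun h => ha (isUnit_of_natAbs_norm_eq_one h))
    (fun h => hb (isUnit_of_natAbs_norm_eq_one h))).mp h'

theorem prime_natCast_of_mod_eight_eq_five {p : ℕ} (hp : p.Prime) (h5 : p % 8 = 5) :
    Prime (p : ZRootTwo) := by
  refine Irreducible.prime ⟨fun hu => ?_, ?_⟩
  · have := Zsqrtd.norm_eq_one_iff.mpr hu
    rw [natAbs_norm_natCast] at this
    exact hp.ne_one ((pow_eq_one_iff.mp this).resolve_right two_ne_zero)
  · intro a b hab
    by_contra! hu
    have ha := (natAbs_norm_eq_of_mul_eq hp hab hu.1 hu.2).1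
    rcases norm_emod_eight (x := a) (by omega) with h | h <;> omega

theorem exists_factors_of_isSquare {q : ℕ} [hq : Fact q.Prime] (hq2 : q ≠ 2)
    (h2 : IsSquare (2 : ZMod q)) : ∃ a b : ZRootTwo, Prime a ∧ Prime b ∧ a.norm.natAbs = q ∧
      b.norm.natAbs = q ∧ ¬ Associated a b ∧ (q : ZRootTwo) = a * b := by
  obtain ⟨r, hr⟩ := h2
  have hq0 := hq.out
  have h20 : (2 : ZMod q) ≠ 0 := by
    intro h
    have h' : ((2 : ℕ) : ZMod q) = 0 := by exact_mod_cast h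
    rw [ZMod.natCast_eq_zero_iff] at h'
    exact hq2 ((Nat.prime_dvd_prime_iff_eq hq0 Nat.prime_two).mp h')
  have hr0 : r ≠ 0 := by
    rintro rfl
    exact h20 (by simpa using hr)
  have hnp : ¬ Irreducible (q : ZRootTwo) := by
    intro hi
    obtain ⟨r', rfl⟩ := ZMod.intCast_surjective r
    have hdvd : (q : ℤ) ∣ r' * r' - 2 := by
      rw [← ZMod.intCast_zmod_eq_zero_iff_dvd]
      push_cast
      rw [hr, sub_self]
    have hdvd' : (q : ZRootTwo) ∣ ⟨r', 1⟩ * ⟨r', -1⟩ := by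
      obtain ⟨c, hc⟩ := hdvd
      refine ⟨⟨c, 0⟩, ?_⟩
      ext
      · simp
        linarith
      · simp
    have hdv1 : ∀ z : ZRootTwo, (q : ZRootTwo) ∣ z → (q : ℤ) ∣ z.im := by
      intro z hz
      have : ((q : ℤ) : ZRootTwo) ∣ z := by rwa [Int.cast_natCast]
      exact ((Zsqrtd.intCast_dvd _ _).mp this).2
    have hq1 : ¬ (q : ℤ) ∣ 1 := by
      intro h
      exact hq0.one_lt.ne' (Nat.dvd_one.mp (by exact_mod_cast h))
    rcases hi.prime.dvd_or_dvd hdvd' with h | h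
    · exact hq1 (hdv1 _ h)
    · exact hq1 (by simpa using hdv1 _ h)
  have hnu : ¬ IsUnit (q : ZRootTwo) := by
    intro hu
    have := Zsqrtd.norm_eq_one_iff.mpr hu
    rw [natAbs_norm_natCast] at this
    exact hq0.ne_one ((pow_eq_one_iff.mp this).resolve_right two_ne_zero)
  rw [irreducible_iff] at hnp
  push Not at hnp
  obtain ⟨a, b, hab, ha, hb⟩ := hnp hnu
  obtain ⟨hNa, hNb⟩ := natAbs_norm_eq_of_mul_eq hq0 hab ha hb
  refine ⟨a, b, prime_of_prime_natAbs_norm (hNa ▸ hq0), prime_of_prime_natAbs_norm (hNb ▸ hq0),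
    hNa, hNb, ?_, hab⟩
  rintro ⟨u, rfl⟩
  have key : ∀ t : ZMod q, (2 : ZMod q) = t * t → (a.re : ZMod q) + a.im * t = 0 := by
    intro t ht
    set φ : ZRootTwo →+* ZMod q := Zsqrtd.lift ⟨t, by rw [← ht]; norm_num⟩ with hφ
    have h0 : φ a * (φ a * φ u) = 0 := by
      rw [← map_mul, ← map_mul, ← hab, map_natCast, ZMod.natCast_self]
    have h1 : φ a = 0 := by
      rcases mul_eq_zero.mp h0 with h | h
      · exact h
      · exact (mul_eq_zero.mp h).resolve_right (u.isUnit.map φ).ne_zero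
    simpa [hφ] using h1
  have k1 := key r hr
  have k2 := key (-r) (by rw [hr]; ring)
  have hre : (a.re : ZMod q) = 0 := by
    apply (mul_eq_zero.mp (_ : (2 : ZMod q) * a.re = 0)).resolve_left h20
    linear_combination k1 + k2
  have him : (a.im : ZMod q) = 0 := by
    rw [hre, zero_add] at k1
    exact (mul_eq_zero.mp k1).resolve_right hr0
  have : ((q : ℤ) : ZRootTwo) ∣ a := (Zsqrtd.intCast_dvd _ _).mpr
    ⟨(ZMod.intCast_zmod_eq_zero_iff_dvd _ q).mp hre, (ZMod.intCast_zmod_eq_zero_iff_dvd _ q).mp him⟩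
  obtain ⟨c, rfl⟩ := this
  rw [Int.cast_natCast, Zsqrtd.norm_mul, Int.natAbs_mul, natAbs_norm_natCast] at hNa
  have h4 : q ^ 2 ∣ q := Dvd.intro _ hNa
  have := Nat.le_of_dvd hq0.pos h4
  nlinarith [hq0.two_le]

end ZRootTwo

theorem Nat.squarefree_prod_of_injective {ι : Type*} [Fintype ι] {f : ι → ℕ} (hf : ∀ i, (f i).Prime)
    (hinj : Function.Injective f) : Squarefree (∏ i, f i) :=
  Finset.squarefree_prod_of_pairwise_isCoprime
    (fun i _ k _ hik => Nat.coprime_iff_isRelPrime.mp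
      ((Nat.coprime_primes (hf i) (hf k)).mpr (hinj.ne hik))) fun i _ => (hf i).prime.squarefree

namespace QuadraticOver

open NumberField

variable {K : Type*} [Field K] [NumberField K] [IsTotallyReal K]

open ZRootTwo

theorem card_two_torsion {t₁ t₂ : ℕ} {p : Fin t₁ → ℕ} {q : Fin t₂ → ℕ}
    (hp : ∀ i, (p i).Prime) (hq : ∀ j, (q j).Prime) (hpinj : Function.Injective p)
    (hqinj : Function.Injective q) (hpq : ∀ i j, p i ≠ q j) (hp5 : ∀ i, p i % 8 = 5)
    (hq1 : ∀ j, q j % 8 = 1) {n : ℕ} (hn : n = (∏ i, p i) * ∏ j, q j)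
    (D : QuadraticOver K (n * ⟨2, 1⟩)) (hfin : Module.finrank ℚ K = 4) :
    ((∀ j, quartSym (q j) 2 = (-1 : ℤ) ^ ((q j - 1) / 8)) →
        Nat.card {x : ClassGroup (𝓞 K) // x ^ 2 = 1} = 2 ^ (t₁ + 2 * t₂)) ∧
      ((∃ j, quartSym (q j) 2 ≠ (-1 : ℤ) ^ ((q j - 1) / 8)) →
        Nat.card {x : ClassGroup (𝓞 K) // x ^ 2 = 1} = 2 ^ (t₁ + 2 * t₂ - 1)) := by
  have hqF : ∀ j, Fact (q j).Prime := fun j => ⟨hq j⟩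
  have hq2 : ∀ j, q j ≠ 2 := fun j h => by have := hq1 j; omega
  have hsq2 : ∀ j, IsSquare (2 : ZMod (q j)) := fun j =>
    (ZMod.exists_sq_eq_two_iff (hq2 j)).mpr (.inl (hq1 j))
  have hsqi : ∀ j, ∃ i : ZMod (q j), i ^ 2 = -1 := fun j => by
    obtain ⟨i, hi⟩ := (ZMod.exists_sq_eq_neg_one_iff (p := q j)).mpr (by have := hq1 j; omega)
    exact ⟨i, by rw [hi, pow_two]⟩
  -- the rational primes dividing `n`
  have hnsf : Squarefree n := by
    have : n = ∏ i, Sum.elim p q i := by rw [hn, Fintype.prod_sum_type]; rfl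
    rw [this]
    refine Nat.squarefree_prod_of_injective ?_ (hpinj.sumElim hqinj hpq)
    rintro (i | j)
    · exact hp i
    · exact hq j
  have hnpos : 0 < n := Nat.pos_of_ne_zero hnsf.ne_zero
  have hdiv : ∀ l, l.Prime → l ∣ n → (∃ i, l = p i) ∨ ∃ j, l = q j := by
    intro l hl hln
    rw [hn, hl.dvd_mul] at hln
    rcases hln with h | h
    · obtain ⟨i, -, hi⟩ := (hl.prime.dvd_finsetProd_iff _).mp h
      exact .inl ⟨i, (Nat.prime_dvd_prime_iff_eq hl (hp i)).mp hi⟩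
    · obtain ⟨i, -, hi⟩ := (hl.prime.dvd_finsetProd_iff _).mp h
      exact .inr ⟨i, (Nat.prime_dvd_prime_iff_eq hl (hq i)).mp hi⟩
  have hmod : ∀ l, l.Prime → l ∣ n → l % 4 = 1 := by
    intro l hl hln
    rcases hdiv l hl hln with ⟨i, rfl⟩ | ⟨j, rfl⟩
    · have := hp5 i
      omega
    · have := hq1 j
      omega
  -- the factorisation of `d`
  choose a b ha hb hNa hNb hab hqab using fun j => exists_factors_of_isSquare (hq2 j) (hsq2 j)
  set P : Unit ⊕ (Fin t₁ ⊕ (Fin t₂ ⊕ Fin t₂)) → ZRootTwo :=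
    Sum.elim (fun _ => Zsqrtd.sqrtd) (Sum.elim (fun i => (p i : ZRootTwo)) (Sum.elim a b)) with hPdef
  have hP : ∀ i, Prime (P i) := by
    rintro (_ | i | j | j)
    · exact prime_sqrtd
    · exact prime_natCast_of_mod_eight_eq_five (hp i) (hp5 i)
    · exact ha j
    · exact hb j
  have hN2 : (Zsqrtd.sqrtd : ZRootTwo).norm.natAbs = 2 := rfl
  have hP' : ∀ i k, Associated (P i) (P k) → i = k := by
    intro i k h
    have hN := natAbs_norm_eq_of_associated h
    have hpp : ∀ (i : Fin t₁) (l : ℕ), l.Prime → p i ^ 2 ≠ l := by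
      rintro i l hl rfl
      exact Nat.Prime.not_prime_pow le_rfl hl
    rcases i with i | i | i | i <;> rcases k with k | k | k | k <;>
      simp only [hPdef, Sum.elim_inl, Sum.elim_inr, natAbs_norm_natCast, hNa, hNb, hN2] at h hN
    · rfl
    · exact absurd hN.symm (hpp k 2 Nat.prime_two)
    · exact absurd hN.symm (hq2 k)
    · exact absurd hN.symm (hq2 k)
    · exact absurd hN (hpp i 2 Nat.prime_two)
    · rw [hpinj (Nat.pow_left_injective two_ne_zero hN)]
    · exact absurd hN (hpp i _ (hq k))
    · exact absurd hN (hpp i _ (hq k))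
    · exact absurd hN (hq2 i)
    · exact absurd hN.symm (hpp k _ (hq i))
    · rw [hqinj hN]
    · obtain rfl := hqinj hN
      exact absurd h (hab i)
    · exact absurd hN (hq2 i)
    · exact absurd hN.symm (hpp k _ (hq i))
    · obtain rfl := hqinj hN
      exact absurd h.symm (hab i)
    · rw [hqinj hN]
  have h21 : (⟨2, 1⟩ : ZRootTwo) = Zsqrtd.sqrtd * eps := by ext <;> simp [eps]
  have hd : Associated ((n : ZRootTwo) * ⟨2, 1⟩) (∏ i, P i) := by
    have : ∏ i, P i = Zsqrtd.sqrtd * (n : ZRootTwo) := by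
      rw [Fintype.prod_sum_type, Fintype.prod_sum_type, Fintype.prod_sum_type, hn]
      simp only [hPdef, Sum.elim_inl, Sum.elim_inr, Finset.univ_unique, Finset.prod_singleton]
      push_cast
      rw [← Finset.prod_mul_distrib]
      simp only [hqab]
    rw [this, h21]
    rw [← mul_assoc, mul_comm (n : ZRootTwo)]
    exact associated_mul_unit_left _ _ isUnit_eps
  have h2 : ∀ ρ : ZRootTwo, Prime ρ → ρ ∣ 2 → ρ ∣ (n : ZRootTwo) * ⟨2, 1⟩ := by
    intro ρ hρ h
    have e : (2 : ZRootTwo) = Zsqrtd.sqrtd ^ 2 := by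
      rw [pow_two]
      ext <;> simp
    rw [e] at h
    rw [h21]
    exact ((hρ.dvd_of_dvd_pow h).mul_right _).mul_left _
  have hneg := D.exists_norm_eq_neg_one hnsf fun l hl hln => by have := hmod l hl hln; omega
  have hcard : Fintype.card (Unit ⊕ (Fin t₁ ⊕ (Fin t₂ ⊕ Fin t₂))) = t₁ + 2 * t₂ + 1 := by
    simp only [Fintype.card_sum, Fintype.card_unit, Fintype.card_fin]
    ring
  constructor
  · intro hall
    have h3 : ¬ 3 ∣ n := fun h => by have := hmod 3 Nat.prime_three h; omega
    have h7 : ¬ 7 ∣ n := fun h => by have := hmod 7 (by norm_num) h; omega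
    obtain ⟨s, hs⟩ := exists_sq_sub_eps hnsf fun l hl hln => by
      rcases hdiv l hl hln with ⟨i, rfl⟩ | ⟨j, rfl⟩
      · have : Fact (p i).Prime := ⟨hl⟩
        exact exists_sq_sub_eps_of_mod_eight_eq_five (hp5 i)
      · obtain ⟨i, hi⟩ := hsqi j
        refine exists_sq_sub_eps_of_isSquare (hq2 j) hi ?_ (hsq2 j)
        rw [isSquare_one_add_iff (hq1 j) hi, ← quartSym_eq_iff (hq1 j) (hsq2 j)]
        exact hall j
    have := D.card_two_torsion_of_norm hfin hP hP' hd h2 hneg (D.exists_norm_eq_eps hnpos h3 h7 hs)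
    rw [hcard] at this
    rw [pow_succ] at this
    omega
  · rintro ⟨j, hj⟩
    have hnot : ¬ ∃ y, y * D.σ y = D.j eps := by
      intro hy
      apply hj
      obtain ⟨i, hi⟩ := hsqi j
      obtain ⟨r, hr⟩ := hsq2 j
      rw [quartSym_eq_iff (hq1 j) (hsq2 j), ← isSquare_one_add_iff (hq1 j) hi]
      refine isSquare_iff_of_two_mul (hq2 j) hi (r := r) (by rw [hr, pow_two]) ?_
      have hsf : Squarefree ((n : ZRootTwo) * ⟨2, 1⟩) :=
        (squarefree_prod_of_primes hP hP' Finset.univ).squarefree_of_dvd hd.dvd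
      have hqn : q j ∣ n := by
        rw [hn]
        exact (Finset.dvd_prod_of_mem q (Finset.mem_univ j)).mul_left _
      have := D.isSquare_of_norm hsf (Zsqrtd.lift ⟨r, by rw [← hr]; norm_num⟩ : ZRootTwo →+* ZMod (q j))
        (by rw [map_mul, map_natCast, (ZMod.natCast_eq_zero_iff _ _).mpr hqn, zero_mul]) hy
      simpa [eps] using this
    have := D.card_two_torsion_of_not_norm hfin hP hP' hd h2 hneg hnot
    have hpos : 0 < t₂ := j.pos
    obtain ⟨m, hm⟩ : ∃ m, t₁ + 2 * t₂ = m + 1 := ⟨t₁ + 2 * t₂ - 1, by omega⟩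
    rw [hcard, hm, pow_succ, pow_succ] at this
    rw [hm, Nat.add_sub_cancel]
    omega

end QuadraticOver

section LegendreSymbol

theorem mod_eight_eq_one_of_legSym {q : ℕ} (hq : q.Prime) (h4 : q % 4 = 1) (h : legSym q 2 = 1) :
    q % 8 = 1 := by
  have := Fact.mk hq
  have hq2 : q ≠ 2 := by rintro rfl; omega
  have hpow : (2 : ZMod q) ^ ((q - 1) / 2) = 1 := by
    by_contra hne
    unfold legSym at h
    push_cast at h
    rw [if_neg hne] at h
    split_ifs at h
    exact zero_ne_one h
  have h20 : (2 : ZMod q) ≠ 0 := by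
    intro h0
    rw [h0, zero_pow (by have := hq.two_le; omega)] at hpow
    exact zero_ne_one hpow
  rw [show (q - 1) / 2 = q / 2 by omega, ← ZMod.euler_criterion q h20,
    ZMod.exists_sq_eq_two_iff hq2] at hpow
  omega

theorem mod_eight_eq_five_of_legSym {p : ℕ} (hp : p.Prime) (h4 : p % 4 = 1)
    (h : legSym p 2 = -1) : p % 8 = 5 := by
  have := Fact.mk hp
  have hp2 : p ≠ 2 := by rintro rfl; omega
  by_contra h5
  have h1 : IsSquare (2 : ZMod p) := (ZMod.exists_sq_eq_two_iff hp2).mpr (by omega)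
  have h20 : (2 : ZMod p) ≠ 0 := by
    intro h0
    have h' : ((2 : ℕ) : ZMod p) = 0 := by exact_mod_cast h0
    rw [ZMod.natCast_eq_zero_iff] at h'
    exact hp2 ((Nat.prime_dvd_prime_iff_eq hp Nat.prime_two).mp h')
  rw [ZMod.euler_criterion p h20, show p / 2 = (p - 1) / 2 by omega] at h1
  unfold legSym at h
  push_cast at h
  rw [if_pos h1] at h
  omega

end LegendreSymbol

section Presentation

open Polynomial NumberField

/-- The minimal polynomial of `√(n(2 + √2))`. -/
noncomputable def quarticPoly (n : ℕ) : ℤ[X] :=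
  X ^ 4 + (C (-4 * (n : ℤ)) * X ^ 2 + C (2 * (n : ℤ) ^ 2))

theorem natDegree_quarticPoly_lt (n : ℕ) :
    (C (-4 * (n : ℤ)) * X ^ 2 + C (2 * (n : ℤ) ^ 2)).degree < ((4 : ℕ) : WithBot ℕ) := by
  refine lt_of_le_of_lt (b := 2) ?_ (by norm_num)
  compute_degree

theorem monic_quarticPoly (n : ℕ) : (quarticPoly n).Monic :=
  monic_X_pow_add (natDegree_quarticPoly_lt n)

theorem natDegree_quarticPoly (n : ℕ) : (quarticPoly n).natDegree = 4 := by
  unfold quarticPoly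
  compute_degree!

theorem irreducible_quarticPoly {n : ℕ} (hn : Odd n) : Irreducible (quarticPoly n) := by
  have hprime : (Ideal.span {(2 : ℤ)}).IsPrime :=
    (Ideal.span_singleton_prime two_ne_zero).mpr Int.prime_two
  refine Polynomial.IsEisensteinAt.irreducible (𝓟 := Ideal.span {(2 : ℤ)}) ⟨?_, ?_, ?_⟩ hprime
    (monic_quarticPoly n).isPrimitive (by rw [natDegree_quarticPoly]; norm_num)
  · rw [(monic_quarticPoly n).leadingCoeff, ← Ideal.ne_top_iff_one]
    exact hprime.ne_top
  · intro k hk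
    rw [natDegree_quarticPoly] at hk
    rw [Ideal.mem_span_singleton]
    simp only [quarticPoly, coeff_add, coeff_X_pow, coeff_C_mul, coeff_C, if_neg hk.ne]
    refine dvd_add (dvd_zero _) (dvd_add (Dvd.dvd.mul_right ⟨-2 * (n : ℤ), by ring⟩ _) ?_)
    split_ifs
    · exact dvd_mul_right _ _
    · exact dvd_zero _
  · rw [Ideal.span_singleton_pow, Ideal.mem_span_singleton]
    simp only [quarticPoly, coeff_add, coeff_X_pow, coeff_C_mul, coeff_C_zero]
    obtain ⟨k, rfl⟩ := hn
    rintro ⟨l, hl⟩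
    push_cast at hl
    ring_nf at hl
    omega

theorem aeval_quarticPoly {K : Type*} [Field K] (n : ℕ) (x : K) :
    aeval x (quarticPoly n) = x ^ 4 - 4 * n * x ^ 2 + 2 * n ^ 2 := by
  rw [quarticPoly, map_add, map_add, map_mul, map_pow, map_pow, aeval_X, aeval_C, aeval_C,
    eq_intCast, eq_intCast]
  push_cast
  ring

theorem minpoly_eq_quarticPoly {K : Type*} [Field K] [CharZero K] [Algebra ℚ K] {n : ℕ} (hn : Odd n)
    {x : K} (hx : x ^ 4 - 4 * n * x ^ 2 + 2 * n ^ 2 = 0) :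
    minpoly ℚ x = (quarticPoly n).map (algebraMap ℤ ℚ) := by
  symm
  refine minpoly.eq_of_irreducible_of_monic ?_ ?_ ((monic_quarticPoly n).map _)
  · exact ((monic_quarticPoly n).irreducible_iff_irreducible_map_fraction_map).mp
      (irreducible_quarticPoly hn)
  · rw [aeval_map_algebraMap, aeval_quarticPoly, hx]

variable {K : Type*} [Field K] [NumberField K]

theorem exists_sq_eq_two {n : ℕ} (hn : n ≠ 0) {x : K}
    (hx : x ^ 4 - 4 * n * x ^ 2 + 2 * n ^ 2 = 0) : (x ^ 2 / n - 2) * (x ^ 2 / n - 2) = 2 := by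
  have : (n : K) ≠ 0 := by exact_mod_cast hn
  field_simp
  linear_combination hx

theorem exists_algEquiv_neg {n : ℕ} (hn : Odd n) (pb : PowerBasis ℚ K)
    (h : pb.gen ^ 4 - 4 * n * pb.gen ^ 2 + 2 * n ^ 2 = 0) :
    ∃ σ : K ≃ₐ[ℚ] K, σ pb.gen = -pb.gen := by
  have hroot : aeval (-pb.gen) (minpoly ℚ pb.gen) = 0 := by
    rw [minpoly_eq_quarticPoly hn h, aeval_map_algebraMap, aeval_quarticPoly]
    linear_combination h
  set f : K →ₐ[ℚ] K := pb.lift (-pb.gen) hroot with hf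
  have hfg : f pb.gen = -pb.gen := pb.lift_gen _ _
  have hff : f.comp f = AlgHom.id ℚ K := pb.algHom_ext (by simp [hfg])
  exact ⟨AlgEquiv.ofAlgHom f f hff hff, hfg⟩

theorem exists_mul_eq_add {n : ℕ} (pb : PowerBasis ℚ K) (j : ZRootTwo →+* K)
    (h : pb.gen ^ 2 = j (n * ⟨2, 1⟩)) (x : K) :
    ∃ a b c : ZRootTwo, c ≠ 0 ∧ x * j c = j a + j b * pb.gen := by
  obtain ⟨f, rfl⟩ := pb.exists_eq_aeval' x
  induction f using Polynomial.induction_on with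
  | C q =>
    refine ⟨(q.num : ZRootTwo), 0, (q.den : ZRootTwo), ?_, ?_⟩
    · exact_mod_cast q.den_ne_zero
    · have h1 : (q.den : K) ≠ 0 := by exact_mod_cast q.den_ne_zero
      rw [aeval_C, map_zero, map_natCast, map_intCast, zero_mul, add_zero, eq_ratCast]
      nth_rw 1 [← Rat.num_div_den q]
      push_cast
      field_simp
  | add f g hf hg =>
    obtain ⟨a, b, c, hc, e⟩ := hf
    obtain ⟨a', b', c', hc', e'⟩ := hg
    refine ⟨a * c' + a' * c, b * c' + b' * c, c * c', mul_ne_zero hc hc', ?_⟩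
    simp only [map_add, map_mul]
    linear_combination (j c') * e + (j c) * e'
  | monomial k q ih =>
    obtain ⟨a, b, c, hc, e⟩ := ih
    refine ⟨b * (n * ⟨2, 1⟩), a, c, hc, ?_⟩
    rw [pow_succ, ← mul_assoc, map_mul, aeval_X, map_mul j b, ← h]
    linear_combination pb.gen * e

theorem exists_quadraticOver {n : ℕ} (hn : Odd n) (pb : PowerBasis ℚ K)
    (h : pb.gen ^ 4 - 4 * n * pb.gen ^ 2 + 2 * n ^ 2 = 0) :
    Nonempty (QuadraticOver K (n * ⟨2, 1⟩)) := by
  have hn0 : n ≠ 0 := by rintro rfl; simp at hn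
  have hnK : (n : K) ≠ 0 := by exact_mod_cast hn0
  obtain ⟨σ, hσ⟩ := exists_algEquiv_neg hn pb h
  set s : K := pb.gen ^ 2 / n - 2 with hs
  have hs2 : s * s = 2 := exists_sq_eq_two hn0 h
  set j : ZRootTwo →+* K := Zsqrtd.lift ⟨s, by rw [hs2]; norm_num⟩ with hj
  have hjr : ∀ r : ZRootTwo, j r = r.re + r.im * s := fun r => rfl
  have hσs : σ s = s := by
    rw [hs, map_sub, map_div₀, map_pow, hσ, map_natCast, map_ofNat, neg_sq]
  have hσj : ∀ r, σ (j r) = j r := fun r => by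
    rw [hjr, map_add, map_mul, map_intCast, map_intCast, hσs]
  have hθ2 : pb.gen ^ 2 = j (n * ⟨2, 1⟩) := by
    rw [map_mul, map_natCast, hjr, hs]
    push_cast
    field_simp
    ring
  have hθ0 : pb.gen ≠ 0 := by
    intro h0
    rw [h0] at h
    simp [hnK] at h
  refine ⟨⟨σ.toRingEquiv, j, pb.gen, fun x => ?_, hσj, hσ, hθ2, hθ0, fun x hx => ?_⟩⟩
  · have : (σ.trans σ : K →ₐ[ℚ] K) = AlgHom.id ℚ K := pb.algHom_ext (by simp [hσ])
    exact DFunLike.congr_fun this x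
  · obtain ⟨a, b, c, hc, e⟩ := exists_mul_eq_add pb j hθ2 x
    refine ⟨a, c, hc, ?_⟩
    have hx' : σ x = x := hx
    have e' := congrArg σ e
    rw [map_mul, map_add, map_mul, hσj, hσj, hσj, hσ, hx'] at e'
    linear_combination (e + e') / 2

theorem isTotallyReal_of_powerBasis {n : ℕ} (hn : n ≠ 0) (pb : PowerBasis ℚ K)
    (h : pb.gen ^ 4 - 4 * n * pb.gen ^ 2 + 2 * n ^ 2 = 0) : IsTotallyReal K := by
  have hreal : ∀ (z : ℂ) (r : ℝ), 0 ≤ r → z ^ 2 = r → ∃ t : ℝ, z = t := by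
    intro z r hr hz
    have : z ^ 2 = ((√r : ℝ) : ℂ) ^ 2 := by
      rw [hz, ← Complex.ofReal_pow, Real.sq_sqrt hr]
    rcases sq_eq_sq_iff_eq_or_eq_neg.mp this with h | h
    · exact ⟨_, h⟩
    · exact ⟨-√r, by rw [h]; push_cast; rfl⟩
  refine ⟨fun v => ?_⟩
  rw [InfinitePlace.isReal_iff]
  set φ := v.embedding with hφ
  have hnC : (n : ℂ) ≠ 0 := by exact_mod_cast hn
  obtain ⟨t, ht⟩ : ∃ t : ℝ, φ pb.gen = t := by
    have e := congrArg φ h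
    simp only [map_add, map_sub, map_mul, map_pow, map_ofNat, map_natCast, map_zero] at e
    have hw : (φ pb.gen ^ 2 / n - 2) ^ 2 = ((2 : ℝ) : ℂ) := by
      push_cast
      field_simp
      linear_combination e
    obtain ⟨w, hw'⟩ := hreal _ 2 zero_le_two hw
    have hw2 : w ^ 2 = 2 := by
      rw [hw'] at hw
      exact_mod_cast hw
    refine hreal _ (n * (2 + w)) ?_ ?_
    · have : 0 ≤ 2 + w := by nlinarith
      positivity
    · push_cast
      rw [← hw']
      field_simp
      ring
  have hext : (φ.toRatAlgHom : K →ₐ[ℚ] ℂ) = (ComplexEmbedding.conjugate φ).toRatAlgHom :=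
    pb.algHom_ext (by simp [ht])
  ext x
  exact (DFunLike.congr_fun hext x).symm

end Presentation

section RealQuartic

open Polynomial NumberField

theorem sqrt_quartic_relation (n : ℕ) :
    √((n : ℝ) * (1 + √2) * √2) ^ 4 - 4 * n * √((n : ℝ) * (1 + √2) * √2) ^ 2 + 2 * n ^ 2 = 0 := by
  have h2 : √(2 : ℝ) ^ 2 = 2 := Real.sq_sqrt zero_le_two
  rw [show √((n : ℝ) * (1 + √2) * √2) ^ 4 = (√((n : ℝ) * (1 + √2) * √2) ^ 2) ^ 2 by ring,
    Real.sq_sqrt (by positivity)]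
  linear_combination (n ^ 2 * (√2 ^ 2 + 2 * √2 - 1) : ℝ) * h2

/-- The power basis of `ℚ(√(n(1 + √2)√2))` given by its defining square root. -/
theorem exists_powerBasis (n : ℕ) (K : IntermediateField ℚ ℝ)
    (hK : K = IntermediateField.adjoin ℚ ({√((n : ℝ) * (1 + √2) * √2)} : Set ℝ)) :
    ∃ pb : PowerBasis ℚ K, pb.gen ^ 4 - 4 * n * pb.gen ^ 2 + 2 * n ^ 2 = 0 := by
  subst hK
  set t := √((n : ℝ) * (1 + √2) * √2) with ht
  have hrel : t ^ 4 - 4 * n * t ^ 2 + 2 * n ^ 2 = 0 := sqrt_quartic_relation n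
  have hintegral : IsIntegral ℚ t := by
    refine ⟨(quarticPoly n).map (algebraMap ℤ ℚ), (monic_quarticPoly n).map _, ?_⟩
    rw [← aeval_def, aeval_map_algebraMap, aeval_quarticPoly, hrel]
  refine ⟨IntermediateField.adjoin.powerBasis hintegral, ?_⟩
  apply Subtype.ext
  rw [IntermediateField.adjoin.powerBasis_gen]
  push_cast
  exact hrel

theorem odd_of_eq_prod {t₁ t₂ : ℕ} {p : Fin t₁ → ℕ} {q : Fin t₂ → ℕ}
    (hp4 : ∀ i, p i % 4 = 1) (hq4 : ∀ j, q j % 4 = 1) : Odd ((∏ i, p i) * ∏ j, q j) := by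
  rw [Nat.odd_mul]
  exact ⟨Finset.prod_induction _ Odd (fun _ _ => Odd.mul) odd_one
      fun i _ => Nat.odd_iff.mpr (by have := hp4 i; omega),
    Finset.prod_induction _ Odd (fun _ _ => Odd.mul) odd_one
      fun j _ => Nat.odd_iff.mpr (by have := hq4 j; omega)⟩

end RealQuartic

/-- `l = 2`, `n = p₁⋯p_{t₁}·q₁⋯q_{t₂}` a product of `t₁ + t₂ ≥ 1`
distinct primes `≡ 1 (mod 4)` with `(2/pᵢ) = -1` and `(2/qⱼ) = 1`.
If `(2/qⱼ)₄ = (qⱼ/2)₄` for all `j` then `r₂(H) = t₁ + 2t₂`;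
if `(2/qⱼ)₄ ≠ (qⱼ/2)₄` for some `j` then `r₂(H) = t₁ + 2t₂ - 1`. -/
theorem stmt_9
    (t₁ t₂ : ℕ) (ht : 1 ≤ t₁ + t₂)
    (p : Fin t₁ → ℕ) (q : Fin t₂ → ℕ)
    (hpprime : ∀ i, (p i).Prime) (hqprime : ∀ j, (q j).Prime)
    (hpinj : Function.Injective p) (hqinj : Function.Injective q)
    (hpq : ∀ i j, p i ≠ q j)
    (hp4 : ∀ i, p i % 4 = 1) (hq4 : ∀ j, q j % 4 = 1)
    (hpleg : ∀ i, legSym (p i) 2 = -1) (hqleg : ∀ j, legSym (q j) 2 = 1)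
    (n : ℕ) (hn : n = (∏ i, p i) * ∏ j, q j)
    (K : IntermediateField ℚ ℝ)
    (hK : K = IntermediateField.adjoin ℚ
      ({Real.sqrt ((n : ℝ) * ((1 : ℝ) + Real.sqrt 2) * Real.sqrt 2)} : Set ℝ))
    [NumberField K] :
    ((∀ j, quartSym (q j) 2 = (-1 : ℤ) ^ ((q j - 1) / 8)) →
        twoTorsCard K = 2 ^ (t₁ + 2 * t₂)) ∧
      ((∃ j, quartSym (q j) 2 ≠ (-1 : ℤ) ^ ((q j - 1) / 8)) →
        twoTorsCard K = 2 ^ (t₁ + 2 * t₂ - 1)) := by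
  have hodd : Odd n := hn ▸ odd_of_eq_prod hp4 hq4
  obtain ⟨pb, h⟩ := exists_powerBasis n K hK
  have hfin : Module.finrank ℚ K = 4 := by
    rw [pb.finrank, ← pb.natDegree_minpoly, minpoly_eq_quarticPoly hodd h,
      (monic_quarticPoly n).natDegree_map, natDegree_quarticPoly]
  have := isTotallyReal_of_powerBasis hodd.pos.ne' pb h
  obtain ⟨D⟩ := exists_quadraticOver hodd pb h
  unfold twoTorsCard
  exact D.card_two_torsion hpprime hqprime hpinj hqinj hpq
    (fun i => mod_eight_eq_five_of_legSym (hpprime i) (hp4 i) (hpleg i))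
    (fun j => mod_eight_eq_one_of_legSym (hqprime j) (hq4 j) (hqleg j)) hn hfin
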